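/- Let H be a finite loopless multigraph with |V(H)| ≥ 2 and |E(H)| ≥ 2, let G_H be a body-bar graph induced by H, let d ≥ 1, and let u,v ∈ V(G_H). Then {u,v} is globally d-linked in G_H if and only if either uv ∈ E(G_H) or there is an ℛ_d-connected subgraph G′ of G_H with u,v ∈ V(G′) and κ_{G′}(u,v) ≥ d+1. -/

import Mathlib

open scoped BigOperators

noncomputable section

namespace Rigidity

variable {V : Type*}

/-- Euclidean distance between two points of `ℝ^d` (given as coordinate functions). -/
def eDist {d : ℕ} (x y : Fin d → ℝ) : ℝ := Real.sqrt (∑ i, (x i - y i) ^ 2)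

/-- Two frameworks `(G,p)` and `(G,q)` are equivalent if corresponding edge lengths agree. -/
def Equivalent {d : ℕ} (G : SimpleGraph V) (p q : V → Fin d → ℝ) : Prop :=
  ∀ u v : V, G.Adj u v → eDist (p u) (p v) = eDist (q u) (q v)

/-- Two placements are congruent if all pairwise distances agree. -/
def Congruent {d : ℕ} (p q : V → Fin d → ℝ) : Prop :=
  ∀ u v : V, eDist (p u) (p v) = eDist (q u) (q v)

/-- A placement is generic if the multiset of its coordinates is algebraically
independent over `ℚ`. -/
def Generic {d : ℕ} (p : V → Fin d → ℝ) : Prop :=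
  AlgebraicIndependent ℚ (fun vi : V × Fin d => p vi.1 vi.2)

/-- `{u,v}` is globally linked in the framework `(G,p)`. -/
def GloballyLinkedIn {d : ℕ} (G : SimpleGraph V) (p : V → Fin d → ℝ) (u v : V) : Prop :=
  ∀ q : V → Fin d → ℝ, Equivalent G p q → eDist (q u) (q v) = eDist (p u) (p v)

/-- `{u,v}` is globally `d`-linked in `G`. -/
def GloballyLinked (d : ℕ) (G : SimpleGraph V) (u v : V) : Prop :=
  ∀ p : V → Fin d → ℝ, Generic p → GloballyLinkedIn G p u v

/-- The framework `(G,p)` is rigid. -/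
def RigidFramework {d : ℕ} (G : SimpleGraph V) (p : V → Fin d → ℝ) : Prop :=
  ∃ ε > (0:ℝ), ∀ q : V → Fin d → ℝ, Equivalent G p q →
    (∀ v, eDist (p v) (q v) < ε) → Congruent p q

/-- `G` is `d`-rigid: every generic framework of `G` in `ℝ^d` is rigid. -/
def IsRigidGraph (d : ℕ) (G : SimpleGraph V) : Prop :=
  ∀ p : V → Fin d → ℝ, Generic p → RigidFramework G p

/-- The framework `(G,p)` is globally rigid. -/
def GloballyRigidFramework {d : ℕ} (G : SimpleGraph V) (p : V → Fin d → ℝ) : Prop :=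
  ∀ q : V → Fin d → ℝ, Equivalent G p q → Congruent p q

/-- The row of the rigidity matrix corresponding to the (ordered) edge `(u,v)`. -/
def edgeVec [DecidableEq V] {d : ℕ} (p : V → Fin d → ℝ) (u v : V) : V × Fin d → ℝ :=
  fun wi => if wi.1 = u then p u wi.2 - p v wi.2
            else if wi.1 = v then p v wi.2 - p u wi.2 else 0

/-- The rank of the set of rows of the rigidity matrix of `(·,p)` indexed by `F`. -/
def rankAt [DecidableEq V] (d : ℕ) (p : V → Fin d → ℝ) (F : Set (Sym2 V)) : ℕ :=
  Module.finrank ℝ (Submodule.span ℝ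
    {x : V × Fin d → ℝ | ∃ u v : V, s(u, v) ∈ F ∧ x = edgeVec p u v})

/-- `r_d(F)`: the rank of the set of rows indexed by `F` of the rigidity matrix of a
generic framework, equivalently the maximum of this rank over all placements. -/
def rd [DecidableEq V] (d : ℕ) (F : Set (Sym2 V)) : ℕ :=
  sSup {n : ℕ | ∃ p : V → Fin d → ℝ, n = rankAt d p F}

/-- An edge set is `ℛ_d`-independent if its rank equals its cardinality. -/
def RdIndep [DecidableEq V] (d : ℕ) (F : Set (Sym2 V)) : Prop := rd d F = F.ncard

/-- An `ℛ_d`-circuit: not independent, but every proper subset is independent. -/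
def RdCircuit [DecidableEq V] (d : ℕ) (C : Set (Sym2 V)) : Prop :=
  ¬ RdIndep d C ∧ ∀ C' : Set (Sym2 V), C' ⊂ C → RdIndep d C'

/-- An `ℛ_d`-circuit of the graph `G`. -/
def RdCircuitOf [DecidableEq V] (d : ℕ) (G : SimpleGraph V) (C : Set (Sym2 V)) : Prop :=
  C ⊆ G.edgeSet ∧ RdCircuit d C

/-- `F` is (the edge set of) an `ℛ_d`-component of `G`: an equivalence class of the
relation "`e = f` or some `ℛ_d`-circuit of `G` contains both `e` and `f`". -/
def IsRdComponent [DecidableEq V] (d : ℕ) (G : SimpleGraph V) (F : Set (Sym2 V)) : Prop :=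
  ∃ e ∈ G.edgeSet, F = {f | f ∈ G.edgeSet ∧
    (e = f ∨ ∃ C, RdCircuitOf d G C ∧ e ∈ C ∧ f ∈ C)}

/-- The set of vertices covered by an edge set. -/
def vertexSpan (F : Set (Sym2 V)) : Set V := {v | ∃ e ∈ F, v ∈ e}

/-- A nonempty edge set is `ℛ_d`-connected if any two of its edges lie on a common
`ℛ_d`-circuit contained in it (or are equal). -/
def RdConnectedSet [DecidableEq V] (d : ℕ) (F : Set (Sym2 V)) : Prop :=
  F.Nonempty ∧ ∀ e ∈ F, ∀ f ∈ F, e = f ∨ ∃ C, C ⊆ F ∧ RdCircuit d C ∧ e ∈ C ∧ f ∈ C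

/-- A graph (with at least one edge) is `ℛ_d`-connected. -/
def RdConnected [DecidableEq V] (d : ℕ) (H : SimpleGraph V) : Prop :=
  RdConnectedSet d H.edgeSet

/-- `e` is an `ℛ_d`-bridge of `G`: `r_d(E ∖ {e}) = r_d(E) − 1`. -/
def IsRdBridge [DecidableEq V] (d : ℕ) (G : SimpleGraph V) (e : Sym2 V) : Prop :=
  e ∈ G.edgeSet ∧ rd d (G.edgeSet \ {e}) + 1 = rd d G.edgeSet

/-- `G + uv`. -/
def addEdge (G : SimpleGraph V) (u v : V) : SimpleGraph V :=
  G ⊔ SimpleGraph.fromEdgeSet {s(u, v)}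

/-- `{u,v}` is `d`-linked in `G` if `r_d(G+uv) = r_d(G)`. -/
def IsLinked [DecidableEq V] (d : ℕ) (G : SimpleGraph V) (u v : V) : Prop :=
  rd d (addEdge G u v).edgeSet = rd d G.edgeSet

/-- There exist `k` pairwise internally vertex-disjoint `u`–`v` paths in `H`
(i.e. `κ_H(u,v) ≥ k`). -/
def InternallyDisjointPaths (H : SimpleGraph V) (u v : V) (k : ℕ) : Prop :=
  ∃ P : Fin k → H.Walk u v, (∀ i, (P i).IsPath) ∧
    ∀ i j, i ≠ j → ∀ w, w ∈ (P i).support → w ∈ (P j).support → w = u ∨ w = v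

/-- An unordered pair forming a 2-separator: two distinct vertices whose deletion
disconnects the graph. -/
def TwoSepPair (H : SimpleGraph V) (e : Sym2 V) : Prop :=
  ¬ e.IsDiag ∧ ¬ (H.induce {v | v ∉ e}).Connected

/-- The augmented graph `Ĥ`: add an edge for every 2-separator. -/
def aug (H : SimpleGraph V) : SimpleGraph V :=
  H ⊔ SimpleGraph.fromEdgeSet {e | TwoSepPair H e}

/-- A subgraph is 3-connected: at least 4 vertices, and deleting fewer than 3
vertices leaves it connected. -/
def IsThreeConnectedSubgraph {G : SimpleGraph V} (J : G.Subgraph) : Prop :=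
  4 ≤ J.verts.ncard ∧ ∀ S : Set V, S.ncard < 3 → (J.deleteVerts S).coe.Connected

/-- A 3-block of `H`: a maximal 3-connected subgraph of the augmented graph `Ĥ`. -/
def IsThreeBlock (H : SimpleGraph V) (J : (aug H).Subgraph) : Prop :=
  IsThreeConnectedSubgraph J ∧
    ∀ J' : (aug H).Subgraph, IsThreeConnectedSubgraph J' → J ≤ J' → J = J'

/-- `h_H(e)`: the number of 3-blocks of `H` containing both vertices of `e`. -/
def numBlocksOn (H : SimpleGraph V) (e : Sym2 V) : ℕ :=
  {J : (aug H).Subgraph | IsThreeBlock H J ∧ ∀ v ∈ e, v ∈ J.verts}.ncard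

open Classical in
/-- `k(H) = Σ (h_H(ab) − 1)` over all 2-separators `{a,b}` of `H`. -/
def kGraph [Fintype V] [DecidableEq V] (H : SimpleGraph V) : ℕ :=
  ∑ e : Sym2 V, if TwoSepPair H e then numBlocksOn H e - 1 else 0

/-- The graph of an `ℛ₂`-component, on its own vertex set. -/
def componentGraph [DecidableEq V] (F : Set (Sym2 V)) :
    SimpleGraph (vertexSpan F) :=
  (SimpleGraph.fromEdgeSet F).induce (vertexSpan F)

/-- `X` is the vertex set of an `ℛ_d`-block of `G`: a 3-block of a non-trivial
`ℛ_d`-component of `G`. -/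
def IsRdBlockVerts [DecidableEq V] (d : ℕ) (G : SimpleGraph V) (X : Set V) : Prop :=
  ∃ F : Set (Sym2 V), IsRdComponent d G F ∧ 2 ≤ F.ncard ∧
    ∃ J : (aug (componentGraph F)).Subgraph,
      IsThreeBlock (componentGraph F) J ∧ X = Subtype.val '' J.verts

/-- The globally linked closure of `G` in `ℝ^d`. -/
def glc (d : ℕ) (G : SimpleGraph V) : SimpleGraph V :=
  G ⊔ SimpleGraph.fromEdgeSet {e | ∃ u v : V, e = s(u, v) ∧ GloballyLinked d G u v}

/-- A globally `d`-linked cluster: the vertex set of a maximal complete subgraph of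
`glc_d(G)`. -/
def IsCluster (d : ℕ) (G : SimpleGraph V) (X : Set V) : Prop :=
  (∀ a ∈ X, ∀ b ∈ X, a ≠ b → (glc d G).Adj a b) ∧
    ∀ Y : Set V, X ⊆ Y → (∀ a ∈ Y, ∀ b ∈ Y, a ≠ b → (glc d G).Adj a b) → Y = X

/-- Equilibrium stress of a framework, encoded as a symmetric function vanishing on
non-edges. -/
def IsEqStress [Fintype V] {d : ℕ} (G : SimpleGraph V) (p : V → Fin d → ℝ)
    (ω : V → V → ℝ) : Prop :=
  (∀ u v, ω u v = ω v u) ∧ (∀ u v, ¬ G.Adj u v → ω u v = 0) ∧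
    ∀ u, ∑ v, ω u v • (p u - p v) = 0

/-- `{u,v}` is `d`-stress-linked in `G`. -/
def StressLinked [Fintype V] (d : ℕ) (G : SimpleGraph V) (u v : V) : Prop :=
  ∀ p : V → Fin d → ℝ, Generic p → ∀ q : V → Fin d → ℝ,
    (∀ ω, IsEqStress G p ω → IsEqStress G q ω) →
    ∀ ω, IsEqStress (addEdge G u v) p ω → IsEqStress (addEdge G u v) q ω

/-- Equivalence of complex frameworks. -/
def CEquivalent {d : ℕ} (G : SimpleGraph V) (p q : V → Fin d → ℂ) : Prop :=
  ∀ u v : V, G.Adj u v →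
    ∑ i, (p u i - p v i) ^ 2 = ∑ i, (q u i - q v i) ^ 2

/-- Generic complex placement. -/
def CGeneric {d : ℕ} (p : V → Fin d → ℂ) : Prop :=
  AlgebraicIndependent ℚ (fun vi : V × Fin d => p vi.1 vi.2)

/-- `{u,v}` is globally linked in `G` in `ℂ^d`. -/
def CGloballyLinked (d : ℕ) (G : SimpleGraph V) (u v : V) : Prop :=
  ∀ p : V → Fin d → ℂ, CGeneric p → ∀ q : V → Fin d → ℂ, CEquivalent G p q →
    ∑ i, (q u i - q v i) ^ 2 = ∑ i, (p u i - p v i) ^ 2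

/-- A flexing of the framework `(G,q)`. -/
def IsFlexing {d : ℕ} (G : SimpleGraph V) (q : V → Fin d → ℝ)
    (φ : Set.Icc (0:ℝ) 1 → V → Fin d → ℝ) : Prop :=
  Continuous φ ∧ φ ⟨0, Set.left_mem_Icc.mpr zero_le_one⟩ = q ∧
    (∀ t, Equivalent G q (φ t)) ∧
    ∀ t : Set.Icc (0:ℝ) 1, 0 < (t : ℝ) → ¬ Congruent q (φ t)

/-- A finite loopless multigraph on vertex type `V` with edge type `E`. -/
structure Multigraph (V : Type*) (E : Type*) where
  ends : E → Sym2 V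
  loopless : ∀ e, ¬ (ends e).IsDiag

/-- The data `(B, bar)` exhibits `G` as a body-bar graph induced by `H`. -/
def IsBodyBar {V E W : Type*} (H : Multigraph V E) (G : SimpleGraph W)
    (B : V → Set W) (bar : E → W × W) : Prop :=
  (∀ w : W, ∃! v : V, w ∈ B v) ∧
  (∀ v : V, (B v).ncard = {e : E | v ∈ H.ends e}.ncard) ∧
  (∀ e : E, ∃ w z : V, H.ends e = s(w, z) ∧ (bar e).1 ∈ B w ∧ (bar e).2 ∈ B z) ∧
  (∀ e : E, (bar e).1 ≠ (bar e).2) ∧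
  (∀ e e' : E, e ≠ e' →
    ({(bar e).1, (bar e).2} ∩ {(bar e').1, (bar e').2} : Set W) = ∅) ∧
  (∀ a b : W, G.Adj a b ↔ a ≠ b ∧
    ((∃ v : V, a ∈ B v ∧ b ∈ B v) ∨ ∃ e : E, s(a, b) = s((bar e).1, (bar e).2)))

/-- `P` is a partition of the set `X`. -/
def IsPartitionOf {V : Type*} (X : Set V) (P : Set (Set V)) : Prop :=
  (∀ p ∈ P, p.Nonempty ∧ p ⊆ X) ∧ ∀ v ∈ X, ∃! p, p ∈ P ∧ v ∈ p

/-- The subgraph `(X,F)` of the multigraph `H` is `k`-tree-connected. -/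
def SubTreeConnected {V E : Type*} (k : ℕ) (H : Multigraph V E)
    (X : Set V) (F : Set E) : Prop :=
  X.Nonempty ∧ (∀ e ∈ F, ∀ v ∈ H.ends e, v ∈ X) ∧
    ∀ P : Set (Set V), IsPartitionOf X P →
      k * (P.ncard - 1) ≤ {e | e ∈ F ∧ ¬ ∃ p ∈ P, ∀ v ∈ H.ends e, v ∈ p}.ncard

/-- `(X,F)` is a `k`-superbrick of `H`: a maximal `k`-tree-connected subgraph. -/
def IsSuperbrick {V E : Type*} (k : ℕ) (H : Multigraph V E)
    (X : Set V) (F : Set E) : Prop :=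
  SubTreeConnected k H X F ∧
    ∀ X' F', SubTreeConnected k H X' F' → X ⊆ X' → F ⊆ F' → X = X' ∧ F = F'

/-- An algebraically independent family of reals can be differentiated with arbitrary
prescribed derivatives. -/
theorem exists_derivation_of_algebraicIndependent {ι : Type*} {x : ι → ℝ}
    (hx : AlgebraicIndependent ℚ x) (α : ι → ℝ) :
    ∃ D : Derivation ℚ ℝ ℝ, ∀ i, D (x i) = α i := by
  obtain ⟨s, hs, hb⟩ := exists_isTranscendenceBasis_superset hx.coe_range
  set y : s → ℝ := Subtype.val with hy
  let A := MvPolynomial s ℚ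
  let φ : A →ₐ[ℚ] ℝ := MvPolynomial.aeval y
  have hφ : Function.Injective φ := hb.1
  let : Algebra A ℝ := φ.toRingHom.toAlgebra
  have : IsScalarTower ℚ A ℝ := IsScalarTower.of_algebraMap_eq fun q => (φ.commutes q).symm
  have : FaithfulSMul A ℝ := (faithfulSMul_iff_algebraMap_injective A ℝ).mpr hφ
  have halg : Algebra.IsAlgebraic (Algebra.adjoin ℚ (Set.range y)) ℝ := hb.isAlgebraic
  have : Algebra.IsAlgebraic A ℝ := by
    let e := hb.1.aevalEquiv
    refine Algebra.IsAlgebraic.of_ringHom_of_comp_eq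
      (f := e.toAlgHom.toRingHom) (g := RingHom.id ℝ) e.surjective Function.injective_id ?_
    ext a
    · simp
    · simp only [e, RingHom.algebraMap_toAlgebra, φ, RingHom.comp_apply]
      simp
      exact (MvPolynomial.aeval_X y a).symm
  let : Algebra (FractionRing A) ℝ := FractionRing.liftAlgebra A ℝ
  have : IsScalarTower A (FractionRing A) ℝ := FractionRing.isScalarTower_liftAlgebra A ℝ
  have : Algebra.IsAlgebraic (FractionRing A) ℝ := 
    (IsFractionRing.comap_isAlgebraic_iff (A := A) (K := FractionRing A) (C := ℝ)).mp inferInstance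
  have : CharZero (FractionRing A) := charZero_of_injective_algebraMap (IsFractionRing.injective A (FractionRing A))
  have : Algebra.FormallyEtale A (FractionRing A) :=
    Algebra.FormallyEtale.of_isLocalization (nonZeroDivisors A)
  have : Algebra.FormallyEtale (FractionRing A) ℝ := Algebra.FormallyEtale.of_isSeparable _ _
  have : Algebra.FormallyEtale A ℝ := Algebra.FormallyEtale.comp A (FractionRing A) ℝ
  classical
  let D₀ : Derivation ℚ A ℝ := MvPolynomial.mkDerivation ℚ
    (fun j : s => if h : ∃ i, x i = j then α h.choose else 0)
  let l : TensorProduct A ℝ (Ω[A⁄ℚ]) →ₗ[ℝ] ℝ :=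
    LinearMap.liftBaseChange ℝ D₀.liftKaehlerDifferential
  let L : Ω[ℝ⁄ℚ] →ₗ[ℝ] ℝ :=
    l ∘ₗ (KaehlerDifferential.tensorKaehlerEquivOfFormallyEtale ℚ A ℝ).symm.toLinearMap
  refine ⟨L.compDer (KaehlerDifferential.D ℚ ℝ), fun i => ?_⟩
  have hi : x i = algebraMap A ℝ (MvPolynomial.X ⟨x i, hs ⟨i, rfl⟩⟩) := by
    change _ = MvPolynomial.aeval y (MvPolynomial.X _)
    rw [MvPolynomial.aeval_X]
  have hex : ∃ k, x k = x i := ⟨i, rfl⟩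
  have : (L.compDer (KaehlerDifferential.D ℚ ℝ)) (x i) = l ((KaehlerDifferential.tensorKaehlerEquivOfFormallyEtale ℚ A ℝ).symm (KaehlerDifferential.D ℚ ℝ (x i))) := rfl
  rw [this, hi, KaehlerDifferential.tensorKaehlerEquivOfFormallyEtale_symm_D_algebraMap]
  simp only [l, LinearMap.liftBaseChange_tmul, one_smul, Derivation.liftKaehlerDifferential_comp_D, D₀]
  rw [MvPolynomial.mkDerivation_X]
  rw [dif_pos hex, hx.injective hex.choose_spec]

theorem AlgebraicIndependent.rat_smul {ι : Type*} {x : ι → ℝ} (hx : AlgebraicIndependent ℚ x)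
    (r : ι → ℚ) (hr : ∀ i, r i ≠ 0) : AlgebraicIndependent ℚ (fun i => (r i : ℝ) * x i) := by
  let f : MvPolynomial ι ℚ →ₐ[ℚ] MvPolynomial ι ℚ :=
    MvPolynomial.aeval fun i => MvPolynomial.C (r i) * MvPolynomial.X i
  let g : MvPolynomial ι ℚ →ₐ[ℚ] MvPolynomial ι ℚ :=
    MvPolynomial.aeval fun i => MvPolynomial.C (r i)⁻¹ * MvPolynomial.X i
  have hgf : g.comp f = AlgHom.id ℚ _ := by
    ext1 i
    simp only [f, g, AlgHom.comp_apply, MvPolynomial.aeval_X, map_mul, MvPolynomial.algHom_C,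
      MvPolynomial.algebraMap_eq, AlgHom.id_apply]
    rw [← mul_assoc, ← map_mul, mul_inv_cancel₀ (hr i), map_one, one_mul]
  have hf : Function.Injective f :=
    Function.LeftInverse.injective (g := g) fun a => DFunLike.congr_fun hgf a
  have : MvPolynomial.aeval (fun i => (r i : ℝ) * x i) = (MvPolynomial.aeval x).comp f := by
    ext1 i
    simp [f]
  change Function.Injective (MvPolynomial.aeval fun i => (r i : ℝ) * x i)
  rw [this]
  exact Function.Injective.comp (g := MvPolynomial.aeval x) hx hf

theorem exists_ne_zero_rat_near (y x ε : ℝ) (hx : x ≠ 0) (hε : 0 < ε) :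
    ∃ r : ℚ, r ≠ 0 ∧ |(r : ℝ) * x - y| < ε := by
  have hx' : 0 < |x| := abs_pos.mpr hx
  have key : ∀ r : ℝ, |r - y / x| < ε / |x| → |r * x - y| < ε := fun r h => by
    rw [lt_div_iff₀ hx', ← abs_mul, sub_mul, div_mul_cancel₀ _ hx] at h
    exact h
  have hδ : 0 < ε / |x| := by positivity
  rcases lt_or_ge (y / x) 0 with h | h
  · obtain ⟨r, h1, h2⟩ := exists_rat_btwn (show y / x < min 0 (y / x + ε / |x|) from
      lt_min h (by linarith))
    rw [lt_min_iff] at h2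
    refine ⟨r, ?_, key _ ?_⟩
    · rintro rfl; simp at h2
    · rw [abs_lt]; constructor <;> linarith
  · obtain ⟨r, h1, h2⟩ := exists_rat_btwn (show y / x < y / x + ε / |x| by linarith)
    refine ⟨r, ?_, key _ ?_⟩
    · rintro rfl; simp at h1; linarith
    · rw [abs_lt]; constructor <;> linarith

theorem exists_infinite_algebraicIndependent :
    ∃ s : Set ℝ, s.Infinite ∧ AlgebraicIndependent ℚ ((↑) : s → ℝ) := by
  obtain ⟨s, hs⟩ := exists_isTranscendenceBasis (R := ℚ) ℝ
  refine ⟨s, fun hfin => ?_, hs.1⟩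
  have := hs.isAlgebraic
  have h1 := Algebra.IsAlgebraic.cardinalMk_le_max
    (Algebra.adjoin ℚ (Set.range ((↑) : s → ℝ))) ℝ
  rw [← Cardinal.mk_congr hs.1.aevalEquiv.toEquiv] at h1
  have : Finite s := hfin
  have h2 := MvPolynomial.cardinalMk_le_max_lift (σ := s) (R := ℚ)
  simp only [Cardinal.mkRat, Cardinal.lift_aleph0] at h2
  have h4 : Cardinal.mk ℝ ≤ Cardinal.aleph0 := h1.trans (max_le (h2.trans (by simp)) le_rfl)
  rw [Cardinal.mk_real] at h4
  exact absurd h4 (not_le.mpr Cardinal.aleph0_lt_continuum)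

/-- Generic placements are dense. -/
theorem exists_generic_mem_nhds {W : Type*} [Fintype W] {d : ℕ} (p₀ : W → Fin d → ℝ)
    {U : Set (W → Fin d → ℝ)} (hU : U ∈ nhds p₀) : ∃ p ∈ U, Generic p := by
  obtain ⟨s, hs, hind⟩ := exists_infinite_algebraicIndependent
  have := hs.to_subtype
  obtain ⟨f⟩ : Nonempty (W × Fin d ↪ s) := by
    classical
    exact ⟨(Fintype.equivFin (W × Fin d)).toEmbedding.trans
      (Fin.valEmbedding.trans (Infinite.natEmbedding s))⟩
  have hx : AlgebraicIndependent ℚ (fun vi => (f vi : ℝ)) := hind.comp f f.injective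
  obtain ⟨ε, hε, hball⟩ := Metric.mem_nhds_iff.mp hU
  choose r hr hr' using fun vi : W × Fin d =>
    exists_ne_zero_rat_near (p₀ vi.1 vi.2) (f vi) ε (hx.ne_zero vi) hε
  refine ⟨fun v i => r (v, i) * f (v, i), hball ?_, ?_⟩
  · rw [Metric.mem_ball, dist_pi_lt_iff hε]
    intro v
    rw [dist_pi_lt_iff hε]
    exact fun i => hr' (v, i)
  · exact AlgebraicIndependent.rat_smul hx r hr

theorem exists_generic (W : Type*) [Fintype W] (d : ℕ) : ∃ p : W → Fin d → ℝ, Generic p := by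
  obtain ⟨p, -, hp⟩ := exists_generic_mem_nhds (0 : W → Fin d → ℝ) Filter.univ_mem
  exact ⟨p, hp⟩

/-- Linear independence of vectors with polynomial coordinates passes from any point to an
algebraically independent one. -/
theorem linearIndependent_of_algebraicIndependent {σ ι κ : Type*} [Fintype ι] [Fintype κ]
    {x y : σ → ℝ} (hx : AlgebraicIndependent ℚ x) (P : ι → κ → MvPolynomial σ ℚ)
    (h : LinearIndependent ℝ fun i k => MvPolynomial.aeval y (P i k)) :
    LinearIndependent ℝ fun i k => MvPolynomial.aeval x (P i k) := by
  classical
  let M : Matrix ι κ (MvPolynomial σ ℚ) := Matrix.of P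
  have gram : ∀ A : Matrix ι κ ℝ, LinearIndependent ℝ A.row ↔ (A * A.transpose).det ≠ 0 := by
    intro A
    rw [← isUnit_iff_ne_zero, ← Matrix.isUnit_iff_isUnit_det,
      ← Matrix.linearIndependent_rows_iff_isUnit, ← Matrix.vecMul_injective_iff,
      ← Matrix.vecMul_injective_iff]
    constructor
    · intro hA c c' hc
      refine hA (sub_eq_zero.mp ?_)
      simp only at hc ⊢
      rw [← Matrix.sub_vecMul] 
      rw [← sub_eq_zero, ← Matrix.sub_vecMul, ← Matrix.vecMul_vecMul] at hc
      rw [← dotProduct_self_eq_zero, ← Matrix.mulVec_transpose, Matrix.mulVec_transpose,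
        ← Matrix.dotProduct_mulVec]
      rw [Matrix.vecMul_transpose] at hc
      rw [hc, dotProduct_zero]
    · intro hA c c' hc
      refine hA ?_
      simp only at hc ⊢
      rw [← Matrix.vecMul_vecMul, hc, Matrix.vecMul_vecMul]
  have hz : ∀ z : σ → ℝ, (M.map (MvPolynomial.aeval z) * (M.map (MvPolynomial.aeval z)).transpose).det
      = MvPolynomial.aeval z (M * M.transpose).det := by
    intro z
    rw [AlgHom.map_det]
    simp [Matrix.map_mul, Matrix.transpose_map]
  have h1 := (gram (M.map (MvPolynomial.aeval y))).mp h
  refine (gram (M.map (MvPolynomial.aeval x))).mpr ?_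
  rw [hz] at h1 ⊢
  intro h0
  apply h1
  rw [(injective_iff_map_eq_zero _).mp hx _ h0, map_zero]

section Stresses

variable {W : Type*} [Fintype W] [DecidableEq W] {d : ℕ}

/-- The row of the rigidity matrix indexed by an unordered pair. -/
def row (p : W → Fin d → ℝ) (e : Sym2 W) : W × Fin d → ℝ :=
  fun zi => ∑ y, if e = s(zi.1, y) then p zi.1 zi.2 - p y zi.2 else 0

theorem row_mk (p : W → Fin d → ℝ) (u v : W) : row p s(u, v) = edgeVec p u v := by
  funext ⟨z, i⟩
  simp only [row, edgeVec]
  by_cases h1 : z = u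
  · subst h1
    simp only [Sym2.congr_right, Finset.sum_ite_eq, Finset.mem_univ, if_true]
  · by_cases h2 : z = v
    · subst h2
      simp only [Sym2.eq_swap (a := u), Sym2.congr_right, Finset.sum_ite_eq, Finset.mem_univ,
        if_true, h1, if_false]
    · rw [if_neg h1, if_neg h2]
      refine Finset.sum_eq_zero fun y _ => if_neg ?_
      intro h
      have : z ∈ s(u, v) := h ▸ Sym2.mem_mk_left z y
      simp [h1, h2] at this

/-- The space of equilibrium stresses of the complete graph at `p`. -/
def stress (p : W → Fin d → ℝ) : Submodule ℝ (Sym2 W → ℝ) where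
  carrier := {ω | ∀ x i, ∑ y, ω s(x, y) * (p x i - p y i) = 0}
  add_mem' := fun {a b} ha hb x i => by
    simp only [Pi.add_apply, add_mul, Finset.sum_add_distrib, ha x i, hb x i, add_zero]
  zero_mem' := fun x i => by simp
  smul_mem' := fun c a ha x i => by
    simp only [Pi.smul_apply, smul_eq_mul, mul_assoc, ← Finset.mul_sum, ha x i, mul_zero]

theorem sum_mul_row (p : W → Fin d → ℝ) (ω : Sym2 W → ℝ) (x : W) (i : Fin d) :
    ∑ e, ω e * row p e (x, i) = ∑ y, ω s(x, y) * (p x i - p y i) := by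
  simp only [row, Finset.mul_sum, mul_ite, mul_zero]
  rw [Finset.sum_comm]
  simp

theorem mem_stress_iff (p : W → Fin d → ℝ) (ω : Sym2 W → ℝ) :
    ω ∈ stress p ↔ ∑ e, ω e • row p e = 0 := by
  constructor
  · intro h
    funext ⟨x, i⟩
    simpa [Finset.sum_apply, sum_mul_row] using h x i
  · intro h x i
    have := congrFun h (x, i)
    simpa [Finset.sum_apply, sum_mul_row] using this

theorem sum_row_mul (p m : W → Fin d → ℝ) (x y : W) :
    ∑ zi : W × Fin d, row p s(x, y) zi * m zi.1 zi.2 =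
      ∑ i, (p x i - p y i) * (m x i - m y i) := by
  rw [row_mk, Fintype.sum_prod_type_right]
  refine Finset.sum_congr rfl fun i _ => ?_
  simp only [edgeVec]
  by_cases h : x = y
  · subst h; simp
  · have : ∀ z, (if z = x then p x i - p y i else if z = y then p y i - p x i else 0) * m z i =
        (if z = x then (p x i - p y i) * m x i else 0) +
          (if z = y then (p y i - p x i) * m y i else 0) := by
      intro z
      by_cases h1 : z = x
      · subst h1; simp [h]
      · by_cases h2 : z = y
        · subst h2; simp [h1]
        · simp [h1, h2]
    simp only [this, Finset.sum_add_distrib, Finset.sum_ite_eq', Finset.mem_univ, if_true]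
    ring

/-- Infinitesimal motions of the framework with edge set `J`. -/
def Motion (J : Set (Sym2 W)) (p m : W → Fin d → ℝ) : Prop :=
  ∀ x y, s(x, y) ∈ J → ∑ i, (p x i - p y i) * (m x i - m y i) = 0

/-- Every stress of `(J,p)` is a stress of `(J,f)`. -/
def RespectsStress (J : Set (Sym2 W)) (p f : W → Fin d → ℝ) : Prop :=
  ∀ ω ∈ stress p, (∀ e ∉ J, ω e = 0) → ω ∈ stress f

theorem sum_stress_mul_row {p : W → Fin d → ℝ} {ω : Sym2 W → ℝ} (hω : ω ∈ stress p)
    (m : W → Fin d → ℝ) :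
    ∑ e, ω e * ∑ zi : W × Fin d, row p e zi * m zi.1 zi.2 = 0 := by
  simp only [Finset.mul_sum]
  rw [Finset.sum_comm]
  refine Finset.sum_eq_zero fun zi _ => ?_
  simp only [← mul_assoc, ← Finset.sum_mul]
  rw [sum_mul_row, hω zi.1 zi.2, zero_mul]

/-- A motion preserves every edge that is in the closure of the edges it preserves. -/
theorem Motion.of_stress {J : Set (Sym2 W)} {p m : W → Fin d → ℝ} (hm : Motion J p m)
    {ω : Sym2 W → ℝ} (hω : ω ∈ stress p) {x y : W} (hxy : ω s(x, y) ≠ 0)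
    (hJ : ∀ e ∉ J, e ≠ s(x, y) → ω e = 0) :
    ∑ i, (p x i - p y i) * (m x i - m y i) = 0 := by
  have h := sum_stress_mul_row hω m
  rw [Finset.sum_eq_single s(x, y)] at h
  · rw [sum_row_mul] at h
    exact (mul_eq_zero.mp h).resolve_left hxy
  · intro e _ he
    by_cases heJ : e ∈ J
    · induction e with | _ a b =>
      rw [sum_row_mul, hm a b heJ, mul_zero]
    · rw [hJ e heJ he, zero_mul]
  · simp

/-- An edge either lies in the closure of `J` or is violated by some motion of `J`. -/
theorem exists_stress_or_motion (J : Set (Sym2 W)) (p : W → Fin d → ℝ) (a b : W) :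
    (∃ τ ∈ stress p, τ s(a, b) = 1 ∧ ∀ e ∉ J, e ≠ s(a, b) → τ e = 0) ∨
      ∃ m, Motion (J \ {s(a, b)}) p m ∧ ∑ i, (p a i - p b i) * (m a i - m b i) ≠ 0 := by
  by_cases h : row p s(a, b) ∈ Submodule.span ℝ (row p '' (J \ {s(a, b)}))
  · left
    obtain ⟨l, hl, hl'⟩ := (Finsupp.mem_span_image_iff_linearCombination ℝ).mp h
    rw [Finsupp.mem_supported] at hl
    have hl0 : l s(a, b) = 0 := by
      by_contra h0
      exact (hl (Finsupp.mem_support_iff.mpr h0)).2 rfl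
    refine ⟨fun e => (if e = s(a, b) then 1 else 0) - l e, ?_, by simp [hl0], ?_⟩
    · rw [mem_stress_iff]
      simp only [sub_smul, Finset.sum_sub_distrib, ite_smul, one_smul, zero_smul,
        Finset.sum_ite_eq', Finset.mem_univ, if_true]
      rw [← hl', Finsupp.linearCombination_apply, Finsupp.sum_fintype _ _ (by simp), sub_self]
    · intro e he hne
      have : l e = 0 := by
        by_contra h0
        exact he (hl (Finsupp.mem_support_iff.mpr h0)).1
      simp [hne, this]
  · right
    obtain ⟨f, hf, hf'⟩ := Submodule.exists_le_ker_of_notMem h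
    have key : ∀ x y, f (row p s(x, y)) =
        ∑ i, (p x i - p y i) * (f (Pi.single (x, i) 1) - f (Pi.single (y, i) 1)) := by
      intro x y
      rw [← sum_row_mul p (fun z i => f (Pi.single (z, i) 1))]
      rw [LinearMap.pi_apply_eq_sum_univ f]
      refine Finset.sum_congr rfl fun zi _ => ?_
      rw [smul_eq_mul]
      congr 2
      funext j
      simp [Pi.single_apply, eq_comm]
    refine ⟨fun z i => f (Pi.single (z, i) 1), fun x y hxy => ?_, ?_⟩
    · rw [← key]
      exact hf' (Submodule.subset_span ⟨_, hxy, rfl⟩)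
    · rw [← key]
      exact hf


theorem linearIndepOn_row_of_generic {p q : W → Fin d → ℝ} (hp : Generic p) {F : Set (Sym2 W)}
    (hq : LinearIndepOn ℝ (row q) F) : LinearIndepOn ℝ (row p) F := by
  classical
  have : Fintype F := Fintype.ofFinite F
  let P : F → W × Fin d → MvPolynomial (W × Fin d) ℚ := fun e zi =>
    ∑ y, if e.1 = s(zi.1, y) then MvPolynomial.X zi - MvPolynomial.X (y, zi.2) else 0
  have hP : ∀ r : W → Fin d → ℝ, (fun (e : F) zi =>
      MvPolynomial.aeval (fun vi : W × Fin d => r vi.1 vi.2) (P e zi)) = fun e : F => row r e := by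
    intro r
    funext e zi
    simp only [P, row, map_sum]
    refine Finset.sum_congr rfl fun y _ => ?_
    split_ifs <;> simp
  have := linearIndependent_of_algebraicIndependent (y := fun vi : W × Fin d => q vi.1 vi.2) hp P
    (by rw [hP]; exact hq)
  rw [hP] at this
  exact this

theorem rankAt_eq (p : W → Fin d → ℝ) (F : Set (Sym2 W)) :
    rankAt d p F = Module.finrank ℝ (Submodule.span ℝ (row p '' F)) := by
  have : {x : W × Fin d → ℝ | ∃ u v : W, s(u, v) ∈ F ∧ x = edgeVec p u v} = row p '' F := by
    ext x
    constructor
    · rintro ⟨u, v, h, rfl⟩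
      exact ⟨_, h, row_mk p u v⟩
    · rintro ⟨e, h, rfl⟩
      induction e with | _ u v => exact ⟨u, v, h, row_mk p u v⟩
  rw [rankAt, this]

theorem rankAt_le_of_generic {p : W → Fin d → ℝ} (hp : Generic p) (q : W → Fin d → ℝ)
    (F : Set (Sym2 W)) : rankAt d q F ≤ rankAt d p F := by
  classical
  obtain ⟨I, hIF, -, hspan, hI⟩ := exists_linearIndepOn_extension
    (linearIndepOn_empty ℝ (row q)) (Set.empty_subset F)
  have hIp := linearIndepOn_row_of_generic hp hI
  have : Fintype I := Fintype.ofFinite I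
  rw [rankAt_eq, rankAt_eq]
  have h1 : Submodule.span ℝ (row q '' F) ≤ Submodule.span ℝ (row q '' I) :=
    Submodule.span_le.mpr hspan
  have e : ∀ r : W → Fin d → ℝ, LinearIndepOn ℝ (row r) I →
      Module.finrank ℝ (Submodule.span ℝ (row r '' I)) = Fintype.card I := by
    intro r hr
    rw [Set.image_eq_range]
    exact finrank_span_eq_card hr
  calc _ ≤ Module.finrank ℝ (Submodule.span ℝ (row q '' I)) := Submodule.finrank_mono h1
    _ = Module.finrank ℝ (Submodule.span ℝ (row p '' I)) := by rw [e q hI, e p hIp]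
    _ ≤ _ := Submodule.finrank_mono (Submodule.span_mono (Set.image_mono hIF))

theorem rd_eq_rankAt {p : W → Fin d → ℝ} (hp : Generic p) (F : Set (Sym2 W)) :
    rd d F = rankAt d p F := by
  refine IsGreatest.csSup_eq ⟨⟨p, rfl⟩, ?_⟩
  rintro n ⟨q, rfl⟩
  exact rankAt_le_of_generic hp q F

theorem rdIndep_iff {p : W → Fin d → ℝ} (hp : Generic p) (F : Set (Sym2 W)) :
    RdIndep d F ↔ ∀ ω ∈ stress p, (∀ e ∉ F, ω e = 0) → ω = 0 := by
  classical
  have : Fintype F := Fintype.ofFinite F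
  rw [RdIndep, rd_eq_rankAt hp, rankAt_eq, Set.image_eq_range, ← Nat.card_coe_set_eq,
    Nat.card_eq_fintype_card, eq_comm]
  have h1 := linearIndependent_iff_card_eq_finrank_span (R := ℝ) (b := fun e : F => row p e)
  rw [Set.finrank] at h1
  rw [← h1, Fintype.linearIndependent_iff]
  have key : ∀ ω : Sym2 W → ℝ, (∀ e ∉ F, ω e = 0) →
      ∑ e : F, ω e • row p e = ∑ e, ω e • row p e := by
    intro ω hω
    rw [Finset.sum_set_coe (s := F) (f := fun e => ω e • row p e)]
    refine Finset.sum_subset (Finset.subset_univ _) fun e _ he => ?_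
    rw [hω e (by simpa using he), zero_smul]
  constructor
  · intro h ω hω hF
    funext e
    by_cases he : e ∈ F
    · refine h (fun e => ω e) ?_ ⟨e, he⟩
      rw [key ω hF, (mem_stress_iff p ω).mp hω]
    · exact hF e he
  · intro h g hg e
    have hF : ∀ e ∉ F, (fun e => if he : e ∈ F then g ⟨e, he⟩ else 0) e = 0 :=
      fun e he => dif_neg he
    have := h (fun e => if he : e ∈ F then g ⟨e, he⟩ else 0) ?_ hF
    · simpa using congrFun this e
    · rw [mem_stress_iff, ← key _ hF, ← hg]
      simp

end Stresses

section Transfer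

variable {W : Type*} [Fintype W] [DecidableEq W] {d : ℕ}

theorem Generic.exists_derivation {p : W → Fin d → ℝ} (hp : Generic p) (α : W → Fin d → ℝ) :
    ∃ D : Derivation ℚ ℝ ℝ, ∀ x i, D (p x i) = α x i := by
  obtain ⟨D, hD⟩ := exists_derivation_of_algebraicIndependent hp (fun vi => α vi.1 vi.2)
  exact ⟨D, fun x i => hD (x, i)⟩

/-- An equivalent realisation inherits all stresses of a generic one. -/
theorem respectsStress_of_equivalent {J : Set (Sym2 W)} {p q : W → Fin d → ℝ} (hp : Generic p)
    (hq : ∀ x y, s(x, y) ∈ J → ∑ i, (p x i - p y i) ^ 2 = ∑ i, (q x i - q y i) ^ 2) :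
    RespectsStress J p q := by
  classical
  intro ω hω hJ
  let R : (W → Fin d → ℝ) → Matrix J (W × Fin d) ℝ := fun r => Matrix.of fun e => row r e
  have hrank : ∀ r, (R r).rank = rankAt d r J := by
    intro r
    rw [rankAt_eq, Matrix.rank_eq_finrank_span_row, Set.image_eq_range]
    rfl
  have hmul : ∀ (r m : W → Fin d → ℝ) (e : J),
      (R r).mulVec (fun zi => m zi.1 zi.2) e = ∑ zi : W × Fin d, row r e zi * m zi.1 zi.2 :=
    fun r m e => rfl
  have hle : LinearMap.range (R p).mulVecLin ≤ LinearMap.range (R q).mulVecLin := by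
    rintro _ ⟨α, rfl⟩
    obtain ⟨D, hD⟩ := hp.exists_derivation (fun x i => α (x, i))
    refine ⟨fun zi => D (q zi.1 zi.2), ?_⟩
    funext e
    rw [Matrix.mulVecLin_apply, Matrix.mulVecLin_apply, hmul q (fun x i => D (q x i))]
    have h2 := hmul p (fun x i => α (x, i)) e
    simp only [Prod.mk.eta] at h2
    rw [h2]
    obtain ⟨e, he⟩ := e
    induction e with | _ x y =>
    have h1 := congrArg D (hq x y he)
    simp only [map_sum, Derivation.leibniz_pow, map_sub, hD, smul_eq_mul] at h1
    have h3 := sum_row_mul p (fun x i => α (x, i)) x y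
    simp only [Prod.mk.eta] at h3
    rw [h3, sum_row_mul q (fun x i => D (q x i))]
    simp only [Nat.add_one_sub_one, pow_one, nsmul_eq_mul, Nat.cast_ofNat, ← Finset.mul_sum] at h1
    linarith
  have heq : LinearMap.range (R p).mulVecLin = LinearMap.range (R q).mulVecLin := by
    refine Submodule.eq_of_le_of_finrank_le hle ?_
    change (R q).rank ≤ (R p).rank
    rw [hrank, hrank]
    exact rankAt_le_of_generic hp q J
  have hsum : ∀ f : Sym2 W → ℝ, ∑ e, ω e * f e = ∑ e : J, ω e * f e := by
    intro f
    rw [Finset.sum_set_coe (s := J) (f := fun e => ω e * f e)]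
    refine (Finset.sum_subset (Finset.subset_univ _) fun e _ he => ?_).symm
    rw [hJ e (by simpa using he), zero_mul]
  intro x i
  obtain ⟨α, hα⟩ : (R q).mulVecLin (Pi.single (x, i) 1) ∈ LinearMap.range (R p).mulVecLin :=
    heq ▸ ⟨_, rfl⟩
  have h := sum_stress_mul_row hω (fun x i => α (x, i))
  rw [hsum] at h
  rw [← sum_mul_row, hsum, ← h]
  refine Finset.sum_congr rfl fun e _ => ?_
  have := congrFun hα e
  simp only [Matrix.mulVecLin_apply, Matrix.mulVec_single_one] at this
  congr 1
  exact this.symm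

/-- A motion of a generic framework satisfies all its stresses. -/
theorem respectsStress_of_motion {J : Set (Sym2 W)} {p m : W → Fin d → ℝ} (hp : Generic p)
    (hm : Motion J p m) : RespectsStress J p m := by
  intro ω hω hJ x i
  have key : ∀ α : W → Fin d → ℝ, ∑ x, ∑ i, α x i * ∑ y, ω s(x, y) * (m x i - m y i) = 0 := by
    intro α
    obtain ⟨D, hD⟩ := hp.exists_derivation α
    have h1 : ∀ x i, ∑ y, (ω s(x, y) * (α x i - α y i) + (p x i - p y i) * D (ω s(x, y))) = 0 := by
      intro x i
      have := congrArg D (hω x i)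
      simpa [map_sum, hD, smul_eq_mul] using this
    have h2 : ∑ x, ∑ i, m x i *
        ∑ y, (ω s(x, y) * (α x i - α y i) + (p x i - p y i) * D (ω s(x, y))) = 0 := by
      simp [h1]
    have h3 : ∑ x, ∑ i, m x i * ∑ y, D (ω s(x, y)) * (p x i - p y i) = 0 := by
      have : ∀ x i, ∑ y, D (ω s(x, y)) * (p x i - p y i) =
          ∑ e, D (ω e) * row p e (x, i) := fun x i => (sum_mul_row p (fun e => D (ω e)) x i).symm
      simp only [this]
      rw [← Fintype.sum_prod_type' (f := fun x i => m x i * ∑ e, D (ω e) * row p e (x, i))]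
      simp only [Finset.mul_sum]
      rw [Finset.sum_comm]
      refine Finset.sum_eq_zero fun e _ => ?_
      have : ∀ zi : W × Fin d, m zi.1 zi.2 * (D (ω e) * row p e (zi.1, zi.2)) =
          D (ω e) * (row p e zi * m zi.1 zi.2) := fun zi => by ring
      simp only [this, ← Finset.mul_sum]
      by_cases he : e ∈ J
      · induction e with | _ a b =>
        rw [sum_row_mul, hm a b he, mul_zero]
      · rw [hJ e he, map_zero, zero_mul]
    have swap : ∀ f g : W → Fin d → ℝ, ∑ x, ∑ i, f x i * ∑ y, ω s(x, y) * (g x i - g y i) =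
        ∑ i, ∑ x, ∑ y, ω s(x, y) * (f x i * g x i) - ∑ i, ∑ x, ∑ y, ω s(x, y) * (f x i * g y i) := by
      intro f g
      rw [Finset.sum_comm, ← Finset.sum_sub_distrib]
      refine Finset.sum_congr rfl fun i _ => ?_
      rw [← Finset.sum_sub_distrib]
      refine Finset.sum_congr rfl fun x _ => ?_
      rw [← Finset.sum_sub_distrib, Finset.mul_sum]
      exact Finset.sum_congr rfl fun y _ => by ring
    have h4 : ∑ x, ∑ i, m x i * ∑ y, ω s(x, y) * (α x i - α y i) = 0 := by
      rw [← h2, ← sub_eq_zero, ← neg_eq_zero, neg_sub]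
      rw [← h3]
      simp only [← Finset.sum_sub_distrib, ← mul_sub]
      refine Finset.sum_congr rfl fun x _ => Finset.sum_congr rfl fun i _ => ?_
      congr 1
      exact Finset.sum_congr rfl fun y _ => by ring
    rw [swap] at h4 ⊢
    rw [← h4]
    congr 1
    · refine Finset.sum_congr rfl fun i _ => Finset.sum_congr rfl fun x _ =>
        Finset.sum_congr rfl fun y _ => by ring
    · refine Finset.sum_congr rfl fun i _ => ?_
      rw [Finset.sum_comm]
      refine Finset.sum_congr rfl fun x _ => Finset.sum_congr rfl fun y _ => ?_
      rw [Sym2.eq_swap, mul_comm (m _ _)]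
  have := key (fun z j => if z = x ∧ j = i then 1 else 0)
  rw [Finset.sum_eq_single x, Finset.sum_eq_single i] at this
  · simpa using this
  · intro j _ hj; simp [hj]
  · simp
  · intro z _ hz; simp [hz]
  · simp

/-- Homogeneous coordinates. -/
def hat (x : Fin d → ℝ) : Fin (d + 1) → ℝ := Fin.cons 1 x

@[simp] theorem hat_zero (x : Fin d → ℝ) : hat x 0 = 1 := rfl

@[simp] theorem hat_succ (x : Fin d → ℝ) (i : Fin d) : hat x i.succ = x i := rfl

theorem Generic.linearIndepOn_hat {p : W → Fin d → ℝ} (hp : Generic p) {S : Finset W}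
    (hS : S.card ≤ d + 1) : LinearIndepOn ℝ (fun x => hat (p x)) (S : Set W) := by
  rw [linearIndepOn_finset_iff]
  intro c hc x₀ hx₀
  by_contra h0
  have hc0 : ∑ x ∈ S, c x = 0 := by
    have := congrFun hc 0
    simpa [Finset.sum_apply] using this
  have hci : ∀ i, ∑ x ∈ S, c x * p x i = 0 := by
    intro i
    have := congrFun hc i.succ
    simpa [Finset.sum_apply] using this
  let T : Submodule ℝ (Fin (d + 1) → ℝ) :=
    Submodule.span ℝ ((fun x => hat (p x)) '' (S.erase x₀ : Set W))
  have hx₀T : hat (p x₀) ∈ T := by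
    have : hat (p x₀) = ∑ x ∈ S.erase x₀, (-(c x / c x₀)) • hat (p x) := by
      have h1 : c x₀ • hat (p x₀) = - ∑ x ∈ S.erase x₀, c x • hat (p x) := by
        rw [← Finset.add_sum_erase _ _ hx₀] at hc
        exact eq_neg_of_add_eq_zero_left hc
      rw [← inv_smul_smul₀ h0 (hat (p x₀)), h1, smul_neg, Finset.smul_sum, ← Finset.sum_neg_distrib]
      refine Finset.sum_congr rfl fun x _ => ?_
      rw [smul_smul, neg_smul, div_eq_inv_mul]
    rw [this]
    exact Submodule.sum_mem _ fun x hx => Submodule.smul_mem _ _ (Submodule.subset_span ⟨x, hx, rfl⟩)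
  have hα : ∀ α : Fin d → ℝ, (Fin.cons 0 α : Fin (d + 1) → ℝ) ∈ T := by
    intro α
    obtain ⟨D, hD⟩ := hp.exists_derivation (fun x i => if x = x₀ then α i else 0)
    have h1 : (c x₀) • (Fin.cons 0 α : Fin (d + 1) → ℝ) = - ∑ x ∈ S, D (c x) • hat (p x) := by
      funext j
      refine Fin.cases ?_ (fun i => ?_) j
      · have := congrArg D hc0
        simp only [map_sum, map_zero] at this
        simp [Finset.sum_apply, this]
      · have := congrArg D (hci i)
        simp only [map_sum, map_zero, Derivation.leibniz, hD, smul_eq_mul, Finset.sum_add_distrib,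
          mul_ite, mul_zero, Finset.sum_ite_eq', hx₀, if_true] at this
        simp only [Pi.smul_apply, Fin.cons_succ, smul_eq_mul, Pi.neg_apply, Finset.sum_apply,
          hat_succ]
        rw [eq_neg_of_add_eq_zero_left this]
        congr 1
        exact Finset.sum_congr rfl fun x _ => mul_comm _ _
    rw [← inv_smul_smul₀ h0 (Fin.cons 0 α : Fin (d + 1) → ℝ), h1]
    refine Submodule.smul_mem _ _ (Submodule.neg_mem _ (Submodule.sum_mem _ fun x hx => ?_))
    refine Submodule.smul_mem _ _ ?_
    by_cases hxx : x = x₀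
    · rw [hxx]; exact hx₀T
    · exact Submodule.subset_span ⟨x, by simp [hxx, hx], rfl⟩
  have hT : T = ⊤ := by
    rw [eq_top_iff]
    intro z _
    have : z = z 0 • hat (p x₀) + (Fin.cons 0 (fun i => z i.succ - z 0 * p x₀ i)) := by
      funext j
      refine Fin.cases ?_ (fun i => ?_) j <;> simp
    rw [this]
    exact Submodule.add_mem _ (Submodule.smul_mem _ _ hx₀T) (hα _)
  have h1 : Module.finrank ℝ T ≤ (S.erase x₀).card := by
    have := finrank_span_finset_le_card (R := ℝ) ((S.erase x₀).image (fun x => hat (p x)))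
    rw [Set.finrank, Finset.coe_image] at this
    exact this.trans Finset.card_image_le
  rw [hT, finrank_top, Module.finrank_fin_fun, Finset.card_erase_of_mem hx₀] at h1
  have := Finset.card_pos.mpr ⟨x₀, hx₀⟩
  omega

/-- In the support of a stress of a generic framework every covered vertex has degree at
least `d + 1`. -/
theorem Generic.card_support_stress {p : W → Fin d → ℝ} (hp : Generic p) {ω : Sym2 W → ℝ}
    (hω : ω ∈ stress p) {a b : W} (hab : a ≠ b) (h : ω s(a, b) ≠ 0) {N : Finset W}
    (hN : ∀ y, y ≠ a → ω s(a, y) ≠ 0 → y ∈ N) (haN : a ∉ N) : d + 1 ≤ N.card := by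
  by_contra hlt
  have hS : (insert a N).card ≤ d + 1 := by
    rw [Finset.card_insert_of_notMem haN]; omega
  have hli := linearIndepOn_finset_iff.mp (hp.linearIndepOn_hat hS)
  let c : W → ℝ := fun y => if y = a then ∑ z ∈ N, ω s(a, z) else - ω s(a, y)
  have hsum : ∀ i, ∑ y ∈ N, ω s(a, y) * (p a i - p y i) = 0 := by
    intro i
    rw [← hω a i]
    refine Finset.sum_subset (Finset.subset_univ _) fun y _ hy => ?_
    by_cases hya : y = a
    · simp [hya]
    · have : ω s(a, y) = 0 := by
        by_contra h0
        exact hy (hN y hya h0)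
      rw [this, zero_mul]
  have hcN : ∀ y ∈ N, c y = - ω s(a, y) := fun y hy => by
    simp only [c]
    rw [if_neg]
    rintro rfl
    exact haN hy
  have := hli c ?_ b (Finset.mem_insert_of_mem (hN b hab.symm h))
  · simp [c, hab.symm, h] at this
  · rw [Finset.sum_insert haN]
    funext j
    refine Fin.cases ?_ (fun i => ?_) j
    · simp only [Pi.add_apply, Finset.sum_apply, Pi.smul_apply, hat_zero, smul_eq_mul, mul_one,
        Pi.zero_apply]
      rw [Finset.sum_congr rfl hcN]
      simp [c]
    · simp only [Pi.add_apply, Finset.sum_apply, Pi.smul_apply, hat_succ, smul_eq_mul,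
        Pi.zero_apply]
      rw [Finset.sum_congr rfl fun y hy => by rw [hcN y hy]]
      simp only [c, if_true]
      rw [← hsum i, Finset.sum_mul, ← Finset.sum_add_distrib]
      exact Finset.sum_congr rfl fun y _ => by ring

end Transfer

section Circuits

/-- `C` is the support of a nonzero element of `S` of minimal support. -/
def IsMinSupport {ι : Type*} (S : Submodule ℝ (ι → ℝ)) (C : Set ι) : Prop :=
  (∃ ω ∈ S, ω ≠ 0 ∧ Function.support ω = C) ∧
    ∀ ω ∈ S, ω ≠ 0 → Function.support ω ⊆ C → Function.support ω = C

variable {ι : Type*} [Finite ι] {S : Submodule ℝ (ι → ℝ)}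

theorem exists_isMinSupport {ω : ι → ℝ} (hω : ω ∈ S) {e : ι} (he : ω e ≠ 0) :
    ∃ C, IsMinSupport S C ∧ e ∈ C ∧ C ⊆ Function.support ω := by
  induction hn : (Function.support ω).ncard using Nat.strong_induction_on generalizing ω with
  | _ n ih =>
  subst hn
  by_cases hmin : ∀ ω' ∈ S, ω' ≠ 0 → Function.support ω' ⊆ Function.support ω →
      Function.support ω' = Function.support ω
  · refine ⟨_, ⟨⟨ω, hω, ?_, rfl⟩, hmin⟩, he, subset_rfl⟩
    rintro rfl
    exact he rfl
  · push Not at hmin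
    obtain ⟨ω', hω', hne, hsub, hneq⟩ := hmin
    by_cases he' : ω' e = 0
    · obtain ⟨f, hf⟩ := Function.ne_iff.mp hne
      have hsub2 : Function.support (ω - (ω f / ω' f) • ω') ⊂ Function.support ω := by
        refine ⟨fun x hx => ?_, fun h => ?_⟩
        · by_contra h0
          have h1 : ω x = 0 := by simpa using h0
          have h2 : ω' x = 0 := by
            by_contra h2
            exact h0 (hsub h2)
          simp [h1, h2] at hx
        · have := h (hsub hf)
          simp only [Pi.zero_apply] at hf
          simp [hf] at this
      obtain ⟨C, hC, heC, hCs⟩ := ih _ (Set.ncard_lt_ncard hsub2 (Set.toFinite _))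
        (S.sub_mem hω (S.smul_mem _ hω')) (by simp [he', he]) rfl
      exact ⟨C, hC, heC, hCs.trans hsub2.subset⟩
    · obtain ⟨C, hC, heC, hCs⟩ := ih _
        (Set.ncard_lt_ncard (hsub.ssubset_of_ne hneq) (Set.toFinite _)) hω' he' rfl
      exact ⟨C, hC, heC, hCs.trans hsub⟩

theorem IsMinSupport.eliminate {C₁ C₂ : Set ι} (h₁ : IsMinSupport S C₁) (h₂ : IsMinSupport S C₂)
    {e f : ι} (he : e ∈ C₁) (he' : e ∉ C₂) (hf₁ : f ∈ C₁) (hf₂ : f ∈ C₂) :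
    ∃ C, IsMinSupport S C ∧ e ∈ C ∧ C ⊆ (C₁ ∪ C₂) \ {f} := by
  obtain ⟨⟨ω₁, hω₁, -, rfl⟩, -⟩ := h₁
  obtain ⟨⟨ω₂, hω₂, -, rfl⟩, -⟩ := h₂
  have h2e : ω₂ e = 0 := by simpa using he'
  obtain ⟨C, hC, heC, hCs⟩ := exists_isMinSupport
    (S.sub_mem hω₁ (S.smul_mem (ω₁ f / ω₂ f) hω₂)) (e := e) (by simpa [h2e] using he)
  refine ⟨C, hC, heC, fun x hx => ⟨?_, ?_⟩⟩
  · by_contra h0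
    simp only [Set.mem_union, Function.mem_support, not_or, not_not] at h0
    have := hCs hx
    simp [h0.1, h0.2] at this
  · rintro rfl
    have := hCs hx
    simp only [Function.mem_support] at hf₂
    simp [hf₂] at this

theorem IsMinSupport.trans {C₁ C₂ : Set ι} (h₁ : IsMinSupport S C₁) (h₂ : IsMinSupport S C₂)
    (hne : (C₁ ∩ C₂).Nonempty) {e g : ι} (he : e ∈ C₁) (hg : g ∈ C₂) :
    ∃ C, IsMinSupport S C ∧ e ∈ C ∧ g ∈ C := by
  induction hn : (C₁ ∪ C₂).ncard using Nat.strong_induction_on generalizing C₁ C₂ with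
  | _ n ih =>
  subst hn
  by_cases he2 : e ∈ C₂
  · exact ⟨C₂, h₂, he2, hg⟩
  by_cases hg1 : g ∈ C₁
  · exact ⟨C₁, h₁, he, hg1⟩
  obtain ⟨f, hf1, hf2⟩ := hne
  have not_sub : ∀ {C D D' : Set ι}, IsMinSupport S C → IsMinSupport S D → f ∈ D →
      C ⊆ (D ∪ D') \ {f} → (C ∩ (D' \ D)).Nonempty := by
    intro C D D' hC hD hfD hCs
    by_contra h0
    have hCD : C ⊆ D := fun x hx => by
      by_contra hxD
      exact h0 ⟨x, hx, ((hCs hx).1.resolve_left hxD), hxD⟩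
    obtain ⟨ω, hω, hω0, rfl⟩ := hC.1
    have := hD.2 ω hω hω0 hCD
    rw [← this] at hfD
    exact (hCs hfD).2 rfl
  obtain ⟨C₃, h₃, he3, hs3⟩ := h₁.eliminate h₂ he he2 hf1 hf2
  obtain ⟨C₄, h₄, hg4, hs4⟩ := h₂.eliminate h₁ hg hg1 hf2 hf1
  obtain ⟨x, hx3, hx2, hx1⟩ := not_sub h₃ h₁ hf1 hs3
  obtain ⟨y, hy4, hy1, hy2⟩ := not_sub h₄ h₂ hf2 hs4
  have hsub : C₃ ∪ C₂ ⊆ C₁ ∪ C₂ :=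
    Set.union_subset (hs3.trans Set.sdiff_subset) Set.subset_union_right
  rcases hsub.eq_or_ssubset with heq | hss
  · have hy3 : y ∈ C₃ := by
      have : y ∈ C₃ ∪ C₂ := heq ▸ Or.inl hy1
      exact this.resolve_right hy2
    refine ih _ (Set.ncard_lt_ncard ?_ (Set.toFinite _)) h₃ h₄ ⟨y, hy3, hy4⟩ he3 hg4 rfl
    rw [Set.union_comm C₂ C₁] at hs4
    refine ⟨Set.union_subset (hs3.trans Set.sdiff_subset) (hs4.trans Set.sdiff_subset), fun h => ?_⟩
    rcases h (Or.inl hf1) with h | h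
    · exact (hs3 h).2 rfl
    · exact (hs4 h).2 rfl
  · exact ih _ (Set.ncard_lt_ncard hss (Set.toFinite _)) h₃ h₂ ⟨x, hx3, hx2⟩ he3 hg rfl

theorem rdCircuit_iff {W : Type*} [Fintype W] [DecidableEq W] {d : ℕ} {p : W → Fin d → ℝ}
    (hp : Generic p) (C : Set (Sym2 W)) : RdCircuit d C ↔ IsMinSupport (stress p) C := by
  have hsupp : ∀ (ω : Sym2 W → ℝ) (F : Set (Sym2 W)),
      (∀ e ∉ F, ω e = 0) ↔ Function.support ω ⊆ F := by
    intro ω F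
    rw [Function.support_subset_iff']
  simp only [RdCircuit, rdIndep_iff hp, hsupp]
  constructor
  · rintro ⟨h1, h2⟩
    have hmin : ∀ ω ∈ stress p, ω ≠ 0 → Function.support ω ⊆ C → Function.support ω = C := by
      intro ω hω h0 hs
      by_contra hne
      exact h0 (h2 _ (hs.ssubset_of_ne hne) ω hω subset_rfl)
    push Not at h1
    obtain ⟨ω, hω, hs, h0⟩ := h1
    exact ⟨⟨ω, hω, h0, hmin ω hω h0 hs⟩, hmin⟩
  · rintro ⟨⟨ω, hω, h0, rfl⟩, hmin⟩
    refine ⟨fun h => h0 (h ω hω subset_rfl), fun C' hC' ω' hω' hs => ?_⟩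
    by_contra h0'
    have := hmin ω' hω' h0' (hs.trans hC'.subset)
    exact hC'.2 (this ▸ hs)

end Circuits

section Affine

open Matrix

variable {W : Type*} [Fintype W] [DecidableEq W] {d : ℕ}

theorem Generic.linearIndepOn_sub {p : W → Fin d → ℝ} (hp : Generic p) {S : Finset W}
    (hS : S.card ≤ d + 1) {x₀ : W} (hx₀ : x₀ ∈ S) :
    LinearIndepOn ℝ (fun x => p x - p x₀) ((S.erase x₀ : Finset W) : Set W) := by
  have hli := linearIndepOn_finset_iff.mp (hp.linearIndepOn_hat hS)
  rw [linearIndepOn_finset_iff]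
  intro c hc x hx
  let c' : W → ℝ := fun y => if y = x₀ then - ∑ z ∈ S.erase x₀, c z else c y
  have hc' : ∀ y ∈ S.erase x₀, c' y = c y := fun y hy => by
    simp [c', Finset.ne_of_mem_erase hy]
  rw [← hc' x hx]
  refine hli c' ?_ x (Finset.mem_of_mem_erase hx)
  rw [← Finset.add_sum_erase _ _ hx₀, Finset.sum_congr rfl fun y hy => by rw [hc' y hy]]
  funext i
  refine Fin.cases ?_ (fun i => ?_) i
  · simp [c']
  · have := congrFun hc i
    simp only [Finset.sum_apply, Pi.smul_apply, Pi.sub_apply, smul_eq_mul, Pi.zero_apply,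
      mul_sub, Finset.sum_sub_distrib, ← Finset.sum_mul] at this
    simp only [c', Pi.add_apply, Pi.smul_apply, Finset.sum_apply, hat_succ, smul_eq_mul, if_true,
      Pi.zero_apply]
    linarith

theorem Generic.span_sub {p : W → Fin d → ℝ} (hp : Generic p) {S : Finset W}
    (hS : d + 1 ≤ S.card) {x₀ : W} (hx₀ : x₀ ∈ S) :
    Submodule.span ℝ ((fun x => p x - p x₀) '' S) = ⊤ := by
  obtain ⟨T, hxT, hTS, hT⟩ := Finset.exists_subsuperset_card_eq
    (Finset.singleton_subset_iff.mpr hx₀) (by simp) hS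
  have hli := hp.linearIndepOn_sub hT.le (Finset.singleton_subset_iff.mp hxT)
  have h1 := finrank_span_eq_card hli
  rw [← Set.image_eq_range (fun x => p x - p x₀)] at h1
  refine top_unique (le_trans (Submodule.eq_top_of_finrank_eq ?_).ge (Submodule.span_mono
    (Set.image_mono (s := ((T.erase x₀ : Finset W) : Set W)) ?_)))
  · rw [h1, Module.finrank_fin_fun, ← Nat.card_eq_fintype_card, Nat.card_coe_set_eq,
      Set.ncard_coe_finset]
    simp [Finset.card_erase_of_mem (Finset.singleton_subset_iff.mp hxT), hT]
  · exact_mod_cast (Finset.erase_subset _ _).trans hTS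

theorem mulVec_eq_zero_of_span {A : Matrix (Fin d) (Fin d) ℝ} {s : Set (Fin d → ℝ)}
    (hs : Submodule.span ℝ s = ⊤) (h : ∀ z ∈ s, A *ᵥ z = 0) : A = 0 := by
  have : A.mulVecLin = 0 := LinearMap.ext_on hs (fun z hz => by simpa using h z hz)
  exact Matrix.ext_of_mulVec_single fun i => by
    simpa only [Matrix.mulVecLin_apply, LinearMap.zero_apply, Matrix.zero_mulVec] using LinearMap.congr_fun this (Pi.single i 1)

theorem dotProduct_eq_zero_of_span {w : Fin d → ℝ} {s : Set (Fin d → ℝ)}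
    (hs : Submodule.span ℝ s = ⊤) (h : ∀ z ∈ s, z ⬝ᵥ w = 0) : w = 0 := by
  have key : ∀ z, z ⬝ᵥ w = 0 := fun z => by
    have hz : z ∈ Submodule.span ℝ s := hs ▸ Submodule.mem_top
    induction hz using Submodule.span_induction with
    | mem z hz => exact h z hz
    | zero => simp
    | add x y _ _ hx hy => simp [add_dotProduct, hx, hy]
    | smul c x _ hx => simp [hx]
  exact dotProduct_self_eq_zero.mp (key w)

/-- A linear map taking prescribed values on a spanning family, provided all linear relations
are respected. -/
theorem exists_matrix_of_relations {ι : Type*} [Fintype ι] (a b : ι → Fin d → ℝ)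
    (hs : Submodule.span ℝ (Set.range a) = ⊤)
    (h : ∀ c : ι → ℝ, ∑ x, c x • a x = 0 → ∑ x, c x • b x = 0) :
    ∃ A : Matrix (Fin d) (Fin d) ℝ, ∀ x, A *ᵥ a x = b x := by
  classical
  have hsurj : LinearMap.range (Fintype.linearCombination ℝ a) = ⊤ := by
    rw [Fintype.range_linearCombination, hs]
  obtain ⟨σ, hσ⟩ := LinearMap.exists_rightInverse_of_surjective _ hsurj
  refine ⟨LinearMap.toMatrix' ((Fintype.linearCombination ℝ b).comp σ), fun x => ?_⟩
  rw [← Matrix.toLin'_apply, Matrix.toLin'_toMatrix', LinearMap.comp_apply]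
  have h1 : Fintype.linearCombination ℝ a (σ (a x) - Pi.single x 1) = 0 := by
    rw [map_sub]
    have := LinearMap.congr_fun hσ (a x)
    simp only [LinearMap.comp_apply, LinearMap.id_apply] at this
    rw [this, Fintype.linearCombination_apply_single, one_smul, sub_self]
  have h2 := h _ (by simpa [Fintype.linearCombination_apply] using h1)
  have h3 : Fintype.linearCombination ℝ b (σ (a x) - Pi.single x 1) = 0 := by
    simpa [Fintype.linearCombination_apply] using h2
  rw [map_sub, sub_eq_zero, Fintype.linearCombination_apply_single, one_smul] at h3
  exact h3

theorem exists_skew_of_span {ι : Type*} [Fintype ι] (a b : ι → Fin d → ℝ)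
    (hs : Submodule.span ℝ (Set.range a) = ⊤)
    (h : ∀ x y, a x ⬝ᵥ b y + a y ⬝ᵥ b x = 0) :
    ∃ A : Matrix (Fin d) (Fin d) ℝ, Aᵀ = -A ∧ ∀ x, A *ᵥ a x = b x := by
  obtain ⟨A, hA⟩ := exists_matrix_of_relations a b hs fun c hc => by
    refine dotProduct_eq_zero_of_span hs ?_
    rintro _ ⟨y, rfl⟩
    have h1 : b y ⬝ᵥ ∑ x, c x • a x = 0 := by rw [hc, dotProduct_zero]
    rw [dotProduct_sum] at h1 ⊢
    rw [← neg_eq_zero, ← h1, ← Finset.sum_neg_distrib]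
    refine Finset.sum_congr rfl fun x _ => ?_
    rw [dotProduct_smul, dotProduct_smul, dotProduct_comm (b y), smul_eq_mul, smul_eq_mul]
    linear_combination (- c x) * h x y
  refine ⟨A, ?_, hA⟩
  rw [← sub_eq_zero]
  refine mulVec_eq_zero_of_span hs ?_
  rintro _ ⟨x, rfl⟩
  refine dotProduct_eq_zero_of_span hs ?_
  rintro _ ⟨y, rfl⟩
  rw [sub_neg_eq_add, add_mulVec, dotProduct_add, hA, dotProduct_mulVec, vecMul_transpose, hA,
    dotProduct_comm]
  linarith [h x y]

theorem exists_skew_of_linearIndependent {ι : Type*} [Fintype ι] (a b : ι → Fin d → ℝ)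
    (hi : LinearIndependent ℝ a) (h : ∀ x y, a x ⬝ᵥ b y + a y ⬝ᵥ b x = 0) :
    ∃ A : Matrix (Fin d) (Fin d) ℝ, Aᵀ = -A ∧ ∀ x, A *ᵥ a x = b x := by
  classical
  let P : Matrix (Fin d) ι ℝ := Matrix.of fun i x => a x i
  let M : Matrix (Fin d) ι ℝ := Matrix.of fun i x => b x i
  obtain ⟨Q, hQ⟩ : ∃ Q : Matrix ι (Fin d) ℝ, Q * P = 1 := by
    obtain ⟨g, hg⟩ := LinearMap.exists_leftInverse_of_injective
      (Fintype.linearCombination ℝ a) (LinearMap.ker_eq_bot.mpr (linearIndependent_iff_injective_fintypeLinearCombination.mp hi))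
    refine ⟨LinearMap.toMatrix' g, ?_⟩
    have : P = LinearMap.toMatrix' (Fintype.linearCombination ℝ a) := by
      ext i x
      rw [LinearMap.toMatrix'_apply]
      exact (congrFun (by rw [Fintype.linearCombination_apply_single, one_smul] :
        a x = (Fintype.linearCombination ℝ a) (Pi.single x 1)) i)
    rw [this, ← LinearMap.toMatrix'_comp, hg, LinearMap.toMatrix'_id]
  have hK : Mᵀ * P = - (Pᵀ * M) := by
    ext x y
    simp only [mul_apply, transpose_apply, Matrix.neg_apply, P, M, of_apply]
    have := h x y
    simp only [dotProduct] at this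
    rw [eq_neg_iff_add_eq_zero, ← this, add_comm]
    congr 1
    exact Finset.sum_congr rfl fun i _ => mul_comm _ _
  have hQ' : Pᵀ * Qᵀ = 1 := by rw [← transpose_mul, hQ, transpose_one]
  refine ⟨M * Q - Qᵀ * Mᵀ - Qᵀ * (Pᵀ * M) * Q, ?_, fun x => ?_⟩
  · have hK' : Mᵀ * (P * Q) = - (Pᵀ * (M * Q)) := by
      rw [← Matrix.mul_assoc, hK, Matrix.neg_mul, Matrix.mul_assoc]
    simp only [transpose_sub, transpose_mul, transpose_transpose, Matrix.mul_assoc, hK',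
      Matrix.mul_neg]
    abel
  · have h1 : (M * Q - Qᵀ * Mᵀ - Qᵀ * (Pᵀ * M) * Q) * P = M := by
      rw [Matrix.sub_mul, Matrix.sub_mul, Matrix.mul_assoc, hQ, Matrix.mul_assoc, hK, Matrix.mul_assoc, hQ]
      simp
    have h2 := congrArg (fun N => N *ᵥ Pi.single x 1) h1
    simp only [← mulVec_mulVec] at h2
    have e1 : P *ᵥ Pi.single x 1 = a x := by funext i; simp [P]
    have e2 : M *ᵥ Pi.single x 1 = b x := by funext i; simp [M]
    rwa [e1, e2] at h2

/-- `f` is affine on `S` with linear part `A`. -/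
def AffineOn (p f : W → Fin d → ℝ) (A : Matrix (Fin d) (Fin d) ℝ) (S : Set W) : Prop :=
  ∀ x ∈ S, ∀ y ∈ S, f x - f y = A *ᵥ (p x - p y)

theorem affineOn_of_base {p f : W → Fin d → ℝ} {A : Matrix (Fin d) (Fin d) ℝ} {S : Set W}
    {u : W} (h : ∀ x ∈ S, f x - f u = A *ᵥ (p x - p u)) : AffineOn p f A S := by
  intro x hx y hy
  rw [← sub_sub_sub_cancel_right (p x) (p y) (p u), mulVec_sub, ← h x hx, ← h y hy,
    sub_sub_sub_cancel_right]

theorem AffineOn.unique {p f : W → Fin d → ℝ} (hp : Generic p)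
    {A A' : Matrix (Fin d) (Fin d) ℝ} {S : Set W} (h : AffineOn p f A S)
    (h' : AffineOn p f A' S) {T : Finset W} (hT : d + 1 ≤ T.card) (hTS : ↑T ⊆ S) : A = A' := by
  obtain ⟨x₀, hx₀⟩ := Finset.card_pos.mp (by omega : 0 < T.card)
  rw [← sub_eq_zero]
  refine mulVec_eq_zero_of_span (hp.span_sub hT hx₀) ?_
  rintro _ ⟨x, hx, rfl⟩
  rw [sub_mulVec, ← h x (hTS hx) x₀ (hTS hx₀), ← h' x (hTS hx) x₀ (hTS hx₀), sub_self]

/-- Infinitesimal isometries of a generic point set are induced by skew matrices. -/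
theorem Generic.exists_skew {p m : W → Fin d → ℝ} (hp : Generic p) (S : Finset W)
    (hm : ∀ x ∈ S, ∀ y ∈ S, (p x - p y) ⬝ᵥ (m x - m y) = 0) :
    ∃ A : Matrix (Fin d) (Fin d) ℝ, Aᵀ = -A ∧ AffineOn p m A S := by
  rcases S.eq_empty_or_nonempty with rfl | ⟨x₀, hx₀⟩
  · exact ⟨0, by simp, fun x hx => by simp at hx⟩
  have hpol : ∀ x ∈ S, ∀ y ∈ S, (p x - p x₀) ⬝ᵥ (m y - m x₀) + (p y - p x₀) ⬝ᵥ (m x - m x₀) = 0 := by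
    intro x hx y hy
    have h1 := hm x hx y hy
    have h2 := hm x hx x₀ hx₀
    have h3 := hm y hy x₀ hx₀
    simp only [sub_dotProduct, dotProduct_sub] at *
    linarith
  rcases le_total S.card (d + 1) with hS | hS
  · have hli := hp.linearIndepOn_sub hS hx₀
    obtain ⟨A, hA, h⟩ := exists_skew_of_linearIndependent
      (fun x : ((S.erase x₀ : Finset W) : Set W) => p x - p x₀) (fun x => m x - m x₀) hli
      (fun x y => hpol _ (Finset.mem_of_mem_erase x.2) _ (Finset.mem_of_mem_erase y.2))
    refine ⟨A, hA, affineOn_of_base (u := x₀) fun x hx => ?_⟩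
    by_cases hxx : x = x₀
    · simp [hxx]
    · exact (h ⟨x, by simpa [hxx] using hx⟩).symm
  · have hs := hp.span_sub hS hx₀
    rw [Set.image_eq_range] at hs
    obtain ⟨A, hA, h⟩ := exists_skew_of_span
      (fun x : (S : Set W) => p x - p x₀) (fun x => m x - m x₀) hs
      (fun x y => hpol _ x.2 _ y.2)
    exact ⟨A, hA, affineOn_of_base (u := x₀) fun x hx => (h ⟨x, hx⟩).symm⟩

/-- Isometric images of sufficiently many generic points are induced by isometries. -/
theorem Generic.exists_isometry {p q : W → Fin d → ℝ} (hp : Generic p) {S : Finset W}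
    (hS : d + 1 ≤ S.card)
    (hq : ∀ x ∈ S, ∀ y ∈ S, (p x - p y) ⬝ᵥ (p x - p y) = (q x - q y) ⬝ᵥ (q x - q y)) :
    ∃ A : Matrix (Fin d) (Fin d) ℝ, (∀ z, (A *ᵥ z) ⬝ᵥ (A *ᵥ z) = z ⬝ᵥ z) ∧ AffineOn p q A S := by
  obtain ⟨x₀, hx₀⟩ := Finset.card_pos.mp (by omega : 0 < S.card)
  have hpol : ∀ x ∈ S, ∀ y ∈ S,
      (p x - p x₀) ⬝ᵥ (p y - p x₀) = (q x - q x₀) ⬝ᵥ (q y - q x₀) := by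
    intro x hx y hy
    have h1 := hq x hx y hy
    have h2 := hq x hx x₀ hx₀
    have h3 := hq y hy x₀ hx₀
    simp only [sub_dotProduct, dotProduct_sub, dotProduct_comm (p y) (p x),
      dotProduct_comm (q y) (q x), dotProduct_comm (p x₀), dotProduct_comm (q x₀)] at *
    linarith
  have hs := hp.span_sub hS hx₀
  rw [Set.image_eq_range] at hs
  have hsum : ∀ c : ((S : Set W) : Type _) → ℝ,
      (∑ x : (S : Set W), c x • (q x - q x₀)) ⬝ᵥ (∑ x : (S : Set W), c x • (q x - q x₀)) =
      (∑ x : (S : Set W), c x • (p x - p x₀)) ⬝ᵥ (∑ x : (S : Set W), c x • (p x - p x₀)) := by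
    intro c
    simp only [sum_dotProduct, dotProduct_sum, smul_dotProduct, dotProduct_smul]
    refine Finset.sum_congr rfl fun x _ => congrArg _ (Finset.sum_congr rfl fun y _ => ?_)
    rw [hpol y y.2 x x.2]
  obtain ⟨A, hA⟩ := exists_matrix_of_relations
    (fun x : (S : Set W) => p x - p x₀) (fun x => q x - q x₀) hs fun c hc =>
      dotProduct_self_eq_zero.mp (by rw [hsum, hc, dotProduct_zero])
  refine ⟨A, fun z => ?_, affineOn_of_base (u := x₀) fun x hx => (hA ⟨x, hx⟩).symm⟩
  obtain ⟨c, hc⟩ := (Submodule.mem_span_range_iff_exists_fun ℝ).mp (hs ▸ Submodule.mem_top : z ∈ _)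
  have : A *ᵥ z = ∑ x : (S : Set W), c x • (q x - q x₀) := by
    rw [← hc, ← Matrix.mulVecLin_apply, map_sum]
    refine Finset.sum_congr rfl fun x _ => ?_
    rw [map_smul, Matrix.mulVecLin_apply, hA]
  rw [this, hsum, hc]

end Affine

section BodyBar

open Matrix

variable {W U : Type*} [Fintype W] [DecidableEq W] {d : ℕ} {G : SimpleGraph W} {β : W → U}
  {mate : W → W}

/-- Body-bar graphs at the vertex level: `β x` is the body of `x`, and `mate x` is the other
endpoint of the bar at `x`. -/
structure BodyBar (G : SimpleGraph W) (β : W → U) (mate : W → W) : Prop where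
  mate_mate : ∀ x, mate (mate x) = x
  body_mate : ∀ x, β (mate x) ≠ β x
  adj : ∀ x y, G.Adj x y ↔ x ≠ y ∧ (β x = β y ∨ y = mate x)

theorem BodyBar.mate_ne (hB : BodyBar G β mate) (x : W) : mate x ≠ x :=
  fun h => hB.body_mate x (by rw [h])

/-- The bar at `a` is not a bridge. -/
def NB (p : W → Fin d → ℝ) (G : SimpleGraph W) (mate : W → W) (a : W) : Prop :=
  ∃ ω ∈ stress p, (∀ e ∉ G.edgeSet, ω e = 0) ∧ ω s(a, mate a) ≠ 0

theorem BodyBar.nb_mate (hB : BodyBar G β mate) {p : W → Fin d → ℝ} {a : W}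
    (h : NB p G mate a) : NB p G mate (mate a) := by
  obtain ⟨ω, h1, h2, h3⟩ := h
  exact ⟨ω, h1, h2, by rwa [hB.mate_mate, Sym2.eq_swap]⟩

/-- One step along a body or along a bar which is not a bridge. -/
def LinkStep (p : W → Fin d → ℝ) (G : SimpleGraph W) (β : W → U) (mate : W → W) (x y : W) : Prop :=
  β x = β y ∨ (y = mate x ∧ NB p G mate x)

/-- Reachability along bodies and bars that are not bridges. -/
def Link (p : W → Fin d → ℝ) (G : SimpleGraph W) (β : W → U) (mate : W → W) : W → W → Prop :=
  Relation.ReflTransGen (LinkStep p G β mate)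

theorem BodyBar.link_symm (hB : BodyBar G β mate) {p : W → Fin d → ℝ} {x y : W}
    (h : Link p G β mate x y) : Link p G β mate y x := by
  have : Std.Symm (LinkStep p G β mate) := ⟨by
    rintro x y (h | ⟨rfl, h⟩)
    · exact Or.inl h.symm
    · exact Or.inr ⟨(hB.mate_mate x).symm, hB.nb_mate h⟩⟩
  exact (Relation.ReflTransGen.stdSymm (r := LinkStep p G β mate)).symm _ _ h

theorem Link.trans {p : W → Fin d → ℝ} {x y z : W} (h : Link p G β mate x y)
    (h' : Link p G β mate y z) : Link p G β mate x z := Relation.ReflTransGen.trans h h'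

theorem Link.of_body {p : W → Fin d → ℝ} {x y : W} (h : β x = β y) : Link p G β mate x y :=
  .single (Or.inl h)

theorem Link.of_nb {p : W → Fin d → ℝ} {x : W} (h : NB p G mate x) :
    Link p G β mate x (mate x) := .single (Or.inr ⟨rfl, h⟩)

/-- A stress respected by `f` determines `f` along the last edge of a vertex star. -/
theorem stress_vertex {p f : W → Fin d → ℝ} {ω : Sym2 W → ℝ} (hp : ω ∈ stress p)
    (hf : ω ∈ stress f) {A : Matrix (Fin d) (Fin d) ℝ} {x b : W} (hb : ω s(x, b) ≠ 0)
    (h : ∀ y, y ≠ b → y ≠ x → ω s(x, y) ≠ 0 → f x - f y = A *ᵥ (p x - p y)) :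
    f x - f b = A *ᵥ (p x - p b) := by
  have vec : ∀ r : W → Fin d → ℝ, ω ∈ stress r → ∑ y, ω s(x, y) • (r x - r y) = 0 := by
    intro r hr
    funext i
    simpa using hr x i
  have h1 := vec f hf
  have h2 := congrArg (fun z => A *ᵥ z) (vec p hp)
  simp only [mulVec_zero, mulVec_sum, mulVec_smul] at h2
  have h3 : ∑ y, ω s(x, y) • ((f x - f y) - A *ᵥ (p x - p y)) = 0 := by
    simp only [smul_sub, Finset.sum_sub_distrib] at h1 h2 ⊢
    simp only [mulVec_sub, smul_sub, Finset.sum_sub_distrib] at h2 ⊢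
    rw [h1, h2, sub_zero]
  rw [Finset.sum_eq_single b] at h3
  · exact sub_eq_zero.mp ((smul_eq_zero.mp h3).resolve_left hb)
  · intro y _ hy
    by_cases hyx : y = x
    · simp [hyx]
    · by_cases h0 : ω s(x, y) = 0
      · simp [h0]
      · rw [h y hy hyx h0, sub_self, smul_zero]
  · simp

open Classical in
/-- The vertices of the body of `x`. -/
def bodyOf (β : W → U) (x : W) : Finset W := Finset.univ.filter fun y => β y = β x

@[simp] theorem mem_bodyOf {x y : W} : y ∈ bodyOf β x ↔ β y = β x := by simp [bodyOf]

theorem BodyBar.card_body (hB : BodyBar G β mate) {p : W → Fin d → ℝ} (hp : Generic p) {a : W}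
    (h : NB p G mate a) : d + 1 ≤ (bodyOf β a).card := by
  obtain ⟨ω, h1, h2, h3⟩ := h
  have ha : a ∈ bodyOf β a := by simp
  have := hp.card_support_stress h1 (hB.mate_ne a).symm h3
    (N := insert (mate a) ((bodyOf β a).erase a)) (fun y hy hy0 => ?_) ?_
  · rwa [Finset.card_insert_of_notMem, Finset.card_erase_add_one ha] at this
    simp [hB.body_mate]
  · have : s(a, y) ∈ G.edgeSet := by by_contra hc; exact hy0 (h2 _ hc)
    rw [SimpleGraph.mem_edgeSet, hB.adj] at this
    rcases this.2 with h | h <;> simp [h, hy]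
  · simp [(hB.mate_ne a).symm]

theorem Motion.insert_of_skew {J : Set (Sym2 W)} {p m : W → Fin d → ℝ} (hm : Motion J p m)
    {A : Matrix (Fin d) (Fin d) ℝ} (hA : Aᵀ = -A) {b x : W} (h : m b - m x = A *ᵥ (p b - p x)) :
    Motion (insert s(b, x) J) p m := by
  have hskew : ∀ z : Fin d → ℝ, z ⬝ᵥ A *ᵥ z = 0 := fun z => by
    have : z ⬝ᵥ A *ᵥ z = - (z ⬝ᵥ A *ᵥ z) := by
      conv_lhs => rw [dotProduct_mulVec, ← mulVec_transpose, hA, neg_mulVec, neg_dotProduct,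
        dotProduct_comm]
    linarith
  have hbx : ∑ i, (p b i - p x i) * (m b i - m x i) = 0 := by
    have := hskew (p b - p x)
    rwa [← h] at this
  intro y z hyz
  rcases hyz with hyz | hyz
  · rcases Sym2.eq_iff.mp hyz with ⟨rfl, rfl⟩ | ⟨rfl, rfl⟩
    · exact hbx
    · rw [← hbx]
      exact Finset.sum_congr rfl fun i _ => by ring
  · exact hm y z hyz

/-- Rigid transfer across a bar which is not a bridge. -/
theorem BodyBar.transfer (hB : BodyBar G β mate) {p : W → Fin d → ℝ} (hp : Generic p)
    {J : Set (Sym2 W)} (hJ : J ⊆ G.edgeSet) {a : W}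
    (hJa : ∀ x y, β x = β a → β y = β a → x ≠ y → s(x, y) ∈ J)
    {ω : Sym2 W → ℝ} (hω : ω ∈ stress p) (hωJ : ∀ e ∉ J, ω e = 0) (hωa : ω s(a, mate a) ≠ 0)
    {f : W → Fin d → ℝ} {A A' : Matrix (Fin d) (Fin d) ℝ}
    (hA : AffineOn p f A {x | β x = β a}) (hA' : AffineOn p f A' {x | β x = β (mate a)})
    (hfJ : RespectsStress J p f)
    (hf : ∀ x, f (mate a) - f x = A *ᵥ (p (mate a) - p x) →
      RespectsStress (insert s(mate a, x) J) p f) :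
    A = A' ∧ ∀ y, β y = β (mate a) → f y - f a = A *ᵥ (p y - p a) := by
  have hcases : ∀ x y, x ≠ y → s(x, y) ∈ J → β y = β x ∨ y = mate x := fun x y _ hxy =>
    (((hB.adj x y).mp (hJ hxy)).2).imp_left Eq.symm
  -- the bar itself
  have hbar : ∀ {g : W → Fin d → ℝ} {C : Matrix (Fin d) (Fin d) ℝ},
      AffineOn p g C {x | β x = β a} → RespectsStress J p g →
      g a - g (mate a) = C *ᵥ (p a - p (mate a)) := fun {g C} hC hg => by
    refine stress_vertex hω (hg ω hω hωJ) hωa fun y hy hya h0 => ?_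
    have hmem : s(a, y) ∈ J := by by_contra hc; exact h0 (hωJ _ hc)
    exact hC a rfl y ((hcases a y hya.symm hmem).resolve_right hy)
  have hbar1 := hbar hA hfJ
  have hbar2 : f (mate a) - f a = A' *ᵥ (p (mate a) - p a) := by
    refine stress_vertex hω (hfJ ω hω hωJ) (by rwa [Sym2.eq_swap]) fun y hy hya h0 => ?_
    have hmem : s(mate a, y) ∈ J := by by_contra hc; exact h0 (hωJ _ hc)
    exact hA' _ rfl y ((hcases _ y hya.symm hmem).resolve_right (by rwa [hB.mate_mate]))
  have hx : ∀ x, β x = β a → f (mate a) - f x = A' *ᵥ (p (mate a) - p x) := by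
    intro x hxa
    by_cases hxe : x = a
    · rw [hxe, hbar2]
    have hne : mate a ≠ x := fun h => hB.body_mate a (by rw [h, hxa])
    have hnot : s(mate a, x) ∉ J := fun h => by
      rcases hcases _ _ hne h with h | h
      · exact hB.body_mate a (by rw [← h, hxa])
      · exact hxe (by rw [h, hB.mate_mate])
    have hext : ∀ {g : W → Fin d → ℝ} {C : Matrix (Fin d) (Fin d) ℝ},
        AffineOn p g C {x | β x = β a} → RespectsStress J p g →
        g (mate a) - g x = C *ᵥ (p (mate a) - p x) := fun {g C} hC hg => by
      have h1 := hbar hC hg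
      have h2 := hC a rfl x hxa
      rw [← sub_sub_sub_cancel_left _ _ (g a), h2, h1, ← mulVec_sub, sub_sub_sub_cancel_left]
    rcases exists_stress_or_motion J p (mate a) x with ⟨τ, hτ, hτ1, hτJ⟩ | ⟨m, hm, hm0⟩
    · have hτJ' : ∀ e ∉ insert s(mate a, x) J, τ e = 0 := fun e he => by
        rw [Set.mem_insert_iff, not_or] at he
        exact hτJ e he.2 he.1
      refine stress_vertex hτ (hf x (hext hA hfJ) τ hτ hτJ') (by rw [hτ1]; exact one_ne_zero)
        fun y hy hya h0 => ?_
      by_cases hya' : y = a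
      · rw [hya', hbar2]
      have hmem : s(mate a, y) ∈ J := by
        by_contra hc
        exact h0 (hτJ _ hc fun h => hy ((Sym2.congr_right).mp h))
      exact hA' _ rfl y ((hcases _ y hya.symm hmem).resolve_right (by rwa [hB.mate_mate]))
    · rw [Set.sdiff_singleton_eq_self hnot] at hm
      obtain ⟨C, hCs, hC⟩ := hp.exists_skew (m := m) (bodyOf β a) (fun y hy z hz => by
        by_cases hyz : y = z
        · simp [hyz]
        · exact hm y z (hJa y z (by simpa using hy) (by simpa using hz) hyz))
      refine absurd (hm.insert_of_skew hCs (hext (fun y hy z hz =>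
        hC y (by simpa using hy) z (by simpa using hz)) (respectsStress_of_motion hp hm))
        (mate a) x (Set.mem_insert _ _)) hm0
  have hAA' : A = A' := by
    refine AffineOn.unique hp hA ?_
      (hB.card_body hp ⟨ω, hω, fun e he => hωJ e (fun h => he (hJ h)), hωa⟩)
      (fun x hx => by simpa using hx)
    refine fun x hxa y hya => ?_
    rw [← sub_sub_sub_cancel_left _ _ (f (mate a)), hx x hxa, hx y hya, ← mulVec_sub,
      sub_sub_sub_cancel_left]
  refine ⟨hAA', fun y hy => ?_⟩
  subst hAA'
  rw [← sub_add_sub_cancel _ (f (mate a)), hbar2, hA' y hy _ rfl, ← mulVec_add, sub_add_sub_cancel]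

/-- Rigid transfer along linked bodies. -/
theorem BodyBar.chain (hB : BodyBar G β mate) {p : W → Fin d → ℝ} (hp : Generic p)
    {J : Set (Sym2 W)} (hJ : J ⊆ G.edgeSet) {u : W}
    (hJu : ∀ x y, Link p G β mate u x → β x = β y → x ≠ y → s(x, y) ∈ J)
    (hNB : ∀ x, Link p G β mate u x → NB p G mate x →
      ∃ ω ∈ stress p, (∀ e ∉ J, ω e = 0) ∧ ω s(x, mate x) ≠ 0)
    {f : W → Fin d → ℝ} {A : Matrix (Fin d) (Fin d) ℝ}
    (hA : AffineOn p f A {x | β x = β u})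
    (hbody : ∀ x, Link p G β mate u x → NB p G mate x →
      ∃ A', AffineOn p f A' {y | β y = β x})
    (hfJ : RespectsStress J p f)
    (hf : ∀ b x, f b - f x = A *ᵥ (p b - p x) → RespectsStress (insert s(b, x) J) p f)
    {x : W} (hx : Link p G β mate u x) : f x - f u = A *ᵥ (p x - p u) := by
  suffices f x - f u = A *ᵥ (p x - p u) ∧ AffineOn p f A {y | β y = β x} from this.1
  induction hx with
  | refl => exact ⟨by simp, hA⟩
  | @tail x y hux hxy ih =>
    obtain ⟨ih1, ih2⟩ := ih
    rcases hxy with hxy | ⟨rfl, hxy⟩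
    · refine ⟨?_, by rwa [← hxy]⟩
      rw [← sub_add_sub_cancel _ (f x), ih1, ih2 y hxy.symm x rfl, ← mulVec_add,
        sub_add_sub_cancel]
    · obtain ⟨ω, h1, h2, h3⟩ := hNB x hux hxy
      obtain ⟨A', hA'⟩ := hbody (mate x) (hux.trans (Link.of_nb hxy)) (hB.nb_mate hxy)
      obtain ⟨rfl, h⟩ := hB.transfer hp hJ (fun y z hy hz hyz => hJu y z
        (Link.trans hux (Link.of_body hy.symm)) (by rw [hy, hz]) hyz) h1 h2 h3 ih2 hA' hfJ (hf _)
      refine ⟨?_, hA'⟩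
      rw [← sub_add_sub_cancel _ (f x), ih1, h _ rfl, ← mulVec_add, sub_add_sub_cancel]

/-- Motions are rigid on linked classes. -/
theorem BodyBar.chain_motion (hB : BodyBar G β mate) {p : W → Fin d → ℝ} (hp : Generic p)
    {J : Set (Sym2 W)} (hJ : J ⊆ G.edgeSet) {u : W}
    (hJu : ∀ x y, Link p G β mate u x → β x = β y → x ≠ y → s(x, y) ∈ J)
    (hNB : ∀ x, Link p G β mate u x → NB p G mate x →
      ∃ ω ∈ stress p, (∀ e ∉ J, ω e = 0) ∧ ω s(x, mate x) ≠ 0)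
    {m : W → Fin d → ℝ} (hm : Motion J p m) :
    ∃ A : Matrix (Fin d) (Fin d) ℝ, Aᵀ = -A ∧
      ∀ x, Link p G β mate u x → m x - m u = A *ᵥ (p x - p u) := by
  have hbody : ∀ x, Link p G β mate u x → ∃ A' : Matrix (Fin d) (Fin d) ℝ, A'ᵀ = -A' ∧
      AffineOn p m A' {y | β y = β x} := fun x hx => by
    obtain ⟨C, hCs, hC⟩ := hp.exists_skew (m := m) (bodyOf β x) (fun y hy z hz => by
      rw [mem_bodyOf] at hy hz
      by_cases hyz : y = z
      · simp [hyz]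
      · exact hm y z (hJu y z (hx.trans (Link.of_body hy.symm)) (by rw [hy, hz]) hyz))
    exact ⟨C, hCs, fun y hy z hz => hC y (by simpa using hy) z (by simpa using hz)⟩
  obtain ⟨A, hAs, hA⟩ := hbody u .refl
  refine ⟨A, hAs, fun x hx => hB.chain hp hJ hJu hNB hA
    (fun x hx _ => (hbody x hx).imp fun _ h => h.2) (respectsStress_of_motion hp hm)
    (fun b x h => respectsStress_of_motion hp (hm.insert_of_skew hAs h)) hx⟩

theorem BodyBar.mem_edgeSet_of_body (hB : BodyBar G β mate) {x y : W} (h : β x = β y)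
    (hxy : x ≠ y) : s(x, y) ∈ G.edgeSet := (hB.adj x y).mpr ⟨hxy, Or.inl h⟩

theorem Link.exists_nb {p : W → Fin d → ℝ} {u v : W} (h : Link p G β mate u v)
    (hβ : β u ≠ β v) : ∃ a, β a = β u ∧ NB p G mate a := by
  by_contra hcon
  push Not at hcon
  refine hβ ?_
  clear hβ
  induction h with
  | refl => rfl
  | tail _ hxy ih =>
    rcases hxy with hxy | ⟨rfl, hxy⟩
    · rw [ih, hxy]
    · exact absurd hxy (hcon _ ih.symm)

/-- Linked vertices are globally linked. -/
theorem BodyBar.dist_eq_of_link (hB : BodyBar G β mate) {p q : W → Fin d → ℝ} (hp : Generic p)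
    (hq : ∀ x y, G.Adj x y → ∑ i, (p x i - p y i) ^ 2 = ∑ i, (q x i - q y i) ^ 2)
    {u v : W} (h : Link p G β mate u v) :
    ∑ i, (p v i - p u i) ^ 2 = ∑ i, (q v i - q u i) ^ 2 := by
  have hdot : ∀ (r : W → Fin d → ℝ) x y, ∑ i, (r x i - r y i) ^ 2 = (r x - r y) ⬝ᵥ (r x - r y) :=
    fun r x y => by simp [dotProduct, sq]
  by_cases hne : u = v
  · simp [hne]
  by_cases hβ : β u = β v
  · exact hq v u (hB.mem_edgeSet_of_body hβ hne).symm
  have hiso : ∀ x, NB p G mate x → ∃ A : Matrix (Fin d) (Fin d) ℝ,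
      (∀ z, (A *ᵥ z) ⬝ᵥ (A *ᵥ z) = z ⬝ᵥ z) ∧ AffineOn p q A {y | β y = β x} := fun x hx => by
    obtain ⟨C, hCs, hC⟩ := hp.exists_isometry (q := q) (hB.card_body hp hx) (fun y hy z hz => by
      rw [mem_bodyOf] at hy hz
      by_cases hyz : y = z
      · simp [hyz]
      · rw [← hdot, ← hdot]
        exact hq y z (hB.mem_edgeSet_of_body (by rw [hy, hz]) hyz))
    exact ⟨C, hCs, fun y hy z hz => hC y (by simpa using hy) z (by simpa using hz)⟩
  obtain ⟨a, hau, ha⟩ := h.exists_nb hβ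
  obtain ⟨A, hAi, hA⟩ := hiso a ha
  rw [hau] at hA
  have := hB.chain hp subset_rfl (fun x y _ h hxy => hB.mem_edgeSet_of_body h hxy)
    (fun x _ hx => hx) hA (fun x _ hx => (hiso x hx).imp fun _ h => h.2)
    (respectsStress_of_equivalent hp fun x y h => hq x y h) (fun b x hbx => by
      refine respectsStress_of_equivalent hp fun y z hyz => ?_
      rcases hyz with hyz | hyz
      · have key : ∑ i, (p b i - p x i) ^ 2 = ∑ i, (q b i - q x i) ^ 2 := by
          rw [hdot, hdot, hbx, hAi]
        rcases Sym2.eq_iff.mp hyz with ⟨rfl, rfl⟩ | ⟨rfl, rfl⟩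
        · exact key
        · simpa only [sub_sq_comm] using key
      · exact hq y z hyz) h
  rw [hdot, hdot, this, hAi]

end BodyBar

section ConnectedToLink

variable {W U : Type*} [Fintype W] [DecidableEq W] {d : ℕ} {G : SimpleGraph W} {β : W → U}
  {mate : W → W}

theorem BodyBar.link_of_connected (hB : BodyBar G β mate) {p : W → Fin d → ℝ} (hp : Generic p)
    {F : Set (Sym2 W)} (hF : F ⊆ G.edgeSet) (hc : RdConnectedSet d F) {u v : W} (huv : u ≠ v)
    (hu : u ∈ vertexSpan F) (hv : v ∈ vertexSpan F) (hadj : ¬ G.Adj u v) :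
    Link p G β mate u v := by
  classical
  obtain ⟨e, he, hue⟩ := hu
  obtain ⟨f, hf, hvf⟩ := hv
  rcases hc.2 e he f hf with rfl | ⟨C, hCF, hC, heC, hfC⟩
  · exact absurd (hF ((Sym2.mem_and_mem_iff huv).mp ⟨hue, hvf⟩ ▸ he)) hadj
  rw [rdCircuit_iff hp] at hC
  obtain ⟨⟨ω, hω, hω0, hωC⟩, hmin⟩ := hC
  have hsupp : ∀ g, ω g ≠ 0 ↔ g ∈ C := fun g => by rw [← hωC, Function.mem_support]
  have hωG : ∀ g ∉ G.edgeSet, ω g = 0 := fun g hg => by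
    by_contra h
    exact hg (hF (hCF ((hsupp g).mp h)))
  have hstep : ∀ x y, ω s(x, y) ≠ 0 → Link p G β mate x y := fun x y hxy => by
    have : s(x, y) ∈ G.edgeSet := by by_contra hc; exact hxy (hωG _ hc)
    rcases ((hB.adj x y).mp this).2 with h | rfl
    · exact Link.of_body h
    · exact Link.of_nb ⟨ω, hω, hωG, hxy⟩
  let ω' : Sym2 W → ℝ := fun g => if ∃ x ∈ g, Link p G β mate u x then ω g else 0
  have hω' : ω' ∈ stress p := by
    intro x i
    by_cases hx : Link p G β mate u x
    · rw [← hω x i]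
      refine Finset.sum_congr rfl fun y _ => ?_
      have : ∃ z ∈ s(x, y), Link p G β mate u z := ⟨x, by simp, hx⟩
      simp only [ω', if_pos this]
    · refine Finset.sum_eq_zero fun y _ => ?_
      by_cases hxy : ω s(x, y) = 0
      · simp [ω', hxy]
      · have : ¬ ∃ z ∈ s(x, y), Link p G β mate u z := by
          rintro ⟨z, hz, huz⟩
          rcases Sym2.mem_iff.mp hz with rfl | rfl
          · exact hx huz
          · exact hx (huz.trans (hB.link_symm (hstep _ _ hxy)))
        simp [ω', if_neg this]
  have hsub : Function.support ω' ⊆ C := fun g hg => by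
    rw [← hsupp]
    intro h
    simp [ω', h] at hg
  have he' : ω' e ≠ 0 := by
    have : ∃ x ∈ e, Link p G β mate u x := ⟨u, hue, .refl⟩
    simpa only [ω', if_pos this] using (hsupp e).mpr heC
  have hf' : ω' f ≠ 0 := by
    rw [← hmin ω' hω' (fun h => he' (by rw [h]; rfl)) hsub] at hfC
    exact hfC
  have : ∃ x ∈ f, Link p G β mate u x := by
    by_contra h
    exact hf' (by simp only [ω', if_neg h])
  obtain ⟨x, hxf, hux⟩ := this
  by_cases hxv : x = v
  · exact hxv ▸ hux
  · have hfe := (Sym2.mem_and_mem_iff hxv).mp ⟨hxf, hvf⟩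
    exact hux.trans (hstep _ _ (by rw [← hfe]; exact (hsupp f).mpr hfC))

end ConnectedToLink

section Skew

open Matrix

variable {W : Type*} [Fintype W] [DecidableEq W] {d : ℕ}

theorem Generic.span_hat {p : W → Fin d → ℝ} (hp : Generic p) {S : Finset W}
    (hS : d + 1 ≤ S.card) : Submodule.span ℝ ((fun x => hat (p x)) '' S) = ⊤ := by
  obtain ⟨T, hTS, hT⟩ := Finset.exists_subset_card_eq hS
  have hli := hp.linearIndepOn_hat hT.le
  have h1 := finrank_span_eq_card hli
  rw [← Set.image_eq_range (fun x => hat (p x))] at h1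
  refine top_unique (le_trans (Submodule.eq_top_of_finrank_eq ?_).ge (Submodule.span_mono
    (Set.image_mono (s := (T : Set W)) (by exact_mod_cast hTS))))
  rw [h1, Module.finrank_fin_fun, ← Nat.card_eq_fintype_card, Nat.card_coe_set_eq,
    Set.ncard_coe_finset, hT]

/-- The velocity at `x` of the infinitesimal isometry encoded by `Ω`. -/
def velocity (Ω : Matrix (Fin (d + 1)) (Fin (d + 1)) ℝ) (x : Fin d → ℝ) : Fin d → ℝ :=
  fun i => (Ω *ᵥ hat x) i.succ

theorem skew_dotProduct {n : ℕ} {Ω : Matrix (Fin n) (Fin n) ℝ} (h : Ωᵀ = -Ω) (x y : Fin n → ℝ) :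
    x ⬝ᵥ Ω *ᵥ y = - (y ⬝ᵥ Ω *ᵥ x) := by
  rw [dotProduct_mulVec, ← mulVec_transpose, h, neg_mulVec, neg_dotProduct, dotProduct_comm]

theorem skew_dotProduct_self {n : ℕ} {Ω : Matrix (Fin n) (Fin n) ℝ} (h : Ωᵀ = -Ω)
    (x : Fin n → ℝ) : x ⬝ᵥ Ω *ᵥ x = 0 := by
  linarith [skew_dotProduct h x x]

theorem sum_sub_mul_velocity {Ω Ω' : Matrix (Fin (d + 1)) (Fin (d + 1)) ℝ} (h : Ωᵀ = -Ω)
    (h' : Ω'ᵀ = -Ω') (x y : Fin d → ℝ) :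
    ∑ i, (x i - y i) * (velocity Ω x i - velocity Ω' y i) = hat x ⬝ᵥ (Ω - Ω') *ᵥ hat y := by
  have h1 : ∑ i, (x i - y i) * (velocity Ω x i - velocity Ω' y i) =
      (hat x - hat y) ⬝ᵥ (Ω *ᵥ hat x - Ω' *ᵥ hat y) := by
    simp [dotProduct, Fin.sum_univ_succ, velocity]
  rw [h1, sub_mulVec, sub_dotProduct, dotProduct_sub, dotProduct_sub, dotProduct_sub,
    skew_dotProduct_self h, skew_dotProduct_self h', skew_dotProduct h]
  ring

theorem eq_zero_of_velocity {p : W → Fin d → ℝ} (hp : Generic p) {S : Finset W}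
    (hS : d + 1 ≤ S.card) {Ω : Matrix (Fin (d + 1)) (Fin (d + 1)) ℝ} (h : Ωᵀ = -Ω)
    (h0 : ∀ x ∈ S, velocity Ω (p x) = 0) : Ω = 0 := by
  have hrow : ∀ (i : Fin d) j, Ω i.succ j = 0 := fun i j => by
    have : Ω i.succ = 0 := by
      refine dotProduct_eq_zero_of_span (hp.span_hat hS) ?_
      rintro _ ⟨x, hx, rfl⟩
      rw [dotProduct_comm]
      exact congrFun (h0 x hx) i
    rw [this]; rfl
  have hT : ∀ i j, Ω j i = - Ω i j := fun i j => congrFun (congrFun h i) j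
  ext i j
  refine Fin.cases ?_ (fun i => ?_) i
  · refine Fin.cases ?_ (fun j => ?_) j
    · have := hT 0 0
      rw [Matrix.zero_apply]
      linarith
    · rw [hT, hrow, neg_zero, Matrix.zero_apply]
  · exact hrow i j

theorem exists_skew_kernel {n : ℕ} {ι : Type*} [Fintype ι] (a : ι → Fin n → ℝ)
    (hι : Fintype.card ι + 2 ≤ n) :
    ∃ Ω : Matrix (Fin n) (Fin n) ℝ, Ωᵀ = -Ω ∧ Ω ≠ 0 ∧ ∀ x, Ω *ᵥ a x = 0 := by
  let N : Matrix ι (Fin n) ℝ := Matrix.of a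
  have hK : 1 < Module.finrank ℝ (LinearMap.ker N.mulVecLin) := by
    have h1 := LinearMap.finrank_range_add_finrank_ker N.mulVecLin
    have h2 := Submodule.finrank_le (LinearMap.range N.mulVecLin)
    rw [Module.finrank_fin_fun] at h1
    rw [Module.finrank_fintype_fun_eq_card] at h2
    omega
  have : Nontrivial (LinearMap.ker N.mulVecLin) :=
    Module.nontrivial_of_finrank_pos (R := ℝ) (by omega)
  obtain ⟨y, hy⟩ := exists_ne (0 : LinearMap.ker N.mulVecLin)
  obtain ⟨z, hyz⟩ := exists_linearIndependent_pair_of_one_lt_finrank hK hy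
  have hker : ∀ w : LinearMap.ker N.mulVecLin, ∀ x, (w : Fin n → ℝ) ⬝ᵥ a x = 0 := fun w x => by
    have := congrFun (LinearMap.mem_ker.mp w.2) x
    rw [dotProduct_comm]
    exact this
  let y' : Fin n → ℝ := y
  let z' : Fin n → ℝ := z
  have hmul : ∀ w, (vecMulVec y' z' - vecMulVec z' y') *ᵥ w = (z' ⬝ᵥ w) • y' - (y' ⬝ᵥ w) • z' :=
    fun w => by
      rw [sub_mulVec, vecMulVec_mulVec, vecMulVec_mulVec]
      simp
  refine ⟨vecMulVec y' z' - vecMulVec z' y', ?_, fun h0 => ?_, fun x => ?_⟩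
  · rw [transpose_sub, transpose_vecMulVec, transpose_vecMulVec, neg_sub]
  · have h1 := hmul z'
    rw [h0, zero_mulVec] at h1
    have h2 := LinearIndependent.pair_iff.mp hyz (z' ⬝ᵥ z') (- (y' ⬝ᵥ z')) (by
      apply Subtype.ext
      rw [neg_smul, ← sub_eq_add_neg]
      exact h1.symm)
    have hz : z = 0 := Subtype.ext (dotProduct_self_eq_zero.mp h2.1)
    have := hyz.ne_zero 1
    exact this hz
  · rw [hmul, hker, hker, zero_smul, zero_smul, sub_zero]

end Skew

section Components

open Matrix

variable {W U : Type*} [Fintype W] [DecidableEq W] {d : ℕ} {G : SimpleGraph W} {β : W → U}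
  {mate : W → W}

/-- The stresses of `(G,p)`. -/
def gstress (p : W → Fin d → ℝ) (G : SimpleGraph W) : Submodule ℝ (Sym2 W → ℝ) where
  carrier := {ω | ω ∈ stress p ∧ ∀ e ∉ G.edgeSet, ω e = 0}
  add_mem' := fun ha hb => ⟨add_mem ha.1 hb.1, fun e he => by simp [ha.2 e he, hb.2 e he]⟩
  zero_mem' := ⟨zero_mem _, fun _ _ => rfl⟩
  smul_mem' := fun c _ ha => ⟨Submodule.smul_mem _ c ha.1, fun e he => by simp [ha.2 e he]⟩

/-- Two edges are equal or lie on a common circuit of `G`. -/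
def CC (p : W → Fin d → ℝ) (G : SimpleGraph W) (e f : Sym2 W) : Prop :=
  e = f ∨ ∃ C, IsMinSupport (gstress p G) C ∧ e ∈ C ∧ f ∈ C

theorem CC.symm {p : W → Fin d → ℝ} {e f : Sym2 W} (h : CC p G e f) : CC p G f e :=
  h.imp Eq.symm fun ⟨C, hC, h1, h2⟩ => ⟨C, hC, h2, h1⟩

theorem CC.trans {p : W → Fin d → ℝ} {e f g : Sym2 W} (h : CC p G e f) (h' : CC p G f g) :
    CC p G e g := by
  rcases h with rfl | ⟨C, hC, he, hf⟩
  · exact h'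
  rcases h' with rfl | ⟨C', hC', hf', hg⟩
  · exact Or.inr ⟨C, hC, he, hf⟩
  · exact Or.inr (hC.trans hC' ⟨f, hf, hf'⟩ he hg)

theorem isMinSupport_gstress {p : W → Fin d → ℝ} {C : Set (Sym2 W)}
    (h : IsMinSupport (gstress p G) C) : IsMinSupport (stress p) C ∧ C ⊆ G.edgeSet := by
  obtain ⟨⟨ω, hω, hω0, rfl⟩, hmin⟩ := h
  have hsub : Function.support ω ⊆ G.edgeSet := fun e he => by
    by_contra h
    exact he (hω.2 e h)
  exact ⟨⟨⟨ω, hω.1, hω0, rfl⟩, fun ω' hω' h0 hs => hmin ω' ⟨hω', fun e he => by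
    by_contra h
    exact he (hsub (hs h))⟩ h0 hs⟩, hsub⟩

/-- The edges of `G` related to `e`. -/
def component (p : W → Fin d → ℝ) (G : SimpleGraph W) (e : Sym2 W) : Set (Sym2 W) :=
  {f | f ∈ G.edgeSet ∧ CC p G e f}

theorem component_connected {p : W → Fin d → ℝ} (hp : Generic p) {e : Sym2 W}
    (he : e ∈ G.edgeSet) : RdConnectedSet d (component p G e) := by
  refine ⟨⟨e, he, Or.inl rfl⟩, fun f hf g hg => ?_⟩
  rcases hf.2.symm.trans hg.2 with h | ⟨C, hC, hfC, hgC⟩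
  · exact Or.inl h
  · refine Or.inr ⟨C, fun c hc => ⟨(isMinSupport_gstress hC).2 hc,
      hf.2.trans (Or.inr ⟨C, hC, hfC, hc⟩)⟩, (rdCircuit_iff hp C).mpr (isMinSupport_gstress hC).1,
      hfC, hgC⟩

/-- A vertex whose available neighbourhood has only `d + 1` vertices uses all of them. -/
theorem Generic.star_full {p : W → Fin d → ℝ} (hp : Generic p) {ω : Sym2 W → ℝ}
    (hω : ω ∈ stress p) {a b : W} (hab : a ≠ b) (h : ω s(a, b) ≠ 0) {N : Finset W}
    (hN : ∀ y, y ≠ a → ω s(a, y) ≠ 0 → y ∈ N) (haN : a ∉ N) (hcard : N.card ≤ d + 1)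
    {y : W} (hy : y ∈ N) : ω s(a, y) ≠ 0 := by
  intro h0
  have := hp.card_support_stress hω hab h (N := N.erase y)
    (fun z hz hz0 => Finset.mem_erase.mpr ⟨fun hzy => hz0 (hzy ▸ h0), hN z hz hz0⟩)
    (fun ha => haN (Finset.mem_of_mem_erase ha))
  rw [Finset.card_erase_of_mem hy] at this
  have := Finset.card_pos.mpr ⟨y, hy⟩
  omega

/-- `d + 2` generic points carry a stress with full support. -/
theorem Generic.exists_stress_simplex {p : W → Fin d → ℝ} (hp : Generic p) {T : Finset W}
    (hT : T.card = d + 2) : ∃ ω ∈ stress p, ∀ x y, ω s(x, y) ≠ 0 ↔ x ≠ y ∧ x ∈ T ∧ y ∈ T := by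
  classical
  obtain ⟨c, hc, hc0⟩ : ∃ c : W → ℝ, ∑ x ∈ T, c x • hat (p x) = 0 ∧ ∃ x ∈ T, c x ≠ 0 := by
    have hn : ¬ LinearIndepOn ℝ (fun x => hat (p x)) (T : Set W) := fun h => by
      have h1 := LinearIndependent.fintype_card_le_finrank h
      rw [Module.finrank_fin_fun, ← Nat.card_eq_fintype_card, Nat.card_coe_set_eq,
        Set.ncard_coe_finset, hT] at h1
      omega
    rw [linearIndepOn_finset_iff] at hn
    push Not at hn
    exact hn
  have hall : ∀ x ∈ T, c x ≠ 0 := by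
    intro x hx hcx
    obtain ⟨y, hy, hcy⟩ := hc0
    rw [← Finset.add_sum_erase _ _ hx, hcx, zero_smul, zero_add] at hc
    refine hcy (linearIndepOn_finset_iff.mp (hp.linearIndepOn_hat (S := T.erase x) ?_) c hc y
      (Finset.mem_erase.mpr ⟨fun h => hcy (h ▸ hcx), hy⟩))
    rw [Finset.card_erase_of_mem hx, hT]
    omega
  let c' : W → ℝ := fun x => if x ∈ T then c x else 0
  have hc'0 : ∀ x, c' x ≠ 0 ↔ x ∈ T := fun x => by
    by_cases hx : x ∈ T
    · simp [c', hx, hall x hx]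
    · simp [c', hx]
  have hsum : ∑ x, c' x • hat (p x) = 0 := by
    rw [← hc]
    simp [c', ite_smul, Finset.sum_ite_mem]
  have hs0 : ∑ x, c' x = 0 := by simpa using congrFun hsum 0
  have hsi : ∀ i, ∑ x, c' x * p x i = 0 := fun i => by simpa using congrFun hsum i.succ
  let ω : Sym2 W → ℝ := fun e => if e.IsDiag then 0 else Sym2.lift ⟨fun x y => c' x * c' y,
    fun x y => mul_comm _ _⟩ e
  have hω : ∀ x y, ω s(x, y) = if x = y then 0 else c' x * c' y := fun x y => by simp [ω]
  refine ⟨ω, fun x i => ?_, fun x y => ?_⟩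
  · have : ∀ y, ω s(x, y) * (p x i - p y i) = c' x * p x i * c' y - c' x * (c' y * p y i) := by
      intro y
      rw [hω]
      split_ifs with h
      · subst h; ring
      · ring
    rw [Finset.sum_congr rfl fun y _ => this y, Finset.sum_sub_distrib, ← Finset.mul_sum,
      ← Finset.mul_sum, hs0, hsi]
    ring
  · rw [hω]
    by_cases h : x = y
    · simp [h]
    · simp only [h, if_false, ne_eq, mul_eq_zero, not_or, not_false_eq_true, true_and]
      exact and_congr (hc'0 x) (hc'0 y)

theorem BodyBar.neighbour (hB : BodyBar G β mate) {p : W → Fin d → ℝ} {ω : Sym2 W → ℝ}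
    (hω : ω ∈ gstress p G) {a y : W} (hy : y ≠ a) (h : ω s(a, y) ≠ 0) :
    y ∈ insert (mate a) ((bodyOf β a).erase a) := by
  have : s(a, y) ∈ G.edgeSet := by by_contra hc; exact h (hω.2 _ hc)
  rw [SimpleGraph.mem_edgeSet, hB.adj] at this
  rcases this.2 with h | h <;> simp [h, hy]

/-- All edges of a large body are related to each other. -/
theorem BodyBar.cc_share (hB : BodyBar G β mate) (hd : 1 ≤ d) {p : W → Fin d → ℝ}
    (hp : Generic p) {a b c : W} (hbig : d + 2 ≤ (bodyOf β a).card) (hb : β b = β a)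
    (hc : β c = β a) (hab : b ≠ a) (hac : c ≠ a) : CC p G s(a, b) s(a, c) := by
  by_cases hbc : b = c
  · exact Or.inl (by rw [hbc])
  have hsub : ({a, b, c} : Finset W) ⊆ bodyOf β a := by
    intro x hx
    simp only [Finset.mem_insert, Finset.mem_singleton] at hx
    rcases hx with rfl | rfl | rfl <;> simp [hb, hc]
  obtain ⟨T, h1, h2, hT⟩ := Finset.exists_subsuperset_card_eq hsub
    (Finset.card_le_three.trans (by omega)) hbig
  obtain ⟨ω, hω, hωT⟩ := hp.exists_stress_simplex hT
  have hωG : ω ∈ gstress p G := ⟨hω, fun e he => by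
    induction e using Sym2.ind with
    | _ x y =>
      by_contra h0
      obtain ⟨hxy, hx, hy⟩ := (hωT x y).mp h0
      exact he (hB.mem_edgeSet_of_body
        ((mem_bodyOf.mp (h2 hx)).trans (mem_bodyOf.mp (h2 hy)).symm) hxy)⟩
  have ha : a ∈ T := h1 (by simp)
  obtain ⟨C, hC, heC, hCs⟩ := exists_isMinSupport hωG
    ((hωT a b).mpr ⟨hab.symm, ha, h1 (by simp)⟩)
  refine Or.inr ⟨C, hC, heC, ?_⟩
  obtain ⟨⟨τ, hτ, -, rfl⟩, -⟩ := hC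
  refine hp.star_full hτ.1 hab.symm heC (N := T.erase a) (fun y hy hy0 => ?_) (by simp) ?_
    (Finset.mem_erase.mpr ⟨hac, h1 (by simp)⟩)
  · exact Finset.mem_erase.mpr ⟨hy, ((hωT a y).mp (hCs hy0)).2.2⟩
  · rw [Finset.card_erase_of_mem ha, hT]
    omega

theorem BodyBar.cc_body (hB : BodyBar G β mate) (hd : 1 ≤ d) {p : W → Fin d → ℝ}
    (hp : Generic p) {x : W} (hx : NB p G mate x) {y z : W} (hy : β y = β x) (hz : β z = β x)
    (hyz : y ≠ z) : CC p G s(x, mate x) s(y, z) := by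
  have hcard := hB.card_body hp hx
  obtain ⟨ω, hω, hωG, hωx⟩ := hx
  obtain ⟨C, hC, heC, -⟩ := exists_isMinSupport (S := gstress p G) ⟨hω, hωG⟩ hωx
  have hC' := hC
  obtain ⟨⟨τ, hτ, -, rfl⟩, -⟩ := hC'
  have hmem : ∀ a, a ∉ insert (mate a) ((bodyOf β a).erase a) := fun a => by
    simp [(hB.mate_ne a).symm]
  have hcardN : ∀ a, (insert (mate a) ((bodyOf β a).erase a)).card = (bodyOf β a).card := fun a => by
    rw [Finset.card_insert_of_notMem (by simp [hB.body_mate]), Finset.card_erase_add_one (by simp)]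
  have hbody : ∀ a, β a = β x → bodyOf β a = bodyOf β x := fun a ha => by ext; simp [ha]
  rcases hcard.eq_or_lt with hcard | hcard
  · have hfull : ∀ a b, β a = β x → a ≠ b → τ s(a, b) ≠ 0 → ∀ c, β c = β x → c ≠ a →
        τ s(a, c) ≠ 0 := fun a b ha hab h0 c hc hca =>
      hp.star_full hτ.1 hab h0 (fun y hy hy0 => hB.neighbour hτ hy hy0) (hmem a)
        (by rw [hcardN, hbody a ha, hcard]) (by simp [hca, hc, ha])
    refine Or.inr ⟨_, hC, heC, ?_⟩
    have h1 := hfull x (mate x) rfl (hB.mate_ne x).symm heC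
    by_cases hyx : y = x
    · subst hyx
      exact h1 z hz hyz.symm
    · exact hfull y x hy hyx (by rw [Sym2.eq_swap]; exact h1 y hy hyx) z hz hyz.symm
  · obtain ⟨w, hwx, hw⟩ : ∃ w ∈ (bodyOf β x).erase x, τ s(x, w) ≠ 0 := by
      by_contra hcon
      push Not at hcon
      have := hp.card_support_stress hτ.1 (hB.mate_ne x).symm heC (N := {mate x})
        (fun v hv hv0 => by
          rcases Finset.mem_insert.mp (hB.neighbour hτ hv hv0) with h | h
          · simp [h]
          · exact absurd (hcon v h) hv0) (by simp [(hB.mate_ne x).symm])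
      simp at this
      omega
    rw [Finset.mem_erase, mem_bodyOf] at hwx
    have hshare : ∀ {a b c : W}, β a = β x → β b = β x → β c = β x → b ≠ a → c ≠ a →
        CC p G s(a, b) s(a, c) := fun {a b c} ha hb hc hab hac =>
      hB.cc_share hd hp (by rw [hbody a ha]; exact hcard) (by rw [hb, ha]) (by rw [hc, ha]) hab hac
    refine CC.trans (Or.inr ⟨_, hC, heC, hw⟩) ?_
    by_cases hxy : y = x
    · subst hxy
      exact hshare hy hwx.2 hz hwx.1 hyz.symm
    · refine (hshare rfl hwx.2 hy hwx.1 hxy).trans ?_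
      rw [Sym2.eq_swap]
      exact hshare hy rfl hz (Ne.symm hxy) hyz.symm

/-- The component of a bar contains all bodies and non-bridge bars linked to it. -/
theorem BodyBar.component_link (hB : BodyBar G β mate) (hd : 1 ≤ d) {p : W → Fin d → ℝ}
    (hp : Generic p) {a x : W} (ha : NB p G mate a) (hx : Link p G β mate a x) :
    (∀ y z, β y = β x → β z = β x → y ≠ z → CC p G s(a, mate a) s(y, z)) ∧
    ∀ y, β y = β x → NB p G mate y → CC p G s(a, mate a) s(y, mate y) := by
  have hsecond : ∀ x, (∀ y z, β y = β x → β z = β x → y ≠ z → CC p G s(a, mate a) s(y, z)) →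
      ∀ y, β y = β x → NB p G mate y → CC p G s(a, mate a) s(y, mate y) := fun x h y hy hNB => by
    obtain ⟨z, hz, hzy⟩ := Finset.exists_mem_ne
      (show 1 < (bodyOf β y).card by have := hB.card_body hp hNB; omega) y
    rw [mem_bodyOf] at hz
    exact (h z y (hz.trans hy) hy hzy).trans (hB.cc_body hd hp hNB hz rfl hzy).symm
  induction hx with
  | refl => exact ⟨fun y z hy hz => hB.cc_body hd hp ha hy hz,
      hsecond a fun y z hy hz => hB.cc_body hd hp ha hy hz⟩
  | @tail x y _ hxy ih =>
    rcases hxy with hxy | ⟨rfl, hxy⟩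
    · rwa [← hxy]
    · have : ∀ y z, β y = β (mate x) → β z = β (mate x) → y ≠ z →
          CC p G s(a, mate a) s(y, z) := fun y z hy hz hyz => by
        have h1 := hB.cc_body hd hp (hB.nb_mate hxy) hy hz hyz
        rw [hB.mate_mate, Sym2.eq_swap] at h1
        exact (ih.2 x rfl hxy).trans h1
      exact ⟨this, hsecond _ this⟩

end Components

section Menger

variable {W : Type*} [Fintype W] [DecidableEq W]

open Classical in
/-- Admissible successors in the auxiliary bipartite graph for Menger's theorem. -/
def mengerSucc (H : SimpleGraph W) (u v : W) (k : ℕ) : W ⊕ Fin k → Finset (W ⊕ Fin k)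
  | Sum.inl x => if x = u ∨ x = v then {Sum.inl x} else
      Finset.univ.filter fun z => z = Sum.inl x ∨
        (∃ y, z = Sum.inl y ∧ H.Adj x y ∧ y ≠ u ∧ y ≠ v) ∨ (∃ j, z = Sum.inr j ∧ H.Adj x v)
  | Sum.inr _ => Finset.univ.filter fun z => ∃ y, z = Sum.inl y ∧ H.Adj u y

theorem exists_mengerSucc (H : SimpleGraph W) {u v : W} (huv : u ≠ v) (hadj : ¬ H.Adj u v) {k : ℕ}
    (hsep : ∀ R X : Finset W, u ∈ R → v ∉ R → v ∉ X → u ∉ X → Disjoint R X →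
      (∀ x y, H.Adj x y → x ∈ R → y ∈ R ∨ y ∈ X) → k ≤ X.card) :
    ∃ f : W ⊕ Fin k → W ⊕ Fin k, Function.Injective f ∧ ∀ z, f z ∈ mengerSucc H u v k z := by
  classical
  rw [← Finset.all_card_le_biUnion_card_iff_exists_injective]
  intro S
  let A : Finset W := Finset.univ.filter fun x => Sum.inl x ∈ S
  let J : Finset (Fin k) := Finset.univ.filter fun j => Sum.inr j ∈ S
  have hS : S = A.disjSum J := by
    ext z
    rcases z with x | j <;> simp [A, J]
  have hcard : S.card = A.card + J.card := by rw [hS, Finset.card_disjSum]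
  have hself : ∀ x ∈ A, Sum.inl x ∈ S.biUnion (mengerSucc H u v k) := fun x hx => by
    refine Finset.mem_biUnion.mpr ⟨Sum.inl x, by simpa [A] using hx, ?_⟩
    simp only [mengerSucc]
    split_ifs <;> simp
  have hJ : J.card ≤ k := by simpa using Finset.card_le_univ J
  by_cases hJe : J = ∅
  · rw [hcard, hJe, Finset.card_empty, add_zero, ← Finset.card_map Function.Embedding.inl]
    refine Finset.card_le_card fun z hz => ?_
    obtain ⟨x, hx, rfl⟩ := Finset.mem_map.mp hz
    exact hself x hx
  obtain ⟨j₀, hj₀⟩ := Finset.nonempty_iff_ne_empty.mpr hJe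
  by_cases hend : ∃ x ∈ A, x ≠ u ∧ x ≠ v ∧ H.Adj x v
  · obtain ⟨x, hx, hxu, hxv, hxadj⟩ := hend
    have hle : A.disjSum (Finset.univ : Finset (Fin k)) ⊆ S.biUnion (mengerSucc H u v k) := by
      intro z hz
      rcases Finset.mem_disjSum.mp hz with ⟨y, hy, rfl⟩ | ⟨j, -, rfl⟩
      · exact hself y hy
      · refine Finset.mem_biUnion.mpr ⟨Sum.inl x, by simpa [A] using hx, ?_⟩
        simp [mengerSucc, hxu, hxv, hxadj]
    have := Finset.card_le_card hle
    rw [Finset.card_disjSum, Finset.card_univ, Fintype.card_fin] at this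
    omega
  · push Not at hend
    let R : Finset W := insert u ((A.erase u).erase v)
    let X : Finset W := (Finset.univ.filter fun y => y ≠ u ∧ y ≠ v ∧ ∃ x ∈ R, H.Adj x y) \ R
    have hk : k ≤ X.card := by
      refine hsep R X (by simp [R]) (by simp [R, huv.symm]) (by simp [X]) (by simp [X])
        Finset.disjoint_sdiff fun x y hxy hx => ?_
      by_cases hyR : y ∈ R
      · exact Or.inl hyR
      · refine Or.inr (Finset.mem_sdiff.mpr ⟨?_, hyR⟩)
        have hyu : y ≠ u := fun h => hyR (by simp [R, h])
        have hyv : y ≠ v := by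
          rintro rfl
          simp only [R, Finset.mem_insert, Finset.mem_erase] at hx
          rcases hx with rfl | ⟨h1, h2, h3⟩
          · exact hadj hxy
          · exact hend x h3 h2 h1 hxy
        simp only [Finset.mem_filter, Finset.mem_univ, true_and]
        exact ⟨hyu, hyv, x, hx, hxy⟩
    have hdisj : Disjoint A X := by
      rw [Finset.disjoint_left]
      intro y hy hyX
      simp only [X, R, Finset.mem_sdiff, Finset.mem_filter, Finset.mem_univ, true_and,
        Finset.mem_insert, Finset.mem_erase] at hyX
      exact hyX.2 (Or.inr ⟨hyX.1.2.1, hyX.1.1, hy⟩)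
    have hle : (A ∪ X).map Function.Embedding.inl ⊆ S.biUnion (mengerSucc H u v k) := by
      intro z hz
      obtain ⟨y, hy, rfl⟩ := Finset.mem_map.mp hz
      rcases Finset.mem_union.mp hy with hy | hy
      · exact hself y hy
      · simp only [X, Finset.mem_sdiff, Finset.mem_filter, Finset.mem_univ, true_and] at hy
        obtain ⟨⟨hyu, hyv, x, hx, hxy⟩, -⟩ := hy
        simp only [R, Finset.mem_insert, Finset.mem_erase] at hx
        rcases hx with rfl | ⟨h1, h2, h3⟩
        · refine Finset.mem_biUnion.mpr ⟨Sum.inr j₀, by simpa [J] using hj₀, ?_⟩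
          simp [mengerSucc, hxy]
        · refine Finset.mem_biUnion.mpr ⟨Sum.inl x, by simpa [A] using h3, ?_⟩
          simp [mengerSucc, h1, h2, hxy, hyu, hyv]
    have := Finset.card_le_card hle
    rw [Finset.card_map, Finset.card_union_of_disjoint hdisj] at this
    omega

/-- Menger's theorem for two nonadjacent vertices. -/
theorem exists_internallyDisjointPaths (H : SimpleGraph W) {u v : W} (huv : u ≠ v)
    (hadj : ¬ H.Adj u v) {k : ℕ}
    (hsep : ∀ R X : Finset W, u ∈ R → v ∉ R → v ∉ X → u ∉ X → Disjoint R X →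
      (∀ x y, H.Adj x y → x ∈ R → y ∈ R ∨ y ∈ X) → k ≤ X.card) :
    InternallyDisjointPaths H u v k := by
  classical
  obtain ⟨f, hf, hft⟩ := exists_mengerSucc H huv hadj hsep
  have hinr : ∀ i, ∃ y, f (Sum.inr i) = Sum.inl y ∧ H.Adj u y := fun i => by
    simpa [mengerSucc] using hft (Sum.inr i)
  have hinl : ∀ x, x ≠ u → x ≠ v → f (Sum.inl x) = Sum.inl x ∨
      (∃ y, f (Sum.inl x) = Sum.inl y ∧ H.Adj x y ∧ y ≠ u ∧ y ≠ v) ∨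
      (∃ j, f (Sum.inl x) = Sum.inr j ∧ H.Adj x v) := fun x hxu hxv => by
    have := hft (Sum.inl x)
    simpa only [mengerSucc, hxu, hxv, or_self, if_false, Finset.mem_filter, Finset.mem_univ,
      true_and] using this
  have hret : ∀ i : Fin k, ∃ n, 0 < n ∧ ∃ j, f^[n] (Sum.inr i) = Sum.inr j := fun i => by
    obtain ⟨n, hn, h⟩ := hf.mem_periodicPts (Sum.inr i)
    exact ⟨n, hn, i, h⟩
  choose N hN hmin using fun i => (⟨Nat.find (hret i), Nat.find_spec (hret i),
    fun m hm => Nat.find_min (hret i) hm⟩ : ∃ n, (0 < n ∧ ∃ j, f^[n] (Sum.inr i) = Sum.inr j) ∧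
      ∀ m < n, ¬ (0 < m ∧ ∃ j, f^[m] (Sum.inr i) = Sum.inr j))
  let T : Fin k → Set W := fun i => {y | ∃ m, 0 < m ∧ m < N i ∧ f^[m] (Sum.inr i) = Sum.inl y}
  have hwalk : ∀ i n, n + 1 < N i → ∃ x, f^[n + 1] (Sum.inr i) = Sum.inl x ∧ x ≠ u ∧ x ≠ v ∧
      ∃ P : H.Walk u x, ∀ y ∈ P.support, y = u ∨ y ∈ T i := by
    intro i n
    induction n with
    | zero =>
      intro hn
      obtain ⟨y, hy, huy⟩ := hinr i
      refine ⟨y, hy, huy.ne', fun h => hadj (h ▸ huy), .cons huy .nil, fun z hz => ?_⟩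
      simp only [SimpleGraph.Walk.support_cons, SimpleGraph.Walk.support_nil, List.mem_cons,
        List.not_mem_nil, or_false] at hz
      rcases hz with rfl | rfl
      · exact Or.inl rfl
      · exact Or.inr ⟨1, one_pos, hn, hy⟩
    | succ n ih =>
      intro hn
      obtain ⟨x, hx, hxu, hxv, P, hP⟩ := ih (by omega)
      rcases hinl x hxu hxv with h | ⟨y, h, hxy, hyu, hyv⟩ | ⟨j, h, -⟩
      · exact ⟨x, by rw [Function.iterate_succ_apply', hx, h], hxu, hxv, P, hP⟩
      · have hy : f^[n + 1 + 1] (Sum.inr i) = Sum.inl y := by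
          rw [Function.iterate_succ_apply', hx, h]
        refine ⟨y, hy, hyu, hyv, P.concat hxy, fun z hz => ?_⟩
        rw [SimpleGraph.Walk.support_concat, List.mem_append,
          List.mem_singleton] at hz
        rcases hz with hz | rfl
        · exact hP z hz
        · exact Or.inr ⟨_, by omega, hn, hy⟩
      · exact absurd ⟨by omega, j, by rw [Function.iterate_succ_apply', hx, h]⟩ (hmin i _ hn)
  have hpath : ∀ i, ∃ P : H.Walk u v, P.IsPath ∧ ∀ y ∈ P.support, y = u ∨ y = v ∨ y ∈ T i := by
    intro i
    obtain ⟨hN0, j, hj⟩ := hN i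
    have hN2 : 2 ≤ N i := by
      by_contra hlt
      have : N i = 1 := by omega
      obtain ⟨y, hy, -⟩ := hinr i
      rw [this, Function.iterate_one, hy] at hj
      exact absurd hj (by simp)
    obtain ⟨x, hx, hxu, hxv, P, hP⟩ := hwalk i (N i - 2) (by omega)
    have hx' : f (Sum.inl x) = Sum.inr j := by
      rw [← hx, ← Function.iterate_succ_apply' f, ← hj]
      congr 1
      omega
    rcases hinl x hxu hxv with h | ⟨y, h, -⟩ | ⟨j', -, hadj'⟩
    · rw [h] at hx'; exact absurd hx' (by simp)
    · rw [h] at hx'; exact absurd hx' (by simp)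
    · refine ⟨(P.concat hadj').bypass, SimpleGraph.Walk.bypass_isPath _, fun y hy => ?_⟩
      have hy' := SimpleGraph.Walk.support_bypass_subset_support _ hy
      rw [SimpleGraph.Walk.support_concat, List.mem_append,
        List.mem_singleton] at hy'
      rcases hy' with hy' | rfl
      · exact (hP y hy').imp_right Or.inr
      · exact Or.inr (Or.inl rfl)
  choose P hPp hPs using hpath
  refine ⟨P, hPp, fun i j hij w hwi hwj => ?_⟩
  by_contra hcon
  rw [not_or] at hcon
  have hdis : ∀ i j a b, i ≠ j → a ≤ b → b < N j → f^[a] (Sum.inr i) ≠ f^[b] (Sum.inr j) := by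
    intro i j a b hij hab hb h
    rw [← Nat.add_sub_cancel' hab, Function.iterate_add_apply] at h
    have h' := (hf.iterate a) h
    rcases Nat.eq_zero_or_pos (b - a) with h0 | h0
    · rw [h0] at h'
      exact hij (by simpa using h')
    · exact hmin j (b - a) (by omega) ⟨h0, i, h'.symm⟩
  obtain ⟨a, -, haN, ha⟩ := ((hPs i w hwi).resolve_left hcon.1).resolve_left hcon.2
  obtain ⟨b, -, hbN, hb⟩ := ((hPs j w hwj).resolve_left hcon.1).resolve_left hcon.2
  rcases le_total a b with h | h
  · exact hdis i j a b hij h hbN (ha.trans hb.symm)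
  · exact hdis j i b a hij.symm h haN (hb.trans ha.symm)

end Menger

section LinkToConnected

open Matrix

variable {W U : Type*} [Fintype W] [DecidableEq W] {d : ℕ} {G : SimpleGraph W} {β : W → U}
  {mate : W → W}

theorem BodyBar.bar_mem (hB : BodyBar G β mate) (x : W) : s(x, mate x) ∈ G.edgeSet :=
  (hB.adj x _).mpr ⟨(hB.mate_ne x).symm, Or.inr rfl⟩

theorem exists_stress_component {p : W → Fin d → ℝ} {e : Sym2 W} {x : W}
    (hx : NB p G mate x) (hmem : s(x, mate x) ∈ component p G e) :
    ∃ ω ∈ stress p, (∀ f ∉ component p G e, ω f = 0) ∧ ω s(x, mate x) ≠ 0 := by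
  obtain ⟨ω, h1, h2, h3⟩ := hx
  obtain ⟨C, hC, hxC, -⟩ := exists_isMinSupport (S := gstress p G) ⟨h1, h2⟩ h3
  obtain ⟨⟨ω', hω', -, rfl⟩, -⟩ := id hC
  refine ⟨ω', hω'.1, fun f hf => ?_, hxC⟩
  by_contra h
  exact hf ⟨(isMinSupport_gstress hC).2 h, hmem.2.trans (Or.inr ⟨_, hC, hxC, h⟩)⟩

theorem BodyBar.nb_of_mem_component (hB : BodyBar G β mate) {p : W → Fin d → ℝ} {a x : W}
    (ha : NB p G mate a) (hx : s(x, mate x) ∈ component p G s(a, mate a)) : NB p G mate x := by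
  rcases hx.2 with h | ⟨C, ⟨⟨ω, hω, -, rfl⟩, -⟩, -, hxC⟩
  · rcases Sym2.eq_iff.mp h with ⟨rfl, -⟩ | ⟨-, rfl⟩
    · exact ha
    · exact hB.nb_mate ha
  · exact ⟨ω, hω.1, hω.2, hxC⟩

/-- Nonadjacent linked vertices lie in a component with high local connectivity. -/
theorem BodyBar.exists_component (hB : BodyBar G β mate) (hd : 1 ≤ d) {p : W → Fin d → ℝ}
    (hp : Generic p) {u v : W} (huv : Link p G β mate u v) (hadj : ¬ G.Adj u v) (hne : u ≠ v) :
    ∃ F ⊆ G.edgeSet, RdConnectedSet d F ∧ u ∈ vertexSpan F ∧ v ∈ vertexSpan F ∧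
      InternallyDisjointPaths (SimpleGraph.fromEdgeSet F) u v (d + 1) := by
  classical
  have hβ : β u ≠ β v := fun h => hadj ((hB.adj u v).mpr ⟨hne, Or.inl h⟩)
  obtain ⟨a, hau, ha⟩ := huv.exists_nb hβ
  obtain ⟨b, hbv, hb⟩ := (hB.link_symm huv).exists_nb hβ.symm
  have hal : ∀ x, Link p G β mate u x → Link p G β mate a x := fun x h =>
    (Link.of_body hau).trans h
  let F := component p G s(a, mate a)
  have hFG : F ⊆ G.edgeSet := fun e he => he.1
  have hclique : ∀ x y, Link p G β mate a x → β x = β y → x ≠ y → s(x, y) ∈ F :=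
    fun x y hx hxy hne => ⟨hB.mem_edgeSet_of_body hxy hne,
      (hB.component_link hd hp ha hx).1 x y rfl hxy.symm hne⟩
  have hbar : ∀ x, Link p G β mate a x → NB p G mate x → s(x, mate x) ∈ F :=
    fun x hx h => ⟨hB.bar_mem x, (hB.component_link hd hp ha hx).2 x rfl h⟩
  have hclique' : ∀ x y, s(x, mate x) ∈ F → β y = β x → y ≠ x → s(y, x) ∈ F :=
    fun x y hx hy hyx => ⟨hB.mem_edgeSet_of_body hy hyx,
      hx.2.trans (hB.cc_body hd hp (hB.nb_of_mem_component ha hx) hy rfl hyx)⟩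
  have hspan : ∀ x c, Link p G β mate a x → β c = β x → NB p G mate c → x ∈ vertexSpan F :=
    fun x c hx hc hNB => by
      obtain ⟨z, hz, hzx⟩ := Finset.exists_mem_ne
        (show 1 < (bodyOf β c).card by have := hB.card_body hp hNB; omega) x
      rw [mem_bodyOf, hc] at hz
      exact ⟨_, hclique x z hx hz.symm hzx.symm, by simp⟩
  refine ⟨F, hFG, component_connected hp (hB.bar_mem a), hspan u a (hal u .refl) hau ha,
    hspan v b (hal v huv) hbv hb, exists_internallyDisjointPaths _ hne
      (fun h => hadj (hFG ((SimpleGraph.fromEdgeSet_adj _).mp h).1)) ?_⟩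
  intro R X huR hvR hvX huX hRX hsep
  by_contra hcard
  have hsepF : ∀ x y, s(x, y) ∈ F → x ≠ y → x ∈ R → y ∈ R ∨ y ∈ X := fun x y h hxy =>
    hsep x y ((SimpleGraph.fromEdgeSet_adj _).mpr ⟨h, hxy⟩)
  obtain ⟨X', c, hX', hXc⟩ : ∃ (X' : Finset W) (c : W), X'.card + 2 ≤ d + 1 ∧
      ∀ x ∈ X, x = c ∨ x ∈ X' := by
    rcases X.eq_empty_or_nonempty with rfl | ⟨c, hc⟩
    · exact ⟨∅, u, by simpa using hd, by simp⟩
    · refine ⟨X.erase c, c, ?_, fun x hx => ?_⟩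
      · have := Finset.card_erase_add_one hc
        omega
      · by_cases h : x = c
        · exact Or.inl h
        · exact Or.inr (Finset.mem_erase.mpr ⟨h, hx⟩)
  obtain ⟨Ω, hΩ, hΩ0, hker⟩ := exists_skew_kernel (fun x : X' => hat (p x))
    (by simpa using hX')
  let φ : W → Matrix (Fin (d + 1)) (Fin (d + 1)) ℝ := fun x =>
    if ∃ y ∈ R, β y = β x then Ω else 0
  have hφ : ∀ x, (φ x)ᵀ = -φ x := fun x => by
    by_cases h : ∃ y ∈ R, β y = β x
    · simp only [φ, if_pos h, hΩ]
    · simp only [φ, if_neg h, transpose_zero, neg_zero]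
  let m : W → Fin d → ℝ := fun x => velocity (φ x) (p x)
  have hsum : ∀ x y, ∑ i, (p x i - p y i) * (m x i - m y i) =
      hat (p x) ⬝ᵥ (φ x - φ y) *ᵥ hat (p y) := fun x y => sum_sub_mul_velocity (hφ x) (hφ y) _ _
  -- the edges between the two sides
  have hcross : ∀ x, s(x, mate x) ∈ F → s(x, mate x) ≠ s(c, mate c) → (∃ y ∈ R, β y = β x) →
      (¬ ∃ y ∈ R, β y = β (mate x)) → hat (p x) ⬝ᵥ Ω *ᵥ hat (p (mate x)) = 0 := by
    rintro x hxF hxc ⟨r, hr, hrx⟩ hmate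
    have hX : x ∈ X ∨ mate x ∈ X := by
      by_cases hxR : x ∈ R
      · exact Or.inr ((hsepF _ _ hxF (hB.mate_ne x).symm hxR).resolve_left
          fun h => hmate ⟨_, h, rfl⟩)
      · have hrx' : r ≠ x := fun h => hxR (h ▸ hr)
        exact Or.inl ((hsepF _ _ (hclique' x r hxF hrx hrx') hrx' hr).resolve_left hxR)
    rcases hX with h | h
    · rcases hXc _ h with rfl | h
      · exact absurd rfl hxc
      · rw [skew_dotProduct hΩ, hker ⟨x, h⟩, dotProduct_zero, neg_zero]
    · rcases hXc _ h with rfl | h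
      · exact absurd (by rw [hB.mate_mate, Sym2.eq_swap]) hxc
      · rw [hker ⟨_, h⟩, dotProduct_zero]
  have hm' : Motion (F \ {s(c, mate c)}) p m := by
    rintro x y ⟨hxy, hxyc⟩
    rw [hsum]
    rcases ((hB.adj x y).mp (hFG hxy)).2 with h | rfl
    · have : φ x = φ y := by simp only [φ, h]
      simp [this]
    · by_cases h1 : ∃ y ∈ R, β y = β x <;> by_cases h2 : ∃ y ∈ R, β y = β (mate x)
      · simp only [φ, if_pos h1, if_pos h2, sub_self, zero_mulVec, dotProduct_zero]
      · simp only [φ, if_pos h1, if_neg h2, sub_zero]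
        exact hcross x hxy hxyc h1 h2
      · have hswap : s(mate x, mate (mate x)) = s(x, mate x) := by rw [hB.mate_mate, Sym2.eq_swap]
        have := hcross (mate x) (by rwa [hswap]) (by rwa [hswap]) h2 (by rwa [hB.mate_mate])
        rw [hB.mate_mate] at this
        simp only [φ, if_neg h1, if_pos h2, zero_sub, neg_mulVec, dotProduct_neg]
        rw [skew_dotProduct hΩ, this, neg_zero, neg_zero]
      · simp only [φ, if_neg h1, if_neg h2, sub_zero, zero_mulVec, dotProduct_zero]
  have hm : Motion F p m := by
    intro x y hxy
    by_cases hc : s(x, y) = s(c, mate c)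
    · rw [hc] at hxy
      obtain ⟨ω, h1, h2, h3⟩ := exists_stress_component (hB.nb_of_mem_component ha hxy) hxy
      rw [← hc] at h3
      refine hm'.of_stress h1 h3 fun e he hne => h2 e fun h => he ⟨h, ?_⟩
      rwa [hc] at hne
    · exact hm' x y ⟨hxy, hc⟩
  have hvl : ∀ x, Link p G β mate v x → Link p G β mate a x := fun x h => (hal v huv).trans h
  obtain ⟨A, -, hA⟩ := hB.chain_motion hp hFG (u := v) (fun x y hx => hclique x y (hvl x hx))
    (fun x hx h => exists_stress_component h (hbar x (hvl x hx) h)) hm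
  have hv0 : ∀ x, β x = β v → m x = 0 := fun x hx => by
    have : ¬ ∃ y ∈ R, β y = β x := by
      rintro ⟨r, hr, hrx⟩
      have hrv : r ≠ v := fun h => hvR (h ▸ hr)
      rcases hsepF r v (hclique r v ((hal v huv).trans (Link.of_body (hrx.trans hx).symm))
        (hrx.trans hx) hrv) hrv hr with h | h
      · exact hvR h
      · exact hvX h
    funext i
    simp [m, φ, if_neg this, velocity]
  have hA0 : A = 0 := by
    refine mulVec_eq_zero_of_span (hp.span_sub (x₀ := v) (S := bodyOf β v) ?_ (by simp)) ?_
    · have := hB.card_body hp hb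
      rwa [show bodyOf β b = bodyOf β v by ext; simp [hbv]] at this
    · rintro _ ⟨x, hx, rfl⟩
      have hx' : β x = β v := by simpa using hx
      rw [← hA x (Link.of_body hx'.symm), hv0 x hx', hv0 v rfl, sub_zero]
  refine hΩ0 (eq_zero_of_velocity hp (hB.card_body hp ha) hΩ fun x hx => ?_)
  rw [mem_bodyOf, hau] at hx
  have hmx := hA x ((hB.link_symm huv).trans (Link.of_body hx.symm))
  rw [hA0, zero_mulVec, hv0 v rfl, sub_zero] at hmx
  have : ∃ y ∈ R, β y = β x := ⟨u, huR, hx.symm⟩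
  simpa only [m, φ, if_pos this] using hmx

end LinkToConnected

section BarForm

open Matrix

variable {W K : Type*} {d : ℕ} {κ : W → K} {mate : W → W}

/-- The first-order change of the length of the bar at `c` when each class `k` moves with the
infinitesimal isometry encoded by `Ω k`. -/
def barForm (κ : W → K) (mate : W → W) (q : W → Fin d → ℝ)
    (Ω : K → Matrix (Fin (d + 1)) (Fin (d + 1)) ℝ) (c : W) : ℝ :=
  hat (q c) ⬝ᵥ (Ω (κ c) - Ω (κ (mate c))) *ᵥ hat (q (mate c))

/-- The lengths of the bars between different classes can be changed independently. -/
def BarsIndependent (κ : W → K) (mate : W → W) (q : W → Fin d → ℝ) : Prop :=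
  ∀ a, κ a ≠ κ (mate a) → ∃ Ω : K → Matrix (Fin (d + 1)) (Fin (d + 1)) ℝ,
    (∀ k, (Ω k)ᵀ = -Ω k) ∧ barForm κ mate q Ω a ≠ 0 ∧
      ∀ c, c ≠ a → c ≠ mate a → barForm κ mate q Ω c = 0

theorem barForm_mate (hmm : ∀ x, mate (mate x) = x) {q : W → Fin d → ℝ}
    {Ω : K → Matrix (Fin (d + 1)) (Fin (d + 1)) ℝ} (hΩ : ∀ k, (Ω k)ᵀ = -Ω k) (c : W) :
    barForm κ mate q Ω (mate c) = barForm κ mate q Ω c := by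
  have h : (Ω (κ (mate c)) - Ω (κ c))ᵀ = -(Ω (κ (mate c)) - Ω (κ c)) := by
    rw [transpose_sub, hΩ, hΩ]; abel
  rw [barForm, barForm, hmm, skew_dotProduct h, ← neg_sub (Ω (κ c)), neg_mulVec, dotProduct_neg,
    neg_neg]

theorem barForm_congr {q q' : W → Fin d → ℝ} {c : W} (h : q c = q' c)
    (h' : q (mate c) = q' (mate c)) (Ω : K → Matrix (Fin (d + 1)) (Fin (d + 1)) ℝ) :
    barForm κ mate q Ω c = barForm κ mate q' Ω c := by
  rw [barForm, barForm, h, h']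

theorem barForm_sub_smul (q : W → Fin d → ℝ) (Ω Ω' : K → Matrix (Fin (d + 1)) (Fin (d + 1)) ℝ)
    (t : ℝ) (c : W) : barForm κ mate q (Ω - t • Ω') c =
      barForm κ mate q Ω c - t * barForm κ mate q Ω' c := by
  have : (Ω - t • Ω') (κ c) - (Ω - t • Ω') (κ (mate c)) =
      (Ω (κ c) - Ω (κ (mate c))) - t • (Ω' (κ c) - Ω' (κ (mate c))) := by
    simp only [Pi.sub_apply, Pi.smul_apply, smul_sub]; abel
  rw [barForm, this, sub_mulVec, smul_mulVec, dotProduct_sub, dotProduct_smul, smul_eq_mul,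
    barForm, barForm]

theorem hat_dotProduct (x : Fin d → ℝ) (w : Fin (d + 1) → ℝ) :
    hat x ⬝ᵥ w = w 0 + ∑ i, x i * w i.succ := by
  simp [dotProduct, Fin.sum_univ_succ]

theorem exists_hat_dotProduct_ne_zero [NeZero d] {y : Fin d → ℝ} {w : Fin (d + 1) → ℝ}
    (hw : w ≠ 0) (hy : hat y ⬝ᵥ w = 0) (t : ℝ) (ht : t ≠ 0) :
    ∃ x : Fin d → ℝ, x 0 = y 0 + t ∧ hat x ⬝ᵥ w ≠ 0 := by
  by_contra hcon
  push Not at hcon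
  have hadd : ∀ z : Fin d → ℝ, z 0 = t → ∑ i, z i * w i.succ = 0 := fun z hz => by
    have h := hcon (y + z) (by rw [Pi.add_apply, hz])
    rw [hat_dotProduct] at h hy
    simp only [Pi.add_apply, add_mul, Finset.sum_add_distrib] at h
    linarith
  have h0 : w (0 : Fin d).succ = 0 := by
    have := hadd (Pi.single 0 t) (by simp)
    simpa [Pi.single_apply, ht] using this
  have hsucc : ∀ j : Fin d, w j.succ = 0 := fun j => by
    by_cases hj : j = 0
    · rw [hj, h0]
    · have := hadd (Pi.single 0 t + Pi.single j 1) (by simp [Ne.symm hj])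
      have h1 : w 1 = 0 := by simpa using h0
      simpa [Pi.single_apply, add_mul, Finset.sum_add_distrib, h1] using this
  refine hw (funext fun i => ?_)
  refine Fin.cases ?_ hsucc i
  rw [hat_dotProduct] at hy
  simpa [hsucc] using hy

/-- Moving one endpoint of one bar to a prescribed first coordinate. -/
theorem BarsIndependent.exists_update [DecidableEq W] [NeZero d] (hmm : ∀ x, mate (mate x) = x)
    {q : W → Fin d → ℝ} (h : BarsIndependent κ mate q) {a : W} (ha : κ a ≠ κ (mate a)) :
    ∃ x : Fin d → ℝ, x 0 = q (mate a) 0 + 1 / 2 ∧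
      BarsIndependent κ mate (Function.update q a x) := by
  obtain ⟨Ω, hΩ, hΩa, hΩc⟩ := h a ha
  have hma : mate a ≠ a := fun h => ha (by rw [h])
  have hskew : (Ω (κ a) - Ω (κ (mate a)))ᵀ = -(Ω (κ a) - Ω (κ (mate a))) := by
    rw [transpose_sub, hΩ, hΩ]; abel
  obtain ⟨x, hx0, hx⟩ := exists_hat_dotProduct_ne_zero (y := q (mate a))
    (w := (Ω (κ a) - Ω (κ (mate a))) *ᵥ hat (q (mate a)))
    (fun h0 => hΩa (by rw [barForm, h0, dotProduct_zero])) (skew_dotProduct_self hskew _)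
    (1 / 2) (by norm_num)
  refine ⟨x, hx0, ?_⟩
  set q' := Function.update q a x
  have hcongr : ∀ (Ω : K → Matrix (Fin (d + 1)) (Fin (d + 1)) ℝ) c, c ≠ a → c ≠ mate a →
      barForm κ mate q' Ω c = barForm κ mate q Ω c := fun Ω c hc hc' =>
    barForm_congr (Function.update_of_ne hc _ _)
      (Function.update_of_ne (fun h => hc' (by rw [← h, hmm])) _ _) Ω
  have hΩa' : barForm κ mate q' Ω a ≠ 0 := by
    rwa [barForm, show q' a = x from Function.update_self .., show q' (mate a) = q (mate a) from
      Function.update_of_ne hma _ _]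
  have hΩc' : ∀ c, c ≠ a → c ≠ mate a → barForm κ mate q' Ω c = 0 := fun c hc hc' => by
    rw [hcongr Ω c hc hc', hΩc c hc hc']
  intro f hf
  by_cases hfa : f = a
  · subst hfa
    exact ⟨Ω, hΩ, hΩa', hΩc'⟩
  by_cases hfm : f = mate a
  · subst hfm
    refine ⟨Ω, hΩ, by rwa [barForm_mate hmm hΩ], fun c hc hc' => hΩc' c ?_ hc⟩
    rwa [hmm] at hc'
  obtain ⟨Ψ, hΨ, hΨf, hΨc⟩ := h f hf
  have hskew' : ∀ k, ((Ψ - (barForm κ mate q' Ψ a / barForm κ mate q' Ω a) • Ω) k)ᵀ =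
      -(Ψ - (barForm κ mate q' Ψ a / barForm κ mate q' Ω a) • Ω) k := fun k => by
    simp only [Pi.sub_apply, Pi.smul_apply, transpose_sub, transpose_smul, hΨ, hΩ, smul_neg]
    abel
  refine ⟨Ψ - (barForm κ mate q' Ψ a / barForm κ mate q' Ω a) • Ω, hskew', ?_,
    fun c hc hc' => ?_⟩
  · rw [barForm_sub_smul, hΩc' f hfa hfm, mul_zero, sub_zero, hcongr Ψ f hfa hfm]
    exact hΨf
  · have hca : barForm κ mate q' (Ψ - (barForm κ mate q' Ψ a / barForm κ mate q' Ω a) • Ω) a = 0 := by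
      rw [barForm_sub_smul, div_mul_cancel₀ _ hΩa', sub_self]
    by_cases hca' : c = a
    · rw [hca', hca]
    by_cases hcm : c = mate a
    · rw [hcm, barForm_mate hmm hskew', hca]
    rw [barForm_sub_smul, hΩc' c hca' hcm, mul_zero, sub_zero, hcongr Ψ c hca' hcm, hΨc c hc hc']

/-- All bars leaving the class `r` can be put into a special position. -/
theorem BarsIndependent.exists_special [Fintype W] [NeZero d] (hmm : ∀ x, mate (mate x) = x)
    {p : W → Fin d → ℝ} (h : BarsIndependent κ mate p) (r : K) :
    ∃ q : W → Fin d → ℝ, BarsIndependent κ mate q ∧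
      (∀ a, κ a = r → κ (mate a) ≠ r → q a 0 = p (mate a) 0 + 1 / 2) ∧
      ∀ x, ¬ (κ x = r ∧ κ (mate x) ≠ r) → q x = p x := by
  classical
  suffices ∀ S : Finset W, ∃ q : W → Fin d → ℝ, BarsIndependent κ mate q ∧
      (∀ a ∈ S, κ a = r → κ (mate a) ≠ r → q a 0 = p (mate a) 0 + 1 / 2) ∧
      ∀ x, ¬ (x ∈ S ∧ κ x = r ∧ κ (mate x) ≠ r) → q x = p x by
    obtain ⟨q, h1, h2, h3⟩ := this Finset.univ
    exact ⟨q, h1, fun a => h2 a (Finset.mem_univ a), fun x hx => h3 x fun hx' => hx hx'.2⟩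
  intro S
  induction S using Finset.induction_on with
  | empty => exact ⟨p, h, by simp, fun _ _ => rfl⟩
  | insert a S haS ih =>
    obtain ⟨q, h1, h2, h3⟩ := ih
    by_cases ha : κ a = r ∧ κ (mate a) ≠ r
    · obtain ⟨x, hx0, hx⟩ := h1.exists_update hmm (a := a) (fun h => ha.2 (h ▸ ha.1))
      refine ⟨_, hx, fun c hc hcr hcm => ?_, fun c hc => ?_⟩
      · by_cases hca : c = a
        · rw [hca, Function.update_self, hx0, h3 (mate a) fun h => ha.2 h.2.1]
        · rw [Function.update_of_ne hca]
          exact h2 c ((Finset.mem_insert.mp hc).resolve_left hca) hcr hcm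
      · have hca : c ≠ a := by
          rintro rfl
          exact hc ⟨Finset.mem_insert_self _ _, ha⟩
        rw [Function.update_of_ne hca]
        exact h3 c fun h => hc ⟨Finset.mem_insert_of_mem h.1, h.2⟩
    · refine ⟨q, h1, fun c hc hcr hcm => ?_, fun c hc => h3 c fun h =>
        hc ⟨Finset.mem_insert_of_mem h.1, h.2⟩⟩
      have hca : c ≠ a := by
        rintro rfl
        exact ha ⟨hcr, hcm⟩
      exact h2 c ((Finset.mem_insert.mp hc).resolve_left hca) hcr hcm

end BarForm

section LocalSurjectivity

open Matrix Topology

variable {W K : Type*} [Fintype W] [Fintype K] {d : ℕ} {κ : W → K} {mate : W → W}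

/-- Direction vectors in homogeneous coordinates. -/
def hatDir (x : Fin d → ℝ) : Fin (d + 1) → ℝ := Fin.cons 0 x

theorem hat_add (x y : Fin d → ℝ) : hat (x + y) = hat x + hatDir y := by
  funext i
  refine Fin.cases ?_ (fun i => ?_) i <;> simp [hatDir]

theorem hatDir_smul (t : ℝ) (y : Fin d → ℝ) : hatDir (t • y) = t • hatDir y := by
  funext i
  refine Fin.cases ?_ (fun i => ?_) i <;> simp [hatDir]

/-- The skew-symmetric part (up to a factor) of a family of matrices. -/
def skewPart (A : K → Fin (d + 1) → Fin (d + 1) → ℝ) (k : K) :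
    Matrix (Fin (d + 1)) (Fin (d + 1)) ℝ := Matrix.of fun i j => A k i j - A k j i

theorem skewPart_transpose (A : K → Fin (d + 1) → Fin (d + 1) → ℝ) (k : K) :
    (skewPart A k)ᵀ = -skewPart A k := by
  ext i j
  simp [skewPart]

theorem skewPart_add_smul (A B : K → Fin (d + 1) → Fin (d + 1) → ℝ) (t : ℝ) (k : K) :
    skewPart (A + t • B) k = skewPart A k + t • skewPart B k := by
  ext i j
  simp [skewPart]
  ring

theorem exists_skewPart_eq {Ω : K → Matrix (Fin (d + 1)) (Fin (d + 1)) ℝ}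
    (h : ∀ k, (Ω k)ᵀ = -Ω k) : ∃ A, ∀ k, skewPart A k = Ω k := by
  refine ⟨fun k i j => Ω k i j / 2, fun k => ?_⟩
  ext i j
  have : Ω k j i = - Ω k i j := congrFun (congrFun (h k) i) j
  simp only [skewPart, Matrix.of_apply, this]
  ring

/-- Half-way configurations and class-wise infinitesimal isometries parametrize pairs of
placements which are congruent on every class; this records one of the two placements and the
change of the lengths of the bars at `T`. -/
def classMap (κ : W → K) (mate : W → W) (T : Set W)
    (z : (W → Fin d → ℝ) × (K → Fin (d + 1) → Fin (d + 1) → ℝ)) :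
    (W → Fin d → ℝ) × (T → ℝ) :=
  (fun x => z.1 x + velocity (skewPart z.2 (κ x)) (z.1 x),
    fun e => barForm κ mate z.1 (skewPart z.2) e)

theorem contDiff_hat (x : W) (j : Fin (d + 1)) :
    ContDiff ℝ 1 fun z : (W → Fin d → ℝ) × (K → Fin (d + 1) → Fin (d + 1) → ℝ) =>
      hat (z.1 x) j := by
  refine Fin.cases ?_ (fun i => ?_) j
  · simp only [hat_zero]
    exact contDiff_const
  · simp only [hat_succ]
    fun_prop

theorem contDiff_skewPart (k : K) (i j : Fin (d + 1)) :
    ContDiff ℝ 1 fun z : (W → Fin d → ℝ) × (K → Fin (d + 1) → Fin (d + 1) → ℝ) =>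
      skewPart z.2 k i j := by
  simp only [skewPart, Matrix.of_apply]
  fun_prop

theorem contDiff_form (x y : W) (k l : K) :
    ContDiff ℝ 1 fun z : (W → Fin d → ℝ) × (K → Fin (d + 1) → Fin (d + 1) → ℝ) =>
      hat (z.1 x) ⬝ᵥ (skewPart z.2 k - skewPart z.2 l) *ᵥ hat (z.1 y) := by
  simp only [dotProduct, mulVec, Matrix.sub_apply]
  exact ContDiff.sum fun i _ => (contDiff_hat x i).mul (ContDiff.sum fun j _ =>
    ((contDiff_skewPart k i j).sub (contDiff_skewPart l i j)).mul (contDiff_hat y j))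

theorem contDiff_classMap (T : Set W) [Fintype T] : ContDiff ℝ 1 (classMap (d := d) κ mate T) := by
  refine ContDiff.prodMk (contDiff_pi.mpr fun x => contDiff_pi.mpr fun i => ?_)
    (contDiff_pi.mpr fun e => contDiff_form _ _ _ _)
  simp only [Pi.add_apply, velocity, dotProduct, mulVec]
  exact ContDiff.add (by fun_prop) (ContDiff.sum fun j _ =>
    (contDiff_skewPart _ _ j).mul (contDiff_hat x j))

theorem hasDerivAt_cubic (a b c e : ℝ) :
    HasDerivAt (fun t : ℝ => a + t * b + t ^ 2 * c + t ^ 3 * e) b 0 := by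
  have h := (((hasDerivAt_id (0 : ℝ)).mul_const b).const_add a).add
    ((hasDerivAt_pow 2 (0 : ℝ)).mul_const c) |>.add ((hasDerivAt_pow 3 (0 : ℝ)).mul_const e)
  exact h.congr_deriv (by norm_num)

theorem hasDerivAt_form (Ω Ω' : Matrix (Fin (d + 1)) (Fin (d + 1)) ℝ) (x y x' y' : Fin d → ℝ) :
    HasDerivAt (fun t : ℝ => hat (x + t • x') ⬝ᵥ (Ω + t • Ω') *ᵥ hat (y + t • y'))
      (hatDir x' ⬝ᵥ Ω *ᵥ hat y + hat x ⬝ᵥ Ω' *ᵥ hat y + hat x ⬝ᵥ Ω *ᵥ hatDir y') 0 := by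
  convert hasDerivAt_cubic (hat x ⬝ᵥ Ω *ᵥ hat y) _
    (hatDir x' ⬝ᵥ Ω' *ᵥ hat y + hatDir x' ⬝ᵥ Ω *ᵥ hatDir y' + hat x ⬝ᵥ Ω' *ᵥ hatDir y')
    (hatDir x' ⬝ᵥ Ω' *ᵥ hatDir y') using 1
  funext t
  simp only [hat_add, hatDir_smul, add_mulVec, mulVec_add, smul_mulVec, mulVec_smul,
    dotProduct_add, add_dotProduct, smul_dotProduct, dotProduct_smul, smul_eq_mul]
  ring

theorem hasDerivAt_velocity (Ω Ω' : Matrix (Fin (d + 1)) (Fin (d + 1)) ℝ) (x x' : Fin d → ℝ)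
    (i : Fin d) : HasDerivAt (fun t : ℝ => velocity (Ω + t • Ω') (x + t • x') i)
      ((Ω *ᵥ hatDir x') i.succ + velocity Ω' x i) 0 := by
  convert hasDerivAt_cubic (velocity Ω x i) _ ((Ω' *ᵥ hatDir x') i.succ) 0 using 1
  funext t
  simp only [velocity, hat_add, hatDir_smul, add_mulVec, mulVec_add, smul_mulVec, mulVec_smul,
    Pi.add_apply, Pi.smul_apply, smul_eq_mul]
  ring

/-- The directional derivatives of `classMap`. -/
theorem hasLineDerivAt_classMap (T : Set W) [Fintype T] (c c' : W → Fin d → ℝ)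
    (A A' : K → Fin (d + 1) → Fin (d + 1) → ℝ) :
    HasDerivAt (fun t : ℝ => classMap κ mate T ((c, A) + t • (c', A')))
      (fun x i => c' x i + ((skewPart A (κ x) *ᵥ hatDir (c' x)) i.succ +
          velocity (skewPart A' (κ x)) (c x) i),
        fun e => hatDir (c' e) ⬝ᵥ (skewPart A (κ e) - skewPart A (κ (mate e))) *ᵥ hat (c (mate e)) +
          hat (c e) ⬝ᵥ (skewPart A' (κ e) - skewPart A' (κ (mate e))) *ᵥ hat (c (mate e)) +
          hat (c e) ⬝ᵥ (skewPart A (κ e) - skewPart A (κ (mate e))) *ᵥ hatDir (c' (mate e))) 0 := by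
  refine HasDerivAt.prodMk (hasDerivAt_pi.mpr fun x => hasDerivAt_pi.mpr fun i => ?_)
    (hasDerivAt_pi.mpr fun e => ?_)
  · have h1 : HasDerivAt (fun t : ℝ => c x i + t * c' x i) (c' x i) 0 := by
      simpa using ((hasDerivAt_id (0 : ℝ)).mul_const (c' x i)).const_add (c x i)
    convert h1.add (hasDerivAt_velocity (skewPart A (κ x)) (skewPart A' (κ x)) (c x) (c' x) i)
      using 1
    funext t
    simp [skewPart_add_smul]
  · refine (hasDerivAt_form (skewPart A (κ e) - skewPart A (κ (mate e)))
      (skewPart A' (κ e) - skewPart A' (κ (mate e))) (c e) (c (mate e)) (c' e)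
      (c' (mate e))).congr_of_eventuallyEq (Filter.Eventually.of_forall fun t => ?_)
    have : ∀ M N M' N' : Matrix (Fin (d + 1)) (Fin (d + 1)) ℝ,
        M + t • M' - (N + t • N') = M - N + t • (M' - N') := fun M N M' N' => by
      rw [smul_sub]; abel
    simp [barForm, skewPart_add_smul, this]

/-- Twice a half-way configuration determines the change of the lengths. -/
theorem sum_sq_sub_sum_sq {Ω Ω' : Matrix (Fin (d + 1)) (Fin (d + 1)) ℝ} (h : Ωᵀ = -Ω)
    (h' : Ω'ᵀ = -Ω') (x y : Fin d → ℝ) :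
    ∑ i, ((x + velocity Ω x) i - (y + velocity Ω' y) i) ^ 2 -
      ∑ i, ((x - velocity Ω x) i - (y - velocity Ω' y) i) ^ 2 =
        4 * (hat x ⬝ᵥ (Ω - Ω') *ᵥ hat y) := by
  rw [← sum_sub_mul_velocity h h', ← Finset.sum_sub_distrib, Finset.mul_sum]
  refine Finset.sum_congr rfl fun i _ => ?_
  simp only [Pi.add_apply, Pi.sub_apply]
  ring

theorem barForm_sum_smul {ι : Type*} (s : Finset ι) (q : W → Fin d → ℝ) (t : ι → ℝ)
    (Ω : ι → K → Matrix (Fin (d + 1)) (Fin (d + 1)) ℝ) (c : W) :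
    barForm κ mate q (∑ e ∈ s, t e • Ω e) c = ∑ e ∈ s, t e * barForm κ mate q (Ω e) c := by
  classical
  induction s using Finset.induction_on with
  | empty => simp [barForm]
  | insert a s ha ih =>
    rw [Finset.sum_insert ha, Finset.sum_insert ha, ← ih, add_comm (t a • Ω a),
      ← sub_neg_eq_add _ (t a • Ω a), ← neg_smul, barForm_sub_smul]
    ring

theorem BarsIndependent.exists_barForm_eq {q : W → Fin d → ℝ} (h : BarsIndependent κ mate q)
    {T : Set W} (hT : ∀ a ∈ T, κ a ≠ κ (mate a) ∧ mate a ∉ T) (μ : T → ℝ) :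
    ∃ Ψ : K → Matrix (Fin (d + 1)) (Fin (d + 1)) ℝ, (∀ k, (Ψ k)ᵀ = -Ψ k) ∧
      ∀ e : T, barForm κ mate q Ψ e = μ e := by
  classical
  have : Fintype T := Fintype.ofFinite T
  choose Ω hΩ hΩa hΩc using fun e : T => h e (hT e e.2).1
  refine ⟨∑ e, (μ e / barForm κ mate q (Ω e) e) • Ω e, fun k => ?_, fun e => ?_⟩
  · simp only [Finset.sum_apply, Pi.smul_apply, transpose_sum, transpose_smul, hΩ, smul_neg,
      Finset.sum_neg_distrib]
  · rw [barForm_sum_smul, Finset.sum_eq_single e, div_mul_cancel₀ _ (hΩa e)]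
    · intro f _ hf
      rw [hΩc f e (fun h => hf (Subtype.ext h.symm)) fun h => (hT f f.2).2 (h ▸ e.2), mul_zero]
    · simp

theorem exists_oriented_bars (hmm : ∀ x, mate (mate x) = x) (r : K) :
    ∃ T : Set W, (∀ a ∈ T, κ a ≠ κ (mate a) ∧ mate a ∉ T) ∧ (∀ a ∈ T, κ (mate a) ≠ r) ∧
      ∀ a, κ a ≠ κ (mate a) → a ∈ T ∨ mate a ∈ T := by
  let o := Fintype.equivFin W
  refine ⟨{a | κ a ≠ κ (mate a) ∧ κ (mate a) ≠ r ∧ (κ a = r ∨ o a < o (mate a))},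
    fun a ha => ⟨ha.1, fun ha' => ?_⟩, fun a ha => ha.2.1, fun a ha => ?_⟩
  · obtain ⟨-, h2, h3⟩ := ha
    obtain ⟨-, h5, h6⟩ := ha'
    rw [hmm] at h5 h6
    exact lt_asymm (h3.resolve_left h5) (h6.resolve_left h2)
  · have hne : o a ≠ o (mate a) := fun h => ha (by rw [← o.injective h])
    by_cases h1 : κ a = r
    · exact Or.inl ⟨ha, fun h => ha (h1.trans h.symm), Or.inl h1⟩
    by_cases h2 : κ (mate a) = r
    · exact Or.inr ⟨by rw [hmm]; exact ha.symm, by rwa [hmm], Or.inl h2⟩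
    rcases lt_or_gt_of_ne hne with h | h
    · exact Or.inl ⟨ha, h2, Or.inr h⟩
    · exact Or.inr ⟨by rw [hmm]; exact ha.symm, by rwa [hmm], Or.inr (by rwa [hmm])⟩

end LocalSurjectivity

section SpecialPosition

open Matrix Topology

variable {W K : Type*} [Fintype W] [Fintype K] {d : ℕ} [NeZero d] {κ : W → K} {mate : W → W}

/-- The infinitesimal translation by `-1/2` in the first coordinate direction. -/
def shift (d : ℕ) [NeZero d] : Matrix (Fin (d + 1)) (Fin (d + 1)) ℝ :=
  (1 / 2 : ℝ) • (vecMulVec (Pi.single 0 1) (Pi.single (0 : Fin d).succ 1) -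
    vecMulVec (Pi.single (0 : Fin d).succ 1) (Pi.single 0 1))

theorem shift_transpose : (shift d)ᵀ = -shift d := by
  rw [shift, transpose_smul, transpose_sub, transpose_vecMulVec, transpose_vecMulVec, ← smul_neg,
    neg_sub]

theorem shift_mulVec (w : Fin (d + 1) → ℝ) : shift d *ᵥ w =
    (1 / 2 : ℝ) • (w (0 : Fin d).succ • Pi.single 0 1 - w 0 • Pi.single (0 : Fin d).succ 1) := by
  rw [shift, smul_mulVec, sub_mulVec, vecMulVec_mulVec, vecMulVec_mulVec]
  simp [single_dotProduct]

theorem dotProduct_shift_mulVec (x w : Fin (d + 1) → ℝ) : x ⬝ᵥ shift d *ᵥ w =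
    1 / 2 * (w (0 : Fin d).succ * x 0 - w 0 * x (0 : Fin d).succ) := by
  rw [shift_mulVec, dotProduct_smul, dotProduct_sub, dotProduct_smul, dotProduct_smul,
    dotProduct_single_one, dotProduct_single_one]
  simp only [smul_eq_mul]

/-- The homogeneous matrix of the translation by `1/2` in the first coordinate direction. -/
def shear (d : ℕ) [NeZero d] : Matrix (Fin (d + 1)) (Fin (d + 1)) ℝ :=
  1 + (1 / 2 : ℝ) • vecMulVec (Pi.single (0 : Fin d).succ 1) (Pi.single 0 1)

theorem shear_mulVec (w : Fin (d + 1) → ℝ) :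
    shear d *ᵥ w = w + (1 / 2 * w 0) • Pi.single (0 : Fin d).succ 1 := by
  rw [shear, add_mulVec, one_mulVec, smul_mulVec, vecMulVec_mulVec, mul_smul]
  simp [single_dotProduct]

theorem hat_add_single (x : Fin d → ℝ) (t : ℝ) :
    hat (x + Pi.single 0 t) = hat x + t • Pi.single (0 : Fin d).succ 1 := by
  funext i
  refine Fin.cases ?_ (fun i => ?_) i
  · simp
  · by_cases hi : i = 0
    · subst hi
      rw [Pi.add_apply, hat_succ, hat_succ, Pi.add_apply, Pi.smul_apply, Pi.single_eq_same,
        Pi.single_eq_same, smul_eq_mul, mul_one]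
    · have : i.succ ≠ (0 : Fin d).succ := fun h => hi (Fin.succ_injective _ h)
      rw [Pi.add_apply, hat_succ, hat_succ, Pi.add_apply, Pi.smul_apply, Pi.single_eq_of_ne hi,
        Pi.single_eq_of_ne this, smul_zero]

theorem form_shear {Ψ Ψ' : Matrix (Fin (d + 1)) (Fin (d + 1)) ℝ} (h : Ψᵀ = -Ψ) (x y : Fin d → ℝ) :
    hat x ⬝ᵥ ((shear d)ᵀ * Ψ * shear d - Ψ') *ᵥ hat y +
      1 / 2 * (velocity ((shear d)ᵀ * Ψ * shear d) x 0 - velocity Ψ' y 0) =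
    hat (x + Pi.single 0 (1 / 2)) ⬝ᵥ (Ψ - Ψ') *ᵥ hat y := by
  have hvel : ∀ (M : Matrix (Fin (d + 1)) (Fin (d + 1)) ℝ) (z : Fin d → ℝ),
      velocity M z 0 = Pi.single (0 : Fin d).succ 1 ⬝ᵥ M *ᵥ hat z := fun M z => by
    rw [single_one_dotProduct]; rfl
  have hform : ∀ z w, z ⬝ᵥ ((shear d)ᵀ * Ψ * shear d) *ᵥ w =
      (shear d *ᵥ z) ⬝ᵥ Ψ *ᵥ (shear d *ᵥ w) := fun z w => by
    rw [← mulVec_mulVec, ← mulVec_mulVec, dotProduct_mulVec, vecMul_transpose]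
  have he : shear d *ᵥ Pi.single (0 : Fin d).succ 1 = Pi.single (0 : Fin d).succ 1 := by
    rw [shear_mulVec, Pi.single_eq_of_ne (Fin.succ_ne_zero _).symm]
    simp
  have h1 := skew_dotProduct_self h (Pi.single (0 : Fin d).succ 1)
  have h2 := skew_dotProduct h (hat x) (Pi.single (0 : Fin d).succ 1)
  rw [hvel, hvel, hat_add_single, sub_mulVec, dotProduct_sub, hform, hform, he, shear_mulVec,
    shear_mulVec, hat_zero, hat_zero, mul_one]
  simp only [sub_mulVec, mulVec_add, mulVec_smul, dotProduct_add, add_dotProduct, dotProduct_sub,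
    smul_dotProduct, dotProduct_smul, smul_eq_mul]
  linear_combination (1 / 2 : ℝ) * h2 + 1 / 2 * h1

open Classical in
/-- The half-way configuration when the class `r` is translated. -/
def halfway (κ : W → K) (r : K) (q : W → Fin d → ℝ) : W → Fin d → ℝ :=
  fun x => if κ x = r then q x - Pi.single 0 (1 / 2) else q x

theorem exists_skewPart_shift (r : K) :
    ∃ A : K → Fin (d + 1) → Fin (d + 1) → ℝ, skewPart A r = shift d ∧
      ∀ k, k ≠ r → skewPart A k = 0 := by
  classical
  obtain ⟨A, hA⟩ := exists_skewPart_eq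
    (Ω := fun k => if k = r then shift d else 0) fun k => by
      split_ifs
      · exact shift_transpose
      · simp
  exact ⟨A, by rw [hA, if_pos rfl], fun k hk => by rw [hA, if_neg hk]⟩

/-- In special position, the class parametrization is a submersion. -/
theorem BarsIndependent.exists_lineDeriv {q : W → Fin d → ℝ} (h : BarsIndependent κ mate q)
    {r : K} {T : Set W} [Fintype T] (hT : ∀ a ∈ T, κ a ≠ κ (mate a) ∧ mate a ∉ T)
    (hTr : ∀ a ∈ T, κ (mate a) ≠ r) {A : K → Fin (d + 1) → Fin (d + 1) → ℝ}
    (hAr : skewPart A r = shift d) (hA : ∀ k, k ≠ r → skewPart A k = 0)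
    (y : (W → Fin d → ℝ) × (T → ℝ)) :
    ∃ z, HasDerivAt (fun t : ℝ => classMap κ mate T ((halfway κ r q, A) + t • z)) y 0 := by
  classical
  obtain ⟨p', l⟩ := y
  obtain ⟨Ψ, hΨ, hΨe⟩ := h.exists_barForm_eq hT fun e => l e +
    if κ (e : W) = r then 1 / 2 * (p' e 0 - p' (mate e) 0) else 0
  obtain ⟨A', hA'⟩ := exists_skewPart_eq
    (Ω := fun k => if k = r then (shear d)ᵀ * Ψ k * shear d else Ψ k) fun k => by
      split_ifs
      · rw [transpose_mul, transpose_mul, transpose_transpose, hΨ, Matrix.neg_mul, Matrix.mul_neg,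
          Matrix.mul_assoc]
      · exact hΨ k
  let c := halfway κ r q
  refine ⟨(fun x => p' x - velocity (skewPart A' (κ x)) (c x), A'), ?_⟩
  convert hasLineDerivAt_classMap (κ := κ) (mate := mate) T c _ A A' using 1
  refine Prod.ext (funext fun x => funext fun i => ?_) (funext fun e => ?_)
  · have : (skewPart A (κ x) *ᵥ hatDir (p' x - velocity (skewPart A' (κ x)) (c x))) i.succ = 0 := by
      by_cases hx : κ x = r
      · rw [hx, hAr, shift_mulVec]
        simp [hatDir]
      · simp [hA _ hx]
    dsimp only
    rw [this]
    simp
  · have hb := hTr e e.2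
    have hcb : c (mate e) = q (mate e) := if_neg hb
    have hμ := hΨe e
    dsimp only
    by_cases ha : κ (e : W) = r
    · have hca : c e + Pi.single 0 (1 / 2) = q e := by
        simp only [c, halfway, if_pos ha, sub_add_cancel]
      have hf := form_shear (Ψ' := Ψ (κ (mate e))) (hΨ (κ e)) (c e) (c (mate e))
      rw [if_pos ha] at hμ
      rw [hca, hcb] at hf
      rw [barForm, ← hf] at hμ
      rw [hA _ hb, sub_zero, hA', hA', if_pos ha, if_neg hb, ha, hAr, dotProduct_shift_mulVec,
        dotProduct_shift_mulVec, hcb]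
      rw [ha] at hμ
      simp only [hatDir, Fin.cons_succ, Fin.cons_zero, hat_zero, Pi.sub_apply]
      linear_combination -hμ
    · have hca : c e = q e := if_neg ha
      rw [if_neg ha, add_zero, barForm] at hμ
      rw [hA _ ha, hA _ hb, hA', hA', if_neg ha, if_neg hb, hca, hcb, hμ]
      simp

end SpecialPosition

section Equivalent

open Matrix Topology

variable {W K : Type*} [Fintype W] [Fintype K] {d : ℕ} [NeZero d] {κ : W → K} {mate : W → W}

theorem Generic.sub_ne_half {p : W → Fin d → ℝ} (hp : Generic p) {u v : W} (huv : u ≠ v) :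
    p u 0 - p v 0 ≠ 1 / 2 := by
  classical
  intro h
  obtain ⟨D, hD⟩ := hp.exists_derivation (Pi.single u 1)
  have h' := congrArg D h
  have h2 : D (1 / 2 : ℝ) = 0 := by
    have := D.map_algebraMap (1 / 2 : ℚ)
    simpa using this
  rw [map_sub, hD, hD, h2] at h'
  simp [huv.symm] at h'

theorem Generic.apply_ne {p : W → Fin d → ℝ} (hp : Generic p) {u v : W} (huv : u ≠ v) :
    p u 0 ≠ p v 0 := fun h =>
  huv (congrArg Prod.fst (hp.injective (a₁ := (u, 0)) (a₂ := (v, 0)) h))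

/-- Classes joined by bars whose lengths can be changed independently admit a generic placement
and an equivalent placement with a different distance between the classes. -/
theorem BarsIndependent.exists_equivalent {p : W → Fin d → ℝ} (h : BarsIndependent κ mate p)
    (hmm : ∀ x, mate (mate x) = x) {G : SimpleGraph W}
    (hG : ∀ x y, G.Adj x y → κ x = κ y ∨ y = mate x) (hp : Generic p) {u v : W}
    (huv : κ u ≠ κ v) (hv : v ≠ mate u) :
    ∃ p' : W → Fin d → ℝ, Generic p' ∧ ∃ q : W → Fin d → ℝ,
      (∀ x y, G.Adj x y → ∑ i, (p' x i - p' y i) ^ 2 = ∑ i, (q x i - q y i) ^ 2) ∧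
      ∑ i, (p' u i - p' v i) ^ 2 ≠ ∑ i, (q u i - q v i) ^ 2 := by
  classical
  obtain ⟨q₀, hq₀, hq₁, hq₂⟩ := h.exists_special hmm (κ u)
  obtain ⟨T, hT, hTr, hcover⟩ := exists_oriented_bars (κ := κ) hmm (κ u)
  obtain ⟨A, hAr, hA⟩ := exists_skewPart_shift (K := K) (d := d) (κ u)
  have : Fintype T := Fintype.ofFinite T
  let z₀ : (W → Fin d → ℝ) × (K → Fin (d + 1) → Fin (d + 1) → ℝ) := (halfway κ (κ u) q₀, A)
  have hhalf : ∀ x, κ x = κ u → z₀.1 x 0 = q₀ x 0 - 1 / 2 := fun x hx => by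
    change halfway κ (κ u) q₀ x 0 = _
    rw [halfway, if_pos hx, Pi.sub_apply, Pi.single_eq_same]
  have hhalf' : ∀ x, κ x ≠ κ u → z₀.1 x 0 = p x 0 := fun x hx => by
    change halfway κ (κ u) q₀ x 0 = _
    rw [halfway, if_neg hx, hq₂ x fun h => hx h.1]
  have hbars : (classMap κ mate T z₀).2 = 0 := by
    funext e
    change hat (z₀.1 e) ⬝ᵥ (skewPart A (κ e) - skewPart A (κ (mate e))) *ᵥ hat (z₀.1 (mate e)) = 0
    rw [hA _ (hTr e e.2), sub_zero]
    by_cases he : κ (e : W) = κ u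
    · rw [he, hAr, dotProduct_shift_mulVec, hat_zero, hat_zero, hat_succ, hat_succ,
        hhalf _ he, hhalf' _ (hTr e e.2), hq₁ _ he (hTr e e.2)]
      ring
    · rw [hA _ he, zero_mulVec, dotProduct_zero]
  have hform : hat (z₀.1 u) ⬝ᵥ (skewPart z₀.2 (κ u) - skewPart z₀.2 (κ v)) *ᵥ hat (z₀.1 v) ≠ 0 := by
    change hat (z₀.1 u) ⬝ᵥ (skewPart A (κ u) - skewPart A (κ v)) *ᵥ hat (z₀.1 v) ≠ 0
    rw [hA _ huv.symm, sub_zero, hAr, dotProduct_shift_mulVec, hat_zero, hat_zero, hat_succ,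
      hat_succ, hhalf _ rfl, hhalf' _ huv.symm]
    intro h0
    by_cases hu : κ (mate u) = κ u
    · rw [hq₂ u fun h => h.2 hu] at h0
      exact hp.sub_ne_half (fun h => huv (congrArg κ h)) (by linarith : p u 0 - p v 0 = 1 / 2)
    · rw [hq₁ u rfl hu] at h0
      exact hp.apply_ne hv (by linarith)
  have hstrict := ((contDiff_classMap (d := d) (κ := κ) (mate := mate) T).contDiffAt
    (x := z₀)).hasStrictFDerivAt one_ne_zero
  have hsurj : (fderiv ℝ (classMap (d := d) κ mate T) z₀).range = ⊤ := by
    refine LinearMap.range_eq_top.mpr fun y => ?_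
    obtain ⟨z, hz⟩ := hq₀.exists_lineDeriv hT hTr hAr hA y
    exact ⟨z, (hstrict.hasFDerivAt.hasLineDerivAt z).unique hz⟩
  have hmap := hstrict.map_nhds_eq_of_surj hsurj
  have hU : {z : (W → Fin d → ℝ) × (K → Fin (d + 1) → Fin (d + 1) → ℝ) |
      hat (z.1 u) ⬝ᵥ (skewPart z.2 (κ u) - skewPart z.2 (κ v)) *ᵥ hat (z.1 v) ≠ 0} ∈ 𝓝 z₀ :=
    (contDiff_form u v (κ u) (κ v)).continuous.continuousAt.eventually_ne hform
  have hpre : {p' : W → Fin d → ℝ | ∃ z : (W → Fin d → ℝ) × (K → Fin (d + 1) → Fin (d + 1) → ℝ),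
      hat (z.1 u) ⬝ᵥ (skewPart z.2 (κ u) - skewPart z.2 (κ v)) *ᵥ hat (z.1 v) ≠ 0 ∧
        classMap κ mate T z = (p', 0)} ∈ 𝓝 (classMap κ mate T z₀).1 := by
    have hc : ContinuousAt (fun p' : W → Fin d → ℝ => (p', (0 : T → ℝ)))
      (classMap κ mate T z₀).1 := by fun_prop
    refine hc.preimage_mem_nhds (t := classMap κ mate T '' {z | hat (z.1 u) ⬝ᵥ
      (skewPart z.2 (κ u) - skewPart z.2 (κ v)) *ᵥ hat (z.1 v) ≠ 0}) ?_
    rw [← hbars, Prod.mk.eta, ← hmap]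
    exact Filter.image_mem_map hU
  obtain ⟨p', ⟨z, hzU, hz⟩, hp'⟩ := exists_generic_mem_nhds _ hpre
  have hx : ∀ x, p' x = z.1 x + velocity (skewPart z.2 (κ x)) (z.1 x) := fun x =>
    (congrFun (congrArg Prod.fst hz) x).symm
  have hdiff : ∀ x y, ∑ i, (p' x i - p' y i) ^ 2 -
      ∑ i, ((z.1 x - velocity (skewPart z.2 (κ x)) (z.1 x)) i -
        (z.1 y - velocity (skewPart z.2 (κ y)) (z.1 y)) i) ^ 2 =
      4 * (hat (z.1 x) ⬝ᵥ (skewPart z.2 (κ x) - skewPart z.2 (κ y)) *ᵥ hat (z.1 y)) := fun x y => by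
    rw [hx, hx]
    exact sum_sq_sub_sum_sq (skewPart_transpose _ _) (skewPart_transpose _ _) _ _
  refine ⟨p', hp', fun x => z.1 x - velocity (skewPart z.2 (κ x)) (z.1 x), fun x y hxy => ?_,
    fun heq => hzU ?_⟩
  · rw [← sub_eq_zero, hdiff]
    by_cases hκ : κ x = κ y
    · rw [hκ, sub_self, zero_mulVec, dotProduct_zero, mul_zero]
    obtain rfl := (hG x y hxy).resolve_left hκ
    have hT0 : ∀ e : T, barForm κ mate z.1 (skewPart z.2) e = 0 := fun e =>
      congrFun (congrArg Prod.snd hz) e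
    have : barForm κ mate z.1 (skewPart z.2) x = 0 := by
      rcases hcover x hκ with hx | hx
      · exact hT0 ⟨x, hx⟩
      · rw [← barForm_mate hmm (skewPart_transpose _)]
        exact hT0 ⟨mate x, hx⟩
    rw [barForm] at this
    rw [this, mul_zero]
  · have := hdiff u v
    rw [sub_eq_zero.mpr heq] at this
    linarith

end Equivalent

section Combination

open Matrix

variable {W U : Type*} [Fintype W] [DecidableEq W] {d : ℕ} {G : SimpleGraph W} {β : W → U}
  {mate : W → W}

theorem exists_velocity_eq {A : Matrix (Fin d) (Fin d) ℝ} (hA : Aᵀ = -A) (t : Fin d → ℝ) :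
    ∃ Ω : Matrix (Fin (d + 1)) (Fin (d + 1)) ℝ, Ωᵀ = -Ω ∧ ∀ y, velocity Ω y = t + A *ᵥ y := by
  have hA' : ∀ i j, A j i = -A i j := fun i j => congrFun (congrFun hA i) j
  refine ⟨Matrix.of (Fin.cons (Fin.cons 0 (-t)) fun i => Fin.cons (t i) (A i)), ?_, fun y => ?_⟩
  · ext i j
    refine Fin.cases ?_ (fun i => ?_) i <;> refine Fin.cases ?_ (fun j => ?_) j
    · simp
    · simp
    · simp
    · simpa using hA' i j
  · funext i
    simp [velocity, mulVec, dotProduct, Fin.sum_univ_succ]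

/-- The bars between different linked classes are independent. -/
theorem BodyBar.barsIndependent (hB : BodyBar G β mate) {p : W → Fin d → ℝ} (hp : Generic p)
    {κ : W → W} (hκ : ∀ x y, κ x = κ y ↔ Link p G β mate x y)
    (hκx : ∀ x, Link p G β mate (κ x) x) : BarsIndependent κ mate p := by
  intro a ha
  have hNBa : ¬ NB p G mate a := fun h => ha ((hκ _ _).mpr (Link.of_nb h))
  rcases exists_stress_or_motion G.edgeSet p a (mate a) with ⟨τ, hτ, hτ1, hτ0⟩ | ⟨m, hm, hma⟩
  · refine absurd ⟨τ, hτ, fun e he => hτ0 e he fun h => he (h ▸ hB.bar_mem a), ?_⟩ hNBa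
    rw [hτ1]
    exact one_ne_zero
  choose A hA hAm using fun k => hB.chain_motion hp (u := k) Set.sdiff_subset
    (fun x y _ hxy hne => ⟨hB.mem_edgeSet_of_body hxy hne, fun h => by
      rcases Sym2.eq_iff.mp h with ⟨rfl, rfl⟩ | ⟨rfl, rfl⟩
      · exact hB.body_mate _ hxy.symm
      · exact hB.body_mate _ hxy⟩)
    (fun x _ ⟨ω, h1, h2, h3⟩ => ⟨ω, h1, fun e he => by
      by_cases heG : e ∈ G.edgeSet
      · obtain rfl : e = s(a, mate a) := by_contra fun h => he ⟨heG, h⟩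
        exact by_contra fun h => hNBa ⟨ω, h1, h2, h⟩
      · exact h2 e heG, h3⟩) hm
  choose Ω hΩ hΩv using fun k => exists_velocity_eq (hA k) (m k - A k *ᵥ p k)
  have hvel : ∀ x, velocity (Ω (κ x)) (p x) = m x := fun x => by
    rw [hΩv, sub_add_eq_add_sub, add_sub_assoc, ← mulVec_sub, ← hAm _ x (hκx x), add_sub_cancel]
  have hform : ∀ c, barForm κ mate p Ω c =
      ∑ i, (p c i - p (mate c) i) * (m c i - m (mate c) i) := fun c => by
    rw [barForm, ← sum_sub_mul_velocity (hΩ _) (hΩ _), hvel, hvel]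
  refine ⟨Ω, hΩ, by rwa [hform], fun c hca hcm => ?_⟩
  rw [hform]
  refine hm _ _ ⟨hB.bar_mem c, fun h => ?_⟩
  rcases Sym2.eq_iff.mp h with ⟨h, -⟩ | ⟨h, -⟩
  exacts [hca h, hcm h]

/-- Vertices that are not linked are not globally linked. -/
theorem BodyBar.exists_equivalent_of_not_link [NeZero d] (hB : BodyBar G β mate)
    {p : W → Fin d → ℝ} (hp : Generic p) {u v : W} (huv : ¬ Link p G β mate u v)
    (hadj : ¬ G.Adj u v) :
    ∃ p' : W → Fin d → ℝ, Generic p' ∧ ∃ q : W → Fin d → ℝ,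
      (∀ x y, G.Adj x y → ∑ i, (p' x i - p' y i) ^ 2 = ∑ i, (q x i - q y i) ^ 2) ∧
      ∑ i, (p' u i - p' v i) ^ 2 ≠ ∑ i, (q u i - q v i) ^ 2 := by
  let S : Setoid W := ⟨Link p G β mate, fun _ => .refl, hB.link_symm, Link.trans⟩
  let κ : W → W := fun x => (Quotient.mk S x).out
  have hκ : ∀ x y, κ x = κ y ↔ Link p G β mate x y := fun x y =>
    Quotient.out_inj.trans Quotient.eq
  refine (hB.barsIndependent hp hκ fun x => Quotient.mk_out x).exists_equivalent hB.mate_mate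
    (fun x y h => ((hB.adj x y).mp h).2.imp_left fun h => (hκ x y).mpr (Link.of_body h)) hp
    (fun h => huv ((hκ u v).mp h)) fun h => hadj ?_
  rw [h]
  exact hB.bar_mem u

theorem exists_bodyBar {V E W : Type*} [Finite E] [Finite W] {H : Multigraph V E}
    {G : SimpleGraph W} {B : V → Set W} {bar : E → W × W} (h : IsBodyBar H G B bar) :
    ∃ (β : W → V) (mate : W → W), BodyBar G β mate := by
  obtain ⟨hpart, hcard, hends, -, hdisj, hadj⟩ := h
  choose β hβ hβ' using hpart
  have hinj : ∀ {x e e'}, x ∈ ({(bar e).1, (bar e).2} : Set W) →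
      x ∈ ({(bar e').1, (bar e').2} : Set W) → e = e' := fun {x e e'} hx hx' => by
    by_contra hne
    exact (Set.eq_empty_iff_forall_notMem.mp (hdisj e e' hne)) x ⟨hx, hx'⟩
  have hcover : ∀ x, ∃ e, x ∈ ({(bar e).1, (bar e).2} : Set W) := fun x => by
    have hf : ∀ e, ∃ y, y ∈ ({(bar e).1, (bar e).2} : Set W) ∧
        (β x ∈ H.ends e → y ∈ B (β x)) := fun e => by
      obtain ⟨w, z, he, hw, hz⟩ := hends e
      by_cases hxw : β x = w
      · exact ⟨_, Or.inl rfl, fun _ => hxw ▸ hw⟩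
      · refine ⟨_, Or.inr rfl, fun hx => ?_⟩
        rw [he, Sym2.mem_iff] at hx
        exact hx.resolve_left hxw ▸ hz
    choose f hf hfB using hf
    have himg : f '' {e | β x ∈ H.ends e} = B (β x) := by
      refine Set.eq_of_subset_of_ncard_le (Set.image_subset_iff.mpr fun e he => hfB e he) ?_
        (Set.toFinite _)
      have hfi : Function.Injective f := fun e e' hee => hinj (hf e) (by rw [hee]; exact hf e')
      rw [hcard, Set.ncard_image_of_injective _ hfi]
    obtain ⟨e, -, rfl⟩ := himg.ge (hβ x)
    exact ⟨e, hf e⟩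
  have hmate : ∀ x, ∃ y e, s(x, y) = s((bar e).1, (bar e).2) := fun x => by
    obtain ⟨e, rfl | rfl⟩ := hcover x
    · exact ⟨_, e, rfl⟩
    · exact ⟨_, e, Sym2.eq_swap⟩
  choose mate e he using hmate
  have hmem : ∀ {x y e}, s(x, y) = s((bar e).1, (bar e).2) →
      x ∈ ({(bar e).1, (bar e).2} : Set W) := fun {x y e} h => by
    rcases Sym2.eq_iff.mp h with ⟨rfl, -⟩ | ⟨rfl, -⟩
    exacts [Or.inl rfl, Or.inr rfl]
  have huniq : ∀ {x y f}, s(x, y) = s((bar f).1, (bar f).2) → y = mate x := fun {x y f} h => by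
    obtain rfl := hinj (hmem h) (hmem (he x))
    exact Sym2.congr_right.mp (h.trans (he x).symm)
  refine ⟨β, mate, fun x => (huniq (Sym2.eq_swap.trans (he x))).symm, fun x hx => ?_,
    fun x y => (hadj x y).trans (and_congr_right fun _ => or_congr
      ⟨fun ⟨v, hx, hy⟩ => (hβ' x v hx).symm.trans (hβ' y v hy),
        fun h => ⟨β x, hβ x, by rw [h]; exact hβ y⟩⟩
      ⟨fun ⟨f, hf⟩ => huniq hf, fun h => ⟨e x, by rw [h, he]⟩⟩)⟩
  obtain ⟨w, z, hwz, hw, hz⟩ := hends (e x)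
  refine H.loopless (e x) ?_
  rw [hwz, Sym2.mk_isDiag_iff, hβ' _ _ hw, hβ' _ _ hz]
  rcases Sym2.eq_iff.mp (he x) with ⟨h1, h2⟩ | ⟨h1, h2⟩
  · rw [← h1, ← h2, hx]
  · rw [← h1, ← h2, hx]

theorem eDist_eq_eDist_iff {x y x' y' : Fin d → ℝ} :
    eDist x y = eDist x' y' ↔ ∑ i, (x i - y i) ^ 2 = ∑ i, (x' i - y' i) ^ 2 :=
  Real.sqrt_inj (Finset.sum_nonneg fun _ _ => sq_nonneg _)
    (Finset.sum_nonneg fun _ _ => sq_nonneg _)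

end Combination

/-- In a body-bar graph `G_H`, `{u,v}` is globally `d`-linked iff `uv ∈ E(G_H)` or
some `ℛ_d`-connected subgraph `G'` of `G_H` contains `u,v` with
`κ_{G'}(u,v) ≥ d+1`. -/
theorem bodyBar_globally_linked_iff_connected_subgraph
    {V E W : Type*} [Fintype V] [Fintype E] [Fintype W] [DecidableEq V]
    [DecidableEq W] (H : Multigraph V E)
    (hV : 2 ≤ Fintype.card V) (hE : 2 ≤ Fintype.card E)
    (G : SimpleGraph W) (B : V → Set W) (bar : E → W × W)
    (hbb : IsBodyBar H G B bar) (d : ℕ) (hd : 1 ≤ d)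
    (u v : W) (huv : u ≠ v) :
    GloballyLinked d G u v ↔
      (G.Adj u v ∨ ∃ F : Set (Sym2 W), F ⊆ G.edgeSet ∧ RdConnectedSet d F ∧
        u ∈ vertexSpan F ∧ v ∈ vertexSpan F ∧
        InternallyDisjointPaths (SimpleGraph.fromEdgeSet F) u v (d + 1)) := by
  obtain ⟨β, mate, hB⟩ := exists_bodyBar hbb
  have : NeZero d := ⟨by omega⟩
  by_cases hadj : G.Adj u v
  · exact ⟨fun _ => Or.inl hadj, fun _ p _ q hq => (hq u v hadj).symm⟩
  constructor
  · intro h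
    obtain ⟨p, hp⟩ := exists_generic W d
    by_cases hl : Link p G β mate u v
    · exact Or.inr (hB.exists_component hd hp hl hadj huv)
    obtain ⟨p', hp', q, hq, hne⟩ := hB.exists_equivalent_of_not_link hp hl hadj
    exact absurd (eDist_eq_eDist_iff.mp
      (h p' hp' q fun x y hxy => eDist_eq_eDist_iff.mpr (hq x y hxy))).symm hne
  · rintro (h | ⟨F, hF, hc, hu, hv, -⟩) p hp q hq
    · exact absurd h hadj
    · have hl := hB.link_of_connected hp hF hc huv hu hv hadj
      exact eDist_eq_eDist_iff.mpr (hB.dist_eq_of_link hp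
        (fun x y h => eDist_eq_eDist_iff.mp (hq x y h)) (hB.link_symm hl)).symm

end Rigidity
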